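/- arXiv:1909.11705 — 2 statements merged into one kernel-verified Lean document; each statement's English description precedes it below -/
import Mathlib

section
/- The space of minimal cubic relations among the 2×2 minors, namely the quotient ℂ-vector space (ker Ψ)_3 / (R_1·(ker Ψ)_2), where R_1·(ker Ψ)_2 is the ℂ-span of all products y·q with y a variable of R and q ∈ (ker Ψ)_2, has dimension [m(m+1)(m+2)(m−1)(m−2)(m−3)/72]·[n²(n−1)²(n+1)(n−2)/144] + [m²(m−1)²(m+1)(m−2)/144]·[n(n+1)(n+2)(n−1)(n−2)(n−3)/72]. -/
open MvPolynomial

/-- Index set for the 2×2 minors of a generic `m × n` matrix: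
quadruples `((i,i'),(j,j'))` with `i < i'` and `j < j'`. -/
def MinorIdx (m n : ℕ) : Type :=
  {w : (Fin m × Fin m) × (Fin n × Fin n) // w.1.1 < w.1.2 ∧ w.2.1 < w.2.2}

/-- The 2×2 minor `Δ_{(i,i'),(j,j')} = x_{i,j} x_{i',j'} - x_{i,j'} x_{i',j}`. -/
noncomputable def minorΔ {m n : ℕ} (w : MinorIdx m n) : MvPolynomial (Fin m × Fin n) ℂ :=
  X (w.1.1.1, w.1.2.1) * X (w.1.1.2, w.1.2.2) - X (w.1.1.1, w.1.2.2) * X (w.1.1.2, w.1.2.1)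

/-- The ℂ-algebra map `Ψ : R → S` sending `y_w` to the corresponding 2×2 minor. -/
noncomputable def Psi (m n : ℕ) :
    MvPolynomial (MinorIdx m n) ℂ →ₐ[ℂ] MvPolynomial (Fin m × Fin n) ℂ :=
  aeval minorΔ

/-- The degree `d` graded component of `ker Ψ`, as a ℂ-subspace of `R`. -/
noncomputable def kerPsiDeg (m n d : ℕ) : Submodule ℂ (MvPolynomial (MinorIdx m n) ℂ) :=
  Submodule.restrictScalars ℂ (RingHom.ker (Psi m n)) ⊓
    homogeneousSubmodule (MinorIdx m n) ℂ d

/-- `R₁·(ker Ψ)₂`: the ℂ-span of all products `y·q` with `y` a variable of `R`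
and `q ∈ (ker Ψ)₂`. -/
noncomputable def R1kerPsi2 (m n : ℕ) : Submodule ℂ (MvPolynomial (MinorIdx m n) ℂ) :=
  Submodule.span ℂ {f | ∃ w : MinorIdx m n, ∃ q ∈ kerPsiDeg m n 2, f = X w * q}

set_option linter.unusedSimpArgs false

/-! ### Part 1: computations in the group algebra of `S₆` -/

/-- The symmetric group on six letters. -/
abbrev G6 : Type := Equiv.Perm (Fin 6)

/-- The group algebra of `S₆`. -/
abbrev A6 : Type := MonoidAlgebra ℂ G6

namespace Cubic

/-- A permutation as an element of the group algebra. -/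
noncomputable def o (σ : G6) : A6 := MonoidAlgebra.of ℂ G6 σ

lemma o_mul (σ τ : G6) : o (σ * τ) = o σ * o τ := by simp [o]
lemma o_one : o 1 = 1 := by rw [o, map_one]

/-- Transpositions. -/
abbrev w (i j : Fin 6) : G6 := Equiv.swap i j

/-- Block swap of the first two blocks. -/
def s1 : G6 := w 0 2 * w 1 3
/-- Block swap of the last two blocks. -/
def s2 : G6 := w 2 4 * w 3 5
/-- Block swap of the outer two blocks. -/
def s3 : G6 := w 0 4 * w 1 5
/-- The representative of the 3-loop double coset. -/
def gg : G6 := w 1 2 * w 3 4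

/-- Antisymmetrizer over `S₂³`. -/
noncomputable def e : A6 :=
  (1 / 8 : ℂ) • ((1 - o (w 0 1)) * (1 - o (w 2 3)) * (1 - o (w 4 5)))

/-- Antisymmetrizer over block permutations. -/
noncomputable def N : A6 :=
  (1 / 6 : ℂ) • (1 - o s1 - o s2 - o s3 + o (s1 * s2) + o (s2 * s1))

/-- The basic 3-loop element. -/
noncomputable def t0 : A6 := e * o gg * e

/-- The totally antisymmetrized 3-loop element. -/
noncomputable def tau : A6 := N * t0

/-- The antisymmetrizer of the wreath product. -/
noncomputable def EE : A6 := N * e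

lemma o_sq {σ : G6} (h : σ * σ = 1) : o σ * o σ = 1 := by rw [← o_mul, h, o_one]

lemma o_comm {σ τ : G6} (h : σ * τ = τ * σ) : o σ * o τ = o τ * o σ := by
  rw [← o_mul, h, o_mul]

/-- `h` acts on `e` by the scalar `c` on both sides. -/
def IsH (h : G6) (c : ℂ) : Prop := o h * e = c • e ∧ e * o h = c • e

lemma isH01 : IsH (w 0 1) (-1) := by
  have h1 : o (w 0 1) * o (w 0 1) = 1 := o_sq (by decide)
  have h2 : o (w 0 1) * o (w 2 3) = o (w 2 3) * o (w 0 1) := o_comm (by decide)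
  have h3 : o (w 0 1) * o (w 4 5) = o (w 4 5) * o (w 0 1) := o_comm (by decide)
  have ha : o (w 0 1) * (1 - o (w 0 1)) = -(1 - o (w 0 1)) := by
    rw [mul_sub, h1]; simp
  have hb : (1 - o (w 0 1)) * o (w 0 1) = -(1 - o (w 0 1)) := by
    rw [sub_mul, h1]; simp
  have c2 : (1 - o (w 2 3)) * o (w 0 1) = o (w 0 1) * (1 - o (w 2 3)) := by
    rw [mul_sub, sub_mul, h2]; simp
  have c3 : (1 - o (w 4 5)) * o (w 0 1) = o (w 0 1) * (1 - o (w 4 5)) := by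
    rw [mul_sub, sub_mul, h3]; simp
  constructor
  · rw [e, mul_smul_comm, ← mul_assoc, ← mul_assoc, ha]; simp only [neg_mul, mul_neg, smul_neg, neg_smul, one_smul]
  · rw [e, smul_mul_assoc, mul_assoc, c3, ← mul_assoc, mul_assoc _ _ (o (w 0 1)), c2, ← mul_assoc,
      hb]; simp only [neg_mul, mul_neg, smul_neg, neg_smul, one_smul]

lemma isH23 : IsH (w 2 3) (-1) := by
  have h1 : o (w 2 3) * o (w 2 3) = 1 := o_sq (by decide)
  have h2 : o (w 2 3) * o (w 0 1) = o (w 0 1) * o (w 2 3) := o_comm (by decide)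
  have h3 : o (w 2 3) * o (w 4 5) = o (w 4 5) * o (w 2 3) := o_comm (by decide)
  have ha : o (w 2 3) * (1 - o (w 2 3)) = -(1 - o (w 2 3)) := by
    rw [mul_sub, h1]; simp
  have hb : (1 - o (w 2 3)) * o (w 2 3) = -(1 - o (w 2 3)) := by
    rw [sub_mul, h1]; simp
  have c2 : (1 - o (w 0 1)) * o (w 2 3) = o (w 2 3) * (1 - o (w 0 1)) := by
    rw [mul_sub, sub_mul, h2]; simp
  have c3 : (1 - o (w 4 5)) * o (w 2 3) = o (w 2 3) * (1 - o (w 4 5)) := by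
    rw [mul_sub, sub_mul, h3]; simp
  constructor
  · rw [e, mul_smul_comm, ← mul_assoc, ← mul_assoc, ← c2, mul_assoc (1 - o (w 0 1)), ha]; simp only [neg_mul, mul_neg, smul_neg, neg_smul, one_smul]
  · rw [e, smul_mul_assoc, mul_assoc, c3, ← mul_assoc, mul_assoc _ _ (o (w 2 3)), hb]; simp only [neg_mul, mul_neg, smul_neg, neg_smul, one_smul]

lemma isH45 : IsH (w 4 5) (-1) := by
  have h1 : o (w 4 5) * o (w 4 5) = 1 := o_sq (by decide)
  have h2 : o (w 4 5) * o (w 0 1) = o (w 0 1) * o (w 4 5) := o_comm (by decide)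
  have h3 : o (w 4 5) * o (w 2 3) = o (w 2 3) * o (w 4 5) := o_comm (by decide)
  have ha : o (w 4 5) * (1 - o (w 4 5)) = -(1 - o (w 4 5)) := by
    rw [mul_sub, h1]; simp
  have hb : (1 - o (w 4 5)) * o (w 4 5) = -(1 - o (w 4 5)) := by
    rw [sub_mul, h1]; simp
  have c2 : (1 - o (w 0 1)) * o (w 4 5) = o (w 4 5) * (1 - o (w 0 1)) := by
    rw [mul_sub, sub_mul, h2]; simp
  have c3 : (1 - o (w 2 3)) * o (w 4 5) = o (w 4 5) * (1 - o (w 2 3)) := by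
    rw [mul_sub, sub_mul, h3]; simp
  constructor
  · rw [e, mul_smul_comm, ← mul_assoc, ← mul_assoc, ← c2, mul_assoc (1 - o (w 0 1)), ← c3,
      mul_assoc, mul_assoc, ha]
    simp only [neg_mul, mul_neg, smul_neg, neg_smul, one_smul, mul_assoc]
  · rw [e, smul_mul_assoc, mul_assoc, hb]; simp only [neg_mul, mul_neg, smul_neg, neg_smul, one_smul]

lemma isH_one : IsH 1 1 := by simp [IsH, o_one]

lemma IsH.mul {h k : G6} {c d : ℂ} (hh : IsH h c) (hk : IsH k d) : IsH (h * k) (c * d) := by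
  constructor
  · rw [o_mul, mul_assoc, hk.1, mul_smul_comm, hh.1, smul_smul, mul_comm]
  · rw [o_mul, ← mul_assoc, hh.2, smul_mul_assoc, hk.2, smul_smul]

lemma e_mul_e : e * e = e := by
  have h1 : e * (1 - o (w 0 1)) = (2 : ℂ) • e := by
    rw [mul_sub, isH01.2, two_smul]; simp
  have h2 : e * (1 - o (w 2 3)) = (2 : ℂ) • e := by
    rw [mul_sub, isH23.2, two_smul]; simp
  have h3 : e * (1 - o (w 4 5)) = (2 : ℂ) • e := by
    rw [mul_sub, isH45.2, two_smul]; simp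
  conv_lhs => rw [show e * e = e * ((1 / 8 : ℂ) •
    ((1 - o (w 0 1)) * (1 - o (w 2 3)) * (1 - o (w 4 5)))) from rfl]
  rw [mul_smul_comm, ← mul_assoc, ← mul_assoc, h1, smul_mul_assoc, h2, smul_mul_assoc,
    smul_mul_assoc, h3]
  module

/-- Double coset reduction. -/
lemma dbl {h k r σ : G6} {c d : ℂ} (hh : IsH h c) (hk : IsH k d) (hσ : σ = h * r * k) :
    e * o σ * e = (c * d) • (e * o r * e) := by
  subst hσ
  rw [o_mul, o_mul, ← mul_assoc, ← mul_assoc, hh.2, mul_assoc _ (o k), hk.1]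
  simp only [smul_mul_assoc, mul_smul_comm, smul_smul]
  rw [mul_comm]

lemma s1_e : o s1 * e = e * o s1 := by
  have h1 : o s1 * o (w 0 1) = o (w 2 3) * o s1 := by
    rw [← o_mul, ← o_mul]; congr 1; decide
  have h2 : o s1 * o (w 2 3) = o (w 0 1) * o s1 := by
    rw [← o_mul, ← o_mul]; congr 1; decide
  have h3 : o s1 * o (w 4 5) = o (w 4 5) * o s1 := by
    rw [← o_mul, ← o_mul]; congr 1; decide
  have c : o (w 0 1) * o (w 2 3) = o (w 2 3) * o (w 0 1) := o_comm (by decide)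
  have k1 : o s1 * (1 - o (w 0 1)) = (1 - o (w 2 3)) * o s1 := by
    rw [mul_sub, sub_mul, h1]; simp
  have k2 : o s1 * (1 - o (w 2 3)) = (1 - o (w 0 1)) * o s1 := by
    rw [mul_sub, sub_mul, h2]; simp
  have k3 : o s1 * (1 - o (w 4 5)) = (1 - o (w 4 5)) * o s1 := by
    rw [mul_sub, sub_mul, h3]; simp
  have kc : (1 - o (w 0 1)) * (1 - o (w 2 3)) = (1 - o (w 2 3)) * (1 - o (w 0 1)) := by
    simp only [mul_sub, sub_mul, c, one_mul, mul_one]; abel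
  rw [e, mul_smul_comm, smul_mul_assoc, ← mul_assoc, ← mul_assoc, k1, mul_assoc _ (o s1), k2,
    ← mul_assoc, mul_assoc _ (o s1), k3, ← kc]
  simp only [mul_assoc]

lemma s2_e : o s2 * e = e * o s2 := by
  have h1 : o s2 * o (w 0 1) = o (w 0 1) * o s2 := by
    rw [← o_mul, ← o_mul]; congr 1; decide
  have h2 : o s2 * o (w 2 3) = o (w 4 5) * o s2 := by
    rw [← o_mul, ← o_mul]; congr 1; decide
  have h3 : o s2 * o (w 4 5) = o (w 2 3) * o s2 := by
    rw [← o_mul, ← o_mul]; congr 1; decide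
  have c : o (w 2 3) * o (w 4 5) = o (w 4 5) * o (w 2 3) := o_comm (by decide)
  have k1 : o s2 * (1 - o (w 0 1)) = (1 - o (w 0 1)) * o s2 := by
    rw [mul_sub, sub_mul, h1]; simp
  have k2 : o s2 * (1 - o (w 2 3)) = (1 - o (w 4 5)) * o s2 := by
    rw [mul_sub, sub_mul, h2]; simp
  have k3 : o s2 * (1 - o (w 4 5)) = (1 - o (w 2 3)) * o s2 := by
    rw [mul_sub, sub_mul, h3]; simp
  have kc : (1 - o (w 2 3)) * (1 - o (w 4 5)) = (1 - o (w 4 5)) * (1 - o (w 2 3)) := by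
    simp only [mul_sub, sub_mul, c, one_mul, mul_one]; abel
  rw [e, mul_smul_comm, smul_mul_assoc, ← mul_assoc, ← mul_assoc, k1, mul_assoc _ (o s2), k2,
    ← mul_assoc, mul_assoc _ (o s2), k3, mul_assoc _ (1 - o (w 2 3)), kc]
  simp only [mul_assoc]

lemma s3_eq : s3 = s1 * s2 * s1 := by decide

lemma s3_e : o s3 * e = e * o s3 := by
  rw [s3_eq, o_mul, o_mul, mul_assoc, s1_e, ← mul_assoc, mul_assoc (o s1), s2_e, ← mul_assoc, s1_e]
  simp only [mul_assoc]

lemma N_e : N * e = e * N := by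
  simp only [N, smul_mul_assoc, mul_smul_comm, sub_mul, add_mul, mul_sub, mul_add, o_mul,
    s1_e, s2_e, s3_e, one_mul, mul_one]
  congr 2
  · congr 1
    rw [mul_assoc, s2_e, ← mul_assoc, s1_e, mul_assoc]
  · rw [mul_assoc, s1_e, ← mul_assoc, s2_e, mul_assoc]

lemma s1_N : o s1 * N = -N := by
  simp only [N, mul_smul_comm, mul_sub, mul_add, ← o_mul, ← smul_neg, mul_one]
  rw [show s1 * s1 = 1 by decide, show s1 * s3 = s2 * s1 by decide,
    show s1 * (s1 * s2) = s2 by decide, show s1 * (s2 * s1) = s3 by decide, o_one]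
  congr 1; abel

lemma s2_N : o s2 * N = -N := by
  simp only [N, mul_smul_comm, mul_sub, mul_add, ← o_mul, ← smul_neg, mul_one]
  rw [show s2 * s2 = 1 by decide, show s2 * s3 = s1 * s2 by decide,
    show s2 * (s1 * s2) = s3 by decide, show s2 * (s2 * s1) = s1 by decide, o_one]
  congr 1; abel

lemma N_s1 : N * o s1 = -N := by
  simp only [N, smul_mul_assoc, sub_mul, add_mul, ← o_mul, ← smul_neg, one_mul]
  rw [show s1 * s1 = 1 by decide, show s3 * s1 = s1 * s2 by decide,
    show s2 * s1 * s1 = s2 by decide, show s1 * s2 * s1 = s3 by decide, o_one]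
  congr 1; abel

lemma N_s2 : N * o s2 = -N := by
  simp only [N, smul_mul_assoc, sub_mul, add_mul, ← o_mul, ← smul_neg, one_mul]
  rw [show s2 * s2 = 1 by decide, show s3 * s2 = s2 * s1 by decide,
    show s2 * s1 * s2 = s3 by decide, show s1 * s2 * s2 = s1 by decide, o_one]
  congr 1; abel

lemma N_s3 : N * o s3 = -N := by
  rw [s3_eq, o_mul, o_mul, ← mul_assoc, ← mul_assoc, N_s1, neg_mul, N_s2, neg_neg, N_s1]

lemma N_N : N * N = N := by
  conv_lhs => rw [show N * N = N * ((1 / 6 : ℂ) •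
    (1 - o s1 - o s2 - o s3 + o (s1 * s2) + o (s2 * s1))) from rfl]
  simp only [mul_smul_comm, mul_sub, mul_add, o_mul, ← mul_assoc, N_s1, N_s2, N_s3, neg_mul,
    neg_neg, mul_one]
  module

lemma e_t0 : e * t0 = t0 := by rw [t0, ← mul_assoc, ← mul_assoc, e_mul_e]
lemma t0_e : t0 * e = t0 := by rw [t0, mul_assoc, e_mul_e]

lemma t0_s1 : t0 * o s1 = o s2 * t0 := by
  have : e * o (gg * s1) * e = (-1 * -1 : ℂ) • (e * o (s2 * gg) * e) :=
    dbl isH01 isH45 (by decide)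
  rw [t0, mul_assoc, ← s1_e, ← mul_assoc, mul_assoc e, ← o_mul, this, o_mul, ← mul_assoc e,
    ← s2_e]
  simp [mul_assoc]

lemma t0_s2 : t0 * o s2 = o s1 * t0 := by
  have : e * o (gg * s2) * e = (-1 * -1 : ℂ) • (e * o (s1 * gg) * e) :=
    dbl isH45 isH01 (by decide)
  rw [t0, mul_assoc, ← s2_e, ← mul_assoc, mul_assoc e, ← o_mul, this, o_mul, ← mul_assoc e,
    ← s1_e]
  simp [mul_assoc]

lemma t0_s3 : t0 * o s3 = o s3 * t0 := by
  have : s3 = s2 * s1 * s2 := by decide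
  conv_rhs => rw [this]
  rw [s3_eq, o_mul, o_mul, o_mul, o_mul, ← mul_assoc, ← mul_assoc, t0_s1, mul_assoc (o s2) t0,
    t0_s2, mul_assoc (o s2), mul_assoc (o s1), t0_s1]
  simp only [mul_assoc]

lemma t0_N : t0 * N = N * t0 := by
  simp only [N, smul_mul_assoc, mul_smul_comm, sub_mul, add_mul, mul_sub, mul_add, o_mul,
    t0_s1, t0_s2, t0_s3, one_mul, mul_one, ← mul_assoc]
  rw [mul_assoc (o s2) t0, t0_s2, mul_assoc (o s1) t0, t0_s1]
  simp only [← mul_assoc]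
  refine congrArg (fun x => (1 / 6 : ℂ) • x) ?_
  abel

lemma N_tau : N * tau = tau := by rw [tau, ← mul_assoc, N_N]
lemma tau_N : tau * N = tau := by rw [tau, mul_assoc, t0_N, ← mul_assoc, N_N]
lemma tau_e : tau * e = tau := by rw [tau, mul_assoc, t0_e]
lemma e_tau : e * tau = tau := by rw [tau, ← mul_assoc, ← N_e, mul_assoc, e_t0]
lemma EE_tau : EE * tau = tau := by rw [EE, mul_assoc, e_tau, N_tau]
lemma tau_EE : tau * EE = tau := by rw [EE, ← mul_assoc, tau_N, tau_e]
lemma EE_EE : EE * EE = EE := by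
  rw [EE, mul_assoc, ← mul_assoc e, ← N_e, mul_assoc N e, e_mul_e, ← mul_assoc, N_N]

/-- A transposition across two blocks is killed by antisymmetrizing. -/
lemma N_cross {s k σ : G6} {c d : ℂ} (hs : N * o s = -N) (hse : o s * e = e * o s)
    {h : G6} (hh : IsH h c) (hk : IsH k d) (hcd : c * d = 1) (hσ : σ = h * (s * σ) * k) :
    N * (e * o σ * e) = 0 := by
  have h1 := dbl hh hk hσ
  rw [hcd, one_smul, o_mul, ← mul_assoc, ← hse] at h1
  have h2 : N * (e * o σ * e) = -(N * (e * o σ * e)) := by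
    conv_lhs => rw [h1]
    simp only [← mul_assoc, hs, neg_mul]
  have h3 : (2 : ℂ) • (N * (e * o σ * e)) = 0 := by
    rw [two_smul]; nth_rw 1 [h2]; exact neg_add_cancel _
  exact (smul_eq_zero.mp h3).resolve_left (by norm_num)

lemma N_loop {s k σ : G6} {c d ε : ℂ} (hs : N * o s = ε • N) (hse : o s * e = e * o s)
    {h : G6} (hh : IsH h c) (hk : IsH k d) (hσ : σ = h * (s * gg) * k) :
    N * (e * o σ * e) = (c * d * ε) • tau := by
  have h1 := dbl hh hk hσ
  rw [h1, o_mul, ← mul_assoc, ← hse, mul_smul_comm, mul_assoc (o s), mul_assoc (o s),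
    ← mul_assoc N, hs, tau, t0, smul_mul_assoc, smul_smul]

lemma e_expand : e = (1 / 8 : ℂ) • (1 - o (w 0 1) - o (w 2 3) - o (w 4 5) + o (w 0 1 * w 2 3)
    + o (w 0 1 * w 4 5) + o (w 2 3 * w 4 5) - o (w 0 1 * w 2 3 * w 4 5)) := by
  rw [e]
  congr 1
  simp only [mul_sub, sub_mul, o_mul, one_mul, mul_one]
  abel

lemma tau_tau : tau * tau = (1 / 8 : ℂ) • EE + (1 / 4 : ℂ) • tau := by
  have h0 : tau * tau = N * (e * (o gg * e * o gg) * e) := by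
    have : tau * tau = N * (t0 * t0) := by
      rw [tau, mul_assoc, ← mul_assoc t0 N, t0_N, ← mul_assoc, ← mul_assoc, N_N, mul_assoc]
    rw [this]
    conv_lhs => rw [t0]
    simp only [mul_assoc]
    rw [← mul_assoc e e, e_mul_e]
  have hx : o gg * e * o gg = (1 / 8 : ℂ) • (1 - o (w 0 2) - o (w 1 4) - o (w 3 5)
      + o (w 0 2 * w 1 4) + o (w 0 2 * w 3 5) + o (w 1 4 * w 3 5)
      - o (w 0 2 * w 1 4 * w 3 5)) := by
    rw [e_expand]
    simp only [mul_smul_comm, smul_mul_assoc, mul_sub, mul_add, sub_mul, add_mul, mul_one, ← o_mul]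
    rw [show gg * gg = 1 by decide, show gg * w 0 1 * gg = w 0 2 by decide,
      show gg * w 2 3 * gg = w 1 4 by decide, show gg * w 4 5 * gg = w 3 5 by decide,
      show gg * (w 0 1 * w 2 3) * gg = w 0 2 * w 1 4 by decide,
      show gg * (w 0 1 * w 4 5) * gg = w 0 2 * w 3 5 by decide,
      show gg * (w 2 3 * w 4 5) * gg = w 1 4 * w 3 5 by decide,
      show gg * (w 0 1 * w 2 3 * w 4 5) * gg = w 0 2 * w 1 4 * w 3 5 by decide, o_one]
  have a1 : N * (e * o (w 0 2) * e) = 0 :=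
    N_cross N_s1 s1_e (isH01.mul isH23) (isH01.mul isH23) (by norm_num) (by decide)
  have a2 : N * (e * o (w 1 4) * e) = 0 :=
    N_cross N_s3 s3_e isH_one (isH01.mul isH45) (by norm_num) (by decide)
  have a3 : N * (e * o (w 3 5) * e) = 0 :=
    N_cross N_s2 s2_e (isH23.mul isH45) (isH23.mul isH45) (by norm_num) (by decide)
  have e12 : o (s1 * s2) * e = e * o (s1 * s2) := by
    rw [o_mul, mul_assoc, s2_e, ← mul_assoc, s1_e, mul_assoc]
  have e21 : o (s2 * s1) * e = e * o (s2 * s1) := by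
    rw [o_mul, mul_assoc, s1_e, ← mul_assoc, s2_e, mul_assoc]
  have n12 : N * o (s1 * s2) = (1 : ℂ) • N := by
    rw [o_mul, ← mul_assoc, N_s1, neg_mul, N_s2]; simp
  have n21 : N * o (s2 * s1) = (1 : ℂ) • N := by
    rw [o_mul, ← mul_assoc, N_s2, neg_mul, N_s1]; simp
  have n3 : N * o s3 = (-1 : ℂ) • N := by rw [N_s3]; simp
  have n0 : N * o 1 = (1 : ℂ) • N := by rw [o_one]; simp
  have b1 := N_loop (σ := w 0 2 * w 1 4) n12 e12 isH_one (isH23.mul isH45) (by decide)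
  have b2 := N_loop (σ := w 0 2 * w 3 5) n0 (by simp [o_one]) (isH01.mul isH45) (isH01.mul isH45)
    (by decide)
  have b3 := N_loop (σ := w 1 4 * w 3 5) n21 e21 isH_one (isH01.mul isH23) (by decide)
  have b4 := N_loop (σ := w 0 2 * w 1 4 * w 3 5) n3 s3_e isH_one ((isH01.mul isH23).mul isH45)
    (by decide)
  rw [h0, hx]
  simp only [mul_smul_comm, smul_mul_assoc, mul_sub, mul_add, sub_mul, add_mul, mul_one]
  rw [a1, a2, a3, b1, b2, b3, b4, e_mul_e, ← EE]
  module

/-- Projection to the `(3,1,1,1)` part. -/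
noncomputable def zA : A6 := (1 / 3 : ℂ) • ((2 : ℂ) • EE - (4 : ℂ) • tau)
/-- Projection to the `(2,2,2)` part. -/
noncomputable def zB : A6 := (1 / 3 : ℂ) • (EE + (4 : ℂ) • tau)

lemma zA_zA : zA * zA = zA := by
  simp only [zA, smul_mul_assoc, mul_smul_comm, mul_sub, mul_add, sub_mul, add_mul, EE_EE,
    tau_EE, EE_tau, tau_tau]
  module
lemma zB_zB : zB * zB = zB := by
  simp only [zB, smul_mul_assoc, mul_smul_comm, mul_sub, mul_add, sub_mul, add_mul, EE_EE,
    tau_EE, EE_tau, tau_tau]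
  module
lemma zA_zB : zA * zB = 0 := by
  simp only [zA, zB, smul_mul_assoc, mul_smul_comm, mul_sub, mul_add, sub_mul, add_mul, EE_EE,
    tau_EE, EE_tau, tau_tau]
  module
lemma zB_zA : zB * zA = 0 := by
  simp only [zA, zB, smul_mul_assoc, mul_smul_comm, mul_sub, mul_add, sub_mul, add_mul, EE_EE,
    tau_EE, EE_tau, tau_tau]
  module
lemma zA_add_zB : zA + zB = EE := by
  simp only [zA, zB]; module
lemma tau_eq : tau = (-1 / 4 : ℂ) • zA + (1 / 2 : ℂ) • zB := by
  simp only [zA, zB]; module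
lemma zA_EE : zA * EE = zA := by
  rw [← zA_add_zB, mul_add, zA_zA, zA_zB, add_zero]
lemma zB_EE : zB * EE = zB := by
  rw [← zA_add_zB, mul_add, zB_zB, zB_zA, zero_add]


/-! ### Part 2: double cosets -/

/-- The fixed perfect matching, as an involution. -/
def iot : G6 := w 0 1 * w 2 3 * w 4 5

/-- The elements of `S₂³`. -/
def HL : List G6 := [1, w 0 1, w 2 3, w 4 5, w 0 1 * w 2 3, w 0 1 * w 4 5, w 2 3 * w 4 5,
  w 0 1 * w 2 3 * w 4 5]
/-- The block permutations. -/
def SL : List G6 := [1, s1, s2, s3, s1 * s2, s2 * s1]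
/-- Left translates for the double coset of `w 1 2`. -/
def LL : List G6 := [1, w 2 3, s2, w 4 5 * s2, s3, w 4 5 * s3]
/-- Representatives of the fifteen cosets of the hyperoctahedral group. -/
def QL : List G6 := [1] ++ LL.map (fun l => l * w 1 2) ++ HL.map (fun l => l * gg)

lemma centralizer_cover : ∀ σ : G6, σ * iot = iot * σ → ∃ h ∈ HL, ∃ s ∈ SL, σ = h * s := by
  decide +kernel

lemma step_cover : ∀ i : Fin 5, ∀ q ∈ QL, ∃ q' ∈ QL,
    q'⁻¹ * (Equiv.swap i.castSucc i.succ * q) * iot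
      = iot * (q'⁻¹ * (Equiv.swap i.castSucc i.succ * q)) := by
  decide +kernel

lemma cover (σ : G6) : ∃ q ∈ QL, ∃ b : G6, b * iot = iot * b ∧ σ = q * b := by
  have hσ : σ ∈ Submonoid.closure
      (Set.range fun i : Fin 5 ↦ Equiv.swap i.castSucc i.succ) := by
    rw [Equiv.Perm.mclosure_swap_castSucc_succ]; trivial
  induction hσ using Submonoid.closure_induction_left with
  | one => exact ⟨1, by simp [QL], 1, by simp, by simp⟩
  | mul_left x hx y hy ih =>
    obtain ⟨i, rfl⟩ := hx
    obtain ⟨q, hq, b, hb, rfl⟩ := ih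
    obtain ⟨q', hq', h⟩ := step_cover i q hq
    refine ⟨q', hq', q'⁻¹ * (Equiv.swap i.castSucc i.succ * q) * b, ?_, ?_⟩
    · rw [mul_assoc, hb, ← mul_assoc, h, mul_assoc]
    · simp [mul_assoc]

lemma good_induction (P : G6 → Prop) (h1 : P 1) (h12 : P (w 1 2)) (hg : P gg)
    (l01 : ∀ σ, P σ → P (w 0 1 * σ)) (l23 : ∀ σ, P σ → P (w 2 3 * σ))
    (l45 : ∀ σ, P σ → P (w 4 5 * σ)) (ls1 : ∀ σ, P σ → P (s1 * σ)) (ls2 : ∀ σ, P σ → P (s2 * σ))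
    (r01 : ∀ σ, P σ → P (σ * w 0 1)) (r23 : ∀ σ, P σ → P (σ * w 2 3))
    (r45 : ∀ σ, P σ → P (σ * w 4 5)) (rs1 : ∀ σ, P σ → P (σ * s1)) (rs2 : ∀ σ, P σ → P (σ * s2))
    (σ : G6) : P σ := by
  have ls3 : ∀ σ, P σ → P (s3 * σ) := by
    intro σ h
    have := ls1 _ (ls2 _ (ls1 _ h))
    rwa [← mul_assoc, ← mul_assoc, ← s3_eq] at this
  have rs3 : ∀ σ, P σ → P (σ * s3) := by
    intro σ h
    have := rs1 _ (rs2 _ (rs1 _ h))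
    rwa [mul_assoc, mul_assoc, ← mul_assoc s1, ← s3_eq] at this
  have hQ : ∀ q ∈ QL, P q := by
    intro q hq
    simp only [QL, LL, HL, List.map_cons, List.map_nil, List.cons_append, List.nil_append,
      List.mem_cons, List.not_mem_nil, or_false, one_mul, mul_assoc] at hq
    rcases hq with rfl | rfl | rfl | rfl | rfl | rfl | rfl | rfl | rfl | rfl | rfl | rfl | rfl |
      rfl | rfl <;>
    repeat (first
      | assumption
      | with_reducible apply l01
      | with_reducible apply l23
      | with_reducible apply l45
      | with_reducible apply ls2
      | with_reducible apply ls3)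
  obtain ⟨q, hq, b, hb, rfl⟩ := cover σ
  obtain ⟨h, hh, s, hs, rfl⟩ := centralizer_cover b hb
  have hP := hQ q hq
  have hP2 : P (q * h) := by
    simp only [HL, List.mem_cons, List.not_mem_nil, or_false] at hh
    rcases hh with rfl | rfl | rfl | rfl | rfl | rfl | rfl | rfl <;>
    (try simp only [mul_one, ← mul_assoc]) <;>
    repeat (first
      | assumption
      | with_reducible apply r01
      | with_reducible apply r23
      | with_reducible apply r45)
  rw [← mul_assoc]
  simp only [SL, List.mem_cons, List.not_mem_nil, or_false] at hs
  rcases hs with rfl | rfl | rfl | rfl | rfl | rfl <;>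
  (try simp only [mul_one, ← mul_assoc]) <;>
  repeat (first
    | assumption
    | with_reducible apply rs1
    | with_reducible apply rs2
    | with_reducible apply rs3)

/-! ### Part 3: balanced vectors -/

section Balanced

variable {T : Type*} [AddCommGroup T] [Module ℂ T] (L R : A6 →ₐ[ℂ] Module.End ℂ T) (t : T)

/-- `x` on the left factor acts on `t` as `y` on the right factor. -/
def Bal (x y : A6) : Prop := L x t = R y t

variable {L R t}

lemma Bal.add {x y x' y' : A6} (h : Bal L R t x x') (k : Bal L R t y y') :
    Bal L R t (x + y) (x' + y') := by
  simp only [Bal] at *; simp [h, k]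

lemma Bal.sub {x y x' y' : A6} (h : Bal L R t x x') (k : Bal L R t y y') :
    Bal L R t (x - y) (x' - y') := by
  simp only [Bal] at *; simp [h, k]

lemma Bal.smul {x x' : A6} (c : ℂ) (h : Bal L R t x x') : Bal L R t (c • x) (c • x') := by
  simp only [Bal] at *; simp [h]

lemma Bal.mul (hc : ∀ x y, L x * R y = R y * L x) {x y x' y' : A6} (h : Bal L R t x x')
    (k : Bal L R t y y') : Bal L R t (x * y) (y' * x') := by
  simp only [Bal] at *
  rw [map_mul, map_mul, Module.End.mul_apply, k, Module.End.mul_apply, ← h,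
    ← Module.End.mul_apply, hc, Module.End.mul_apply]

lemma Bal.congr {x y x' y' : A6} (h : Bal L R t x x') (hx : x = y) (hy : x' = y') :
    Bal L R t y y' := by subst hx hy; exact h

/-- The sum of the four transpositions across the first two blocks. -/
noncomputable def W : A6 := o (w 0 2) + o (w 0 3) + o (w 1 2) + o (w 1 3)

lemma e_W_e : e * W * e = (4 : ℂ) • (e * o (w 1 2) * e) := by
  have h1 : e * o (w 0 2) * e = (-1 * -1 : ℂ) • (e * o (w 1 2) * e) := dbl isH01 isH01 (by decide)
  have h2 : e * o (w 1 3) * e = (-1 * -1 : ℂ) • (e * o (w 1 2) * e) := dbl isH23 isH23 (by decide)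
  have h3 : e * o (w 0 3) * e = (-1 * -1 * (-1 * -1) : ℂ) • (e * o (w 1 2) * e) :=
    dbl (isH01.mul isH23) (isH01.mul isH23) (by decide)
  rw [W]
  simp only [mul_add, add_mul, h1, h2, h3]
  module

lemma e_mid_gen {p q : G6} (hp : IsH p (-1)) (hq : IsH q (-1))
    (e' : e = (1 / 8 : ℂ) • ((1 - o p) * (1 - o (w 2 3)) * (1 - o q)))
    {x y : A6} (hx : x * o p = o p * x) (hy : y * o q = o q * y) :
    (e * x * e) * (e * y * e) = (1 / 2 : ℂ) • (e * (x * y) * e - e * (x * o (w 2 3) * y) * e) := by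
  have hl : ∀ z : A6, e * (x * (o p * z)) = -(e * (x * z)) := by
    intro z
    rw [← mul_assoc x, hx, mul_assoc, ← mul_assoc e, hp.2]; simp
  have hr : ∀ z : A6, z * o q * y * e = -(z * y * e) := by
    intro z
    rw [mul_assoc z, ← hy, mul_assoc, mul_assoc, hq.1]; simp [mul_assoc]
  have h0 : (e * x * e) * (e * y * e) = e * x * e * y * e := by
    simp only [mul_assoc]; rw [← mul_assoc e e, e_mul_e]
  rw [h0]
  have h1 : e * x * e * y * e
      = (1 / 8 : ℂ) • (e * (x * ((1 - o p) * ((1 - o (w 2 3)) * (1 - o q) * y * e)))) := by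
    conv_lhs => rw [show e * x * e * y * e = e * x * (e) * y * e from rfl]
    nth_rw 2 [e']
    simp only [smul_mul_assoc, mul_smul_comm, mul_assoc]
  have h2 : ∀ z : A6, e * (x * ((1 - o p) * z)) = (2 : ℂ) • (e * (x * z)) := by
    intro z
    rw [sub_mul, mul_sub, mul_sub, hl, one_mul, two_smul]; abel
  have h3 : ∀ z : A6, z * (1 - o q) * y * e = (2 : ℂ) • (z * y * e) := by
    intro z
    rw [mul_sub, sub_mul, sub_mul, hr, mul_one, two_smul]; abel
  rw [h1, h2, h3]
  simp only [mul_smul_comm, smul_smul, sub_mul, mul_sub, one_mul, mul_assoc]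
  module

lemma e_rev : e = (1 / 8 : ℂ) • ((1 - o (w 4 5)) * (1 - o (w 2 3)) * (1 - o (w 0 1))) := by
  have c1 : o (w 0 1) * o (w 2 3) = o (w 2 3) * o (w 0 1) := o_comm (by decide)
  have c2 : o (w 0 1) * o (w 4 5) = o (w 4 5) * o (w 0 1) := o_comm (by decide)
  have c3 : o (w 2 3) * o (w 4 5) = o (w 4 5) * o (w 2 3) := o_comm (by decide)
  rw [e]; congr 1
  simp only [mul_sub, sub_mul, one_mul, mul_one, c1, c2, c3, mul_assoc]
  rw [← mul_assoc (o (w 2 3)) (o (w 4 5)), c3, mul_assoc]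
  abel

lemma c12 : (e * o (w 1 2) * e) * (e * o (w 3 4) * e) = (1 / 2 : ℂ) • (t0 + t0 * o s2) := by
  rw [e_mid_gen isH45 isH01 e_rev (o_comm (by decide)) (o_comm (by decide)), ← o_mul, ← o_mul, ← o_mul]
  have : e * o (w 1 2 * w 2 3 * w 3 4) * e = (-1 * 1 : ℂ) • (e * o (gg * s2) * e) :=
    dbl isH45 isH_one (by decide)
  rw [this, o_mul gg, ← mul_assoc e (o gg), mul_assoc _ (o s2), s2_e, t0, gg]
  simp [mul_assoc, sub_eq_add_neg]

lemma c21 : (e * o (w 3 4) * e) * (e * o (w 1 2) * e) = (1 / 2 : ℂ) • (t0 + o s2 * t0) := by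
  rw [e_mid_gen isH01 isH45 rfl (o_comm (by decide)) (o_comm (by decide)), ← o_mul, ← o_mul,
    ← o_mul]
  have : e * o (w 3 4 * w 2 3 * w 1 2) * e = (1 * -1 : ℂ) • (e * o (s2 * gg) * e) :=
    dbl isH_one isH45 (by decide)
  rw [this, o_mul s2, ← mul_assoc e (o s2), ← s2_e, t0, show w 3 4 * w 1 2 = gg by decide]
  simp [mul_assoc, sub_eq_add_neg]

/-- Balancedness of all double coset elements. -/
theorem bal_all (hc : ∀ x y, L x * R y = R y * L x)
    (hL01 : L (o (w 0 1)) t = -t) (hL23 : L (o (w 2 3)) t = -t) (hL45 : L (o (w 4 5)) t = -t)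
    (hR01 : R (o (w 0 1)) t = -t) (hR23 : R (o (w 2 3)) t = -t) (hR45 : R (o (w 4 5)) t = -t)
    (hs1 : R (o s1) (L (o s1) t) = t) (hs2 : R (o s2) (L (o s2) t) = t)
    (hW : L W t = R W t) (hAB : L zA (R zB t) = 0) (hBA : L zB (R zA t) = 0) (σ : G6) :
    Bal L R t (e * o σ * e) (e * o σ⁻¹ * e) := by
  have m := @Bal.mul T _ _ L R t hc
  have b01 : Bal L R t (o (w 0 1)) (o (w 0 1)) := hL01.trans hR01.symm
  have b23 : Bal L R t (o (w 2 3)) (o (w 2 3)) := hL23.trans hR23.symm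
  have b45 : Bal L R t (o (w 4 5)) (o (w 4 5)) := hL45.trans hR45.symm
  have b1 : Bal L R t 1 1 := by simp [Bal]
  have be : Bal L R t e e := by
    have k := (m (m (b1.sub b01) (b1.sub b23)) (b1.sub b45)).smul (1 / 8)
    exact k.congr rfl (by rw [← mul_assoc]; exact e_rev.symm)
  have bs1 : Bal L R t (o s1) (o s1) := by
    have h := congrArg (R (o s1)) hs1
    rw [← Module.End.mul_apply, ← map_mul, o_sq (by decide), map_one] at h
    exact h
  have bs2 : Bal L R t (o s2) (o s2) := by
    have h := congrArg (R (o s2)) hs2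
    rw [← Module.End.mul_apply, ← map_mul, o_sq (by decide), map_one] at h
    exact h
  have b12 : Bal L R t (o (s1 * s2)) (o (s2 * s1)) :=
    (m bs1 bs2).congr (o_mul _ _).symm (o_mul _ _).symm
  have b21 : Bal L R t (o (s2 * s1)) (o (s1 * s2)) :=
    (m bs2 bs1).congr (o_mul _ _).symm (o_mul _ _).symm
  have bs3 : Bal L R t (o s3) (o s3) :=
    (m bs1 b21).congr (by rw [← o_mul, show s1 * (s2 * s1) = s3 by decide])
      (by rw [← o_mul, show s1 * s2 * s1 = s3 by decide])
  have bN : Bal L R t N N :=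
    ((((((b1.sub bs1).sub bs2).sub bs3).add b12).add b21).smul (1 / 6)).congr rfl
      (by rw [N]; congr 1; abel)
  have bEE : Bal L R t EE EE := (m bN be).congr rfl N_e.symm
  have btau : Bal L R t tau tau := by
    have h1 : L tau t = L tau (R EE t) := by
      rw [← bEE, ← Module.End.mul_apply, ← map_mul, tau_EE]
    have h2 : R tau t = L EE (R tau t) := by
      rw [← Module.End.mul_apply, hc, Module.End.mul_apply, bEE, ← Module.End.mul_apply, ← map_mul,
        tau_EE]
    rw [Bal, h1, h2, tau_eq, ← zA_add_zB]
    simp only [map_add, map_smul, LinearMap.add_apply, LinearMap.smul_apply, hAB, hBA]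
    module
  have bc1 : Bal L R t (e * o (w 1 2) * e) (e * o (w 1 2) * e) := by
    have h : Bal L R t (e * W * e) (e * (W * e)) := m (m be hW) be
    refine (h.smul (1 / 4)).congr ?_ ?_
    · rw [e_W_e]; module
    · rw [← mul_assoc, e_W_e]; module
  have bc2 : Bal L R t (e * o (w 3 4) * e) (e * o (w 3 4) * e) := by
    have h := m (m b12 bc1) b21
    have key : o (s1 * s2) * (e * o (w 1 2) * e) * o (s2 * s1) = e * o (w 3 4) * e := by
      have e12 : o (s1 * s2) * e = e * o (s1 * s2) := by
        rw [o_mul, mul_assoc, s2_e, ← mul_assoc, s1_e, mul_assoc]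
      have e21 : e * o (s2 * s1) = o (s2 * s1) * e := by
        rw [o_mul, ← mul_assoc, ← s2_e, mul_assoc, ← s1_e, mul_assoc]
      rw [← mul_assoc, ← mul_assoc, e12, mul_assoc _ e, e21, ← mul_assoc, mul_assoc e,
        ← o_mul, mul_assoc e, ← o_mul, show s1 * s2 * w 1 2 * (s2 * s1) = w 3 4 by decide]
    exact h.congr key (by rw [← mul_assoc]; exact key)
  have u2 : Bal L R t (t0 + t0 * o s2) (t0 + o s2 * t0) := by
    refine ((m bc1 bc2).smul 2).congr ?_ ?_
    · rw [c12]; module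
    · rw [c21]; module
  have q1 : o s1 * o s1 = 1 := o_sq (by decide)
  have q2 : o s2 * o s2 = 1 := o_sq (by decide)
  have u3 : Bal L R t (t0 + t0 * o s3) (t0 + o s3 * t0) := by
    refine (m (m bs2 u2) bs1).congr ?_ ?_
    · rw [mul_add, ← mul_assoc, ← t0_s1, add_mul, mul_assoc t0, q1, mul_one, s3_eq, o_mul, o_mul]
      simp only [mul_assoc]
    · rw [add_mul, mul_assoc _ t0, t0_s2, mul_add, ← mul_assoc, q1, one_mul, s3_eq, o_mul, o_mul]
      simp only [mul_assoc]
  have u1 : Bal L R t (t0 + t0 * o s1) (t0 + o s1 * t0) := by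
    have q323 : o s2 * (o s3 * o s2) = o s1 := by
      rw [← o_mul, ← o_mul, show s2 * (s3 * s2) = s1 by decide]
    refine (m (m bs1 u3) bs2).congr ?_ ?_
    · rw [mul_add, ← mul_assoc, ← t0_s2, add_mul, mul_assoc t0, q2, mul_one, mul_assoc t0,
        mul_assoc t0, mul_assoc, q323]
    · rw [add_mul, mul_assoc _ t0, t0_s1, mul_add, ← mul_assoc, q2, one_mul, ← q323]
      simp only [mul_assoc]
  have bt0 : Bal L R t t0 t0 := by
    have h := (((((u1.add u1).add (u2.add u2)).add u3).sub (m u1 bs2)).sub (m u2 bs1)).smul (1 / 6)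
    refine (h.add btau).congr ?_ ?_
    · rw [tau, ← t0_N, N]
      simp only [mul_smul_comm, mul_add, mul_sub, add_mul, o_mul, mul_assoc, mul_one]
      module
    · rw [tau, N]
      simp only [smul_mul_assoc, mul_add, sub_mul, add_mul, o_mul, mul_assoc, one_mul]
      module
  have hl : ∀ h : G6, h⁻¹ = h → IsH h (-1) → ∀ σ, Bal L R t (e * o σ * e) (e * o σ⁻¹ * e) →
      Bal L R t (e * o (h * σ) * e) (e * o (h * σ)⁻¹ * e) := by
    intro h hi hh σ k
    refine (k.smul (-1)).congr ?_ ?_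
    · rw [o_mul, ← mul_assoc, hh.2, smul_mul_assoc, smul_mul_assoc]
    · rw [mul_inv_rev, hi, o_mul]
      simp only [mul_assoc]
      rw [hh.1, mul_smul_comm, mul_smul_comm]
  have hr : ∀ h : G6, h⁻¹ = h → IsH h (-1) → ∀ σ, Bal L R t (e * o σ * e) (e * o σ⁻¹ * e) →
      Bal L R t (e * o (σ * h) * e) (e * o (σ * h)⁻¹ * e) := by
    intro h hi hh σ k
    refine (k.smul (-1)).congr ?_ ?_
    · rw [o_mul]
      simp only [mul_assoc]
      rw [hh.1, mul_smul_comm, mul_smul_comm]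
    · rw [mul_inv_rev, hi, o_mul, ← mul_assoc, hh.2, smul_mul_assoc, smul_mul_assoc]
  have sl : ∀ s : G6, s⁻¹ = s → o s * e = e * o s → Bal L R t (o s) (o s) → ∀ σ,
      Bal L R t (e * o σ * e) (e * o σ⁻¹ * e) →
      Bal L R t (e * o (s * σ) * e) (e * o (s * σ)⁻¹ * e) := by
    intro s hi hs bs σ k
    refine (m bs k).congr ?_ ?_
    · rw [o_mul, ← mul_assoc, ← mul_assoc, hs, mul_assoc e (o s)]
    · rw [mul_inv_rev, hi, o_mul, mul_assoc, ← hs, mul_assoc e, mul_assoc e, mul_assoc (o σ⁻¹)]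
  have sr : ∀ s : G6, s⁻¹ = s → o s * e = e * o s → Bal L R t (o s) (o s) → ∀ σ,
      Bal L R t (e * o σ * e) (e * o σ⁻¹ * e) →
      Bal L R t (e * o (σ * s) * e) (e * o (σ * s)⁻¹ * e) := by
    intro s hi hs bs σ k
    refine (m k bs).congr ?_ ?_
    · rw [o_mul, mul_assoc, ← hs, mul_assoc e, mul_assoc e, mul_assoc (o σ)]
    · rw [mul_inv_rev, hi, o_mul, ← mul_assoc, ← mul_assoc, hs, mul_assoc e (o s)]
  refine good_induction (fun σ => Bal L R t (e * o σ * e) (e * o σ⁻¹ * e)) ?_ ?_ ?_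
    (hl _ (by decide) isH01) (hl _ (by decide) isH23) (hl _ (by decide) isH45)
    (sl _ (by decide) s1_e bs1) (sl _ (by decide) s2_e bs2)
    (hr _ (by decide) isH01) (hr _ (by decide) isH23) (hr _ (by decide) isH45)
    (sr _ (by decide) s1_e bs1) (sr _ (by decide) s2_e bs2) σ
  · exact be.congr (by rw [o_one, mul_one, e_mul_e]) (by rw [inv_one, o_one, mul_one, e_mul_e])
  · exact bc1.congr rfl (by rw [show (w 1 2)⁻¹ = w 1 2 by decide])
  · exact bt0.congr rfl (by rw [show gg⁻¹ = gg by decide, t0])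


end Balanced

/-! ### Part 4: matrix representation on tensors -/

lemma A6_induction {P : A6 → Prop} (x : A6) (ho : ∀ σ, P (o σ))
    (hadd : ∀ x y, P x → P y → P (x + y)) (hsmul : ∀ (c : ℂ) x, P x → P (c • x)) : P x :=
  MonoidAlgebra.induction_on x ho hadd hsmul

/-- Index type for six-fold tensors. -/
abbrev Tu (d : ℕ) : Type := Fin 6 → Fin d

/-- The permutation matrices on six-fold tensors. -/
noncomputable def Mhom (d : ℕ) : G6 →* Matrix (Tu d) (Tu d) ℂ where
  toFun σ := Matrix.of fun a b => if a ∘ σ = b then 1 else 0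
  map_one' := by
    ext a b
    simp [Matrix.one_apply]
  map_mul' σ τ := by
    ext a b
    simp only [Matrix.mul_apply, Matrix.of_apply, ite_mul, one_mul, zero_mul, Finset.sum_ite_eq,
      Finset.mem_univ, if_true, Equiv.Perm.coe_mul, Function.comp_assoc]
    congr

/-- The representation of the group algebra on six-fold tensors. -/
noncomputable def Mx (d : ℕ) : A6 →ₐ[ℂ] Matrix (Tu d) (Tu d) ℂ :=
  MonoidAlgebra.lift ℂ _ G6 (Mhom d)

lemma Mx_o (d : ℕ) (σ : G6) (a b : Tu d) : Mx d (o σ) a b = if a ∘ σ = b then 1 else 0 := by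
  simp [Mx, o, Mhom]

/-- Two-sided tensors. -/
abbrev TT (m n : ℕ) : Type := Matrix (Tu m) (Tu n) ℂ

/-- Left action. -/
noncomputable def Lf (m n : ℕ) : A6 →ₐ[ℂ] Module.End ℂ (TT m n) :=
  AlgHom.ofLinearMap (LinearMap.mk₂ ℂ (fun x t => Mx m x * t)
    (by intros; simp [Matrix.add_mul]) (by intros; simp) (by intros; simp [Matrix.mul_add])
    (by intros; simp))
    (by ext1 t; simp) (by intro x y; ext1 t; simp [Matrix.mul_assoc])

/-- Right action. -/
noncomputable def Rf (m n : ℕ) : A6 →ₐ[ℂ] Module.End ℂ (TT m n) :=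
  AlgHom.ofLinearMap (LinearMap.mk₂ ℂ (fun x t => t * (Mx n x).transpose)
    (by intros; simp [Matrix.mul_add]) (by intros; simp) (by intros; simp [Matrix.add_mul])
    (by intros; simp))
    (by ext1 t; simp) (by intro x y; ext1 t; simp [Matrix.mul_assoc])

lemma Lf_apply {m n : ℕ} (x : A6) (t : TT m n) : Lf m n x t = Mx m x * t := rfl
lemma Rf_apply {m n : ℕ} (x : A6) (t : TT m n) : Rf m n x t = t * (Mx n x).transpose := rfl

lemma Lf_o {m n : ℕ} (σ : G6) (t : TT m n) (a : Tu m) (c : Tu n) :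
    Lf m n (o σ) t a c = t (a ∘ σ) c := by
  simp [Lf_apply, Matrix.mul_apply, Mx_o]

lemma Rf_o {m n : ℕ} (σ : G6) (t : TT m n) (a : Tu m) (c : Tu n) :
    Rf m n (o σ) t a c = t a (c ∘ σ) := by
  simp [Rf_apply, Matrix.mul_apply, Mx_o]

lemma LR_comm (m n : ℕ) (x y : A6) : Lf m n x * Rf m n y = Rf m n y * Lf m n x := by
  ext1 t
  simp [Lf_apply, Rf_apply, Matrix.mul_assoc]

lemma LR_comm' {m n : ℕ} (x y : A6) (t : TT m n) :
    Lf m n x (Rf m n y t) = Rf m n y (Lf m n x t) := by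
  simp [Lf_apply, Rf_apply, Matrix.mul_assoc]

lemma LL_mul {m n : ℕ} (x y : A6) (t : TT m n) : Lf m n x (Lf m n y t) = Lf m n (x * y) t := by
  rw [map_mul]; rfl
lemma RR_mul {m n : ℕ} (x y : A6) (t : TT m n) : Rf m n x (Rf m n y t) = Rf m n (x * y) t := by
  rw [map_mul]; rfl

/-- The antipode, as an algebra map to the opposite algebra. -/
noncomputable def antip : A6 →ₐ[ℂ] A6ᵐᵒᵖ :=
  MonoidAlgebra.lift ℂ _ G6
    { toFun := fun σ => MulOpposite.op (o σ⁻¹)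
      map_one' := by simp [o_one]
      map_mul' := by intro σ τ; rw [mul_inv_rev, o_mul]; rfl }

/-- The antipode. -/
noncomputable def Sa (x : A6) : A6 := (antip x).unop

lemma Sa_o (σ : G6) : Sa (o σ) = o σ⁻¹ := by simp [Sa, antip, o]
lemma Sa_mul (x y : A6) : Sa (x * y) = Sa y * Sa x := by simp [Sa]
lemma Sa_add (x y : A6) : Sa (x + y) = Sa x + Sa y := by simp [Sa]
lemma Sa_sub (x y : A6) : Sa (x - y) = Sa x - Sa y := by simp [Sa]
lemma Sa_smul (c : ℂ) (x : A6) : Sa (c • x) = c • Sa x := by simp [Sa]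
lemma Sa_one : Sa 1 = 1 := by simp [Sa]

lemma Sa_e : Sa e = e := by
  conv_lhs => rw [e]
  simp only [Sa_smul, Sa_mul, Sa_sub, Sa_one, Sa_o, Equiv.swap_inv]
  rw [← mul_assoc]; exact e_rev.symm

lemma Sa_N : Sa N = N := by
  conv_lhs => rw [N]
  simp only [Sa_smul, Sa_add, Sa_sub, Sa_one, Sa_o]
  rw [show s1⁻¹ = s1 by decide, show s2⁻¹ = s2 by decide, show s3⁻¹ = s3 by decide,
    show (s1 * s2)⁻¹ = s2 * s1 by decide, show (s2 * s1)⁻¹ = s1 * s2 by decide, N]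
  refine congrArg (fun x => (1 / 6 : ℂ) • x) ?_
  abel

lemma Sa_t0 : Sa t0 = t0 := by
  rw [t0, Sa_mul, Sa_mul, Sa_e, Sa_o, show gg⁻¹ = gg by decide, mul_assoc]

lemma Sa_tau : Sa tau = tau := by rw [tau, Sa_mul, Sa_t0, Sa_N, t0_N]
lemma Sa_EE : Sa EE = EE := by rw [EE, Sa_mul, Sa_e, Sa_N, N_e]
lemma Sa_zA : Sa zA = zA := by rw [zA, Sa_smul, Sa_sub, Sa_smul, Sa_smul, Sa_EE, Sa_tau]
lemma Sa_zB : Sa zB = zB := by rw [zB, Sa_smul, Sa_add, Sa_smul, Sa_EE, Sa_tau]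

lemma EE_zA : EE * zA = zA := by
  rw [← zA_add_zB, add_mul, zA_zA, zB_zA, add_zero]
lemma EE_zB : EE * zB = zB := by
  rw [← zA_add_zB, add_mul, zB_zB, zA_zB, zero_add]
lemma e_EE : e * EE = EE := by rw [EE, ← mul_assoc, ← N_e, mul_assoc, e_mul_e]
lemma e_zA : e * zA = zA := by rw [← EE_zA, ← mul_assoc, e_EE]
lemma e_zB : e * zB = zB := by rw [← EE_zB, ← mul_assoc, e_EE]
lemma EE_s1 : EE * o s1 = -EE := by rw [EE, mul_assoc, ← s1_e, ← mul_assoc, N_s1, neg_mul]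
lemma EE_s2 : EE * o s2 = -EE := by rw [EE, mul_assoc, ← s2_e, ← mul_assoc, N_s2, neg_mul]
lemma EE_s3 : EE * o s3 = -EE := by rw [EE, mul_assoc, ← s3_e, ← mul_assoc, N_s3, neg_mul]
lemma EE_e : EE * e = EE := by rw [EE, mul_assoc, e_mul_e]

/-- The projection onto the new cubics. -/
noncomputable def pp (m n : ℕ) : Module.End ℂ (TT m n) :=
  Lf m n zA * Rf m n zB + Lf m n zB * Rf m n zA

lemma pp_apply {m n : ℕ} (t : TT m n) :
    pp m n t = Lf m n zA (Rf m n zB t) + Lf m n zB (Rf m n zA t) := rfl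

lemma Lf_zA_pp {m n : ℕ} (t : TT m n) : Lf m n zA (pp m n t) = Lf m n zA (Rf m n zB t) := by
  rw [pp_apply, map_add, LL_mul, LL_mul, zA_zA, zA_zB, map_zero, LinearMap.zero_apply, add_zero]

lemma Lf_zB_pp {m n : ℕ} (t : TT m n) : Lf m n zB (pp m n t) = Lf m n zB (Rf m n zA t) := by
  rw [pp_apply, map_add, LL_mul, LL_mul, zB_zA, zB_zB, map_zero, LinearMap.zero_apply, zero_add]

lemma pp_pp {m n : ℕ} (t : TT m n) : pp m n (pp m n t) = pp m n t := by
  conv_lhs => rw [pp_apply]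
  rw [LR_comm', LR_comm', Lf_zA_pp, Lf_zB_pp, ← LR_comm', ← LR_comm', RR_mul, RR_mul, zA_zA, zB_zB,
    pp_apply]

/-- `pp` only depends on the antisymmetrization. -/
lemma pp_EE {m n : ℕ} (t : TT m n) : pp m n (Lf m n EE (Rf m n EE t)) = pp m n t := by
  rw [pp_apply, pp_apply]
  simp only [← LR_comm', RR_mul, LL_mul, zA_EE, zB_EE]

/-- The Hermitian pairing. -/
noncomputable def ip {m n : ℕ} (s t : TT m n) : ℂ := ∑ a, ∑ c, star (s a c) * t a c

lemma ip_Lo {m n : ℕ} (σ : G6) (s t : TT m n) :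
    ip (Lf m n (o σ) s) t = ip s (Lf m n (o σ⁻¹) t) := by
  simp only [ip, Lf_o]
  refine Fintype.sum_equiv (Equiv.arrowCongr σ.symm (Equiv.refl _)) _ _ ?_
  intro a
  refine Finset.sum_congr rfl fun c _ => ?_
  have h1 : (Equiv.arrowCongr σ.symm (Equiv.refl (Fin m))) a = a ∘ σ := rfl
  rw [h1]
  congr 2
  funext k; simp

lemma ip_Ro {m n : ℕ} (σ : G6) (s t : TT m n) :
    ip (Rf m n (o σ) s) t = ip s (Rf m n (o σ⁻¹) t) := by
  simp only [ip, Rf_o]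
  refine Finset.sum_congr rfl fun a _ => ?_
  refine Fintype.sum_equiv (Equiv.arrowCongr σ.symm (Equiv.refl _)) _ _ ?_
  intro c
  have h1 : (Equiv.arrowCongr σ.symm (Equiv.refl (Fin n))) c = c ∘ σ := rfl
  rw [h1]
  congr 2
  funext k; simp

lemma ip_add_left {m n : ℕ} (s s' t : TT m n) : ip (s + s') t = ip s t + ip s' t := by
  simp [ip, add_mul, Finset.sum_add_distrib]
lemma ip_sub_left {m n : ℕ} (s s' t : TT m n) : ip (s - s') t = ip s t - ip s' t := by
  simp [ip, sub_mul, Finset.sum_sub_distrib]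
lemma ip_add_right {m n : ℕ} (s t t' : TT m n) : ip s (t + t') = ip s t + ip s t' := by
  simp [ip, mul_add, Finset.sum_add_distrib]
lemma ip_sub_right {m n : ℕ} (s t t' : TT m n) : ip s (t - t') = ip s t - ip s t' := by
  simp [ip, mul_sub, Finset.sum_sub_distrib]
lemma ip_zero_right {m n : ℕ} (s : TT m n) : ip s 0 = 0 := by simp [ip]
lemma ip_smul_real_left {m n : ℕ} (r : ℝ) (s t : TT m n) :
    ip ((r : ℂ) • s) t = (r : ℂ) * ip s t := by
  simp [ip, Finset.mul_sum, mul_assoc]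
lemma ip_smul_right {m n : ℕ} (r : ℂ) (s t : TT m n) :
    ip s (r • t) = r * ip s t := by
  simp only [ip, Finset.mul_sum, Matrix.smul_apply, smul_eq_mul]
  refine Finset.sum_congr rfl fun a _ => Finset.sum_congr rfl fun c _ => by ring

lemma ip_nondeg {m n : ℕ} (t : TT m n) (h : ∀ s, ip s t = 0) : t = 0 := by
  ext a c
  have := h (Matrix.single a c 1)
  rw [ip, Finset.sum_eq_single a, Finset.sum_eq_single c] at this
  · simpa using this
  · intro b _ hb; simp [Matrix.single_apply, Ne.symm hb]
  · simp
  · intro b _ hb; simp [Matrix.single_apply, Ne.symm hb]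
  · simp

lemma ip_self_re {m n : ℕ} (t : TT m n) : (ip t t).re = ∑ a, ∑ c, ‖t a c‖ ^ 2 := by
  simp only [ip, Complex.re_sum]
  refine Finset.sum_congr rfl fun a _ => Finset.sum_congr rfl fun c _ => ?_
  rw [Complex.star_def, ← Complex.normSq_eq_conj_mul_self, Complex.ofReal_re,
    Complex.normSq_eq_norm_sq]

lemma ip_self_nonneg {m n : ℕ} (t : TT m n) : 0 ≤ (ip t t).re := by
  rw [ip_self_re]; positivity

lemma ip_self_eq_zero {m n : ℕ} (t : TT m n) (h : (ip t t).re ≤ 0) : t = 0 := by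
  have h0 := le_antisymm h (ip_self_nonneg t)
  rw [ip_self_re, Finset.sum_eq_zero_iff_of_nonneg (fun a _ => by positivity)] at h0
  ext a c
  have h1 := h0 a (Finset.mem_univ _)
  rw [Finset.sum_eq_zero_iff_of_nonneg (fun a _ => by positivity)] at h1
  simpa using h1 c (Finset.mem_univ _)

lemma ip_Le {m n : ℕ} (s t : TT m n) : ip (Lf m n e s) t = ip s (Lf m n e t) := by
  have key : ∀ (i j : Fin 6) (s t : TT m n),
      ip (Lf m n (1 - o (w i j)) s) t = ip s (Lf m n (1 - o (w i j)) t) := by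
    intro i j s t
    simp only [map_sub, map_one, LinearMap.sub_apply, Module.End.one_apply, ip_sub_left,
      ip_sub_right, ip_Lo, Equiv.swap_inv]
  conv_lhs => rw [e]
  rw [e_rev, map_smul, map_smul, LinearMap.smul_apply, LinearMap.smul_apply,
    ip_smul_right, show (1 / 8 : ℂ) = ((1 / 8 : ℝ) : ℂ) by norm_num, ip_smul_real_left,
    ← LL_mul, ← LL_mul, ← LL_mul, ← LL_mul, key, key, key]

lemma ip_Leoe {m n : ℕ} (σ : G6) (s t : TT m n) :
    ip (Lf m n (e * o σ * e) s) t = ip s (Lf m n (e * o σ⁻¹ * e) t) := by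
  rw [← LL_mul, ← LL_mul, ip_Le, ip_Lo, ip_Le, LL_mul, LL_mul]

/-! ### Part 5: the variables as alternating symbols -/

noncomputable instance instFintypeMinorIdx (m n : ℕ) : Fintype (MinorIdx m n) :=
  inferInstanceAs (Fintype {w : (Fin m × Fin m) × (Fin n × Fin n) // w.1.1 < w.1.2 ∧ w.2.1 < w.2.2})

noncomputable instance instDecEqMinorIdx (m n : ℕ) : DecidableEq (MinorIdx m n) :=
  Classical.decEq _

/-- Alternating Kronecker delta. -/
noncomputable def uu {d : ℕ} (a b i j : Fin d) : ℂ :=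
  (if a = i then 1 else 0) * (if b = j then 1 else 0)
    - (if b = i then 1 else 0) * (if a = j then 1 else 0)

lemma uu_swap {d : ℕ} (a b i j : Fin d) : uu b a i j = - uu a b i j := by
  simp only [uu]; ring
lemma uu_swap' {d : ℕ} (a b i j : Fin d) : uu a b j i = - uu a b i j := by
  simp only [uu]; ring

lemma uu_ne {d : ℕ} {a b i j : Fin d} (h : a < b) (h' : i < j) (hu : uu a b i j ≠ 0) :
    a = i ∧ b = j := by
  by_contra hc
  apply hu
  have h1 : ¬ (b = i ∧ a = j) := by rintro ⟨rfl, rfl⟩; exact absurd h h'.not_gt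
  rw [uu]
  split_ifs <;> simp_all

lemma uu_sum {d : ℕ} {V : Type*} [AddCommGroup V] [Module ℂ V] (F : Fin d → Fin d → V)
    (hF : ∀ a b, F b a = - F a b) (a b : Fin d) :
    ∑ i, ∑ j, (if i < j then uu a b i j • F i j else 0) = F a b := by
  have h1 : ∀ i j, (if i < j then uu a b i j • F i j else 0)
      = (if a = i then (if b = j then (if i < j then F i j else 0) else 0) else 0)
        - (if b = i then (if a = j then (if i < j then F i j else 0) else 0) else 0) := by
    intro i j
    simp only [uu]
    split_ifs <;> simp
  simp only [h1, Finset.sum_sub_distrib, Finset.sum_ite_irrel, Finset.sum_ite_eq, Finset.mem_univ,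
    if_true, Finset.sum_const_zero]
  rcases lt_trichotomy a b with h | h | h
  · simp [h, h.not_gt]
  · subst h
    have := hF a a
    have h2 : (2 : ℂ) • F a a = 0 := by
      rw [two_smul]; nth_rw 1 [this]; exact neg_add_cancel _
    simp [(smul_eq_zero.mp h2).resolve_left (by norm_num)]
  · simp [h, h.not_gt, hF b a]

/-- Coordinates of the alternating symbol. -/
noncomputable def eps {m n : ℕ} (a b : Fin m) (c d : Fin n) (v : MinorIdx m n) : ℂ :=
  uu a b v.1.1.1 v.1.1.2 * uu c d v.1.2.1 v.1.2.2

lemma eps_sum {m n : ℕ} {V : Type*} [AddCommGroup V] [Module ℂ V]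
    (F : Fin m → Fin m → Fin n → Fin n → V)
    (h1 : ∀ a b c d, F b a c d = - F a b c d) (h2 : ∀ a b c d, F a b d c = - F a b c d)
    (a b : Fin m) (c d : Fin n) :
    ∑ v : MinorIdx m n, eps a b c d v • F v.1.1.1 v.1.1.2 v.1.2.1 v.1.2.2 = F a b c d := by
  have e1 : ∑ v : MinorIdx m n, eps a b c d v • F v.1.1.1 v.1.1.2 v.1.2.1 v.1.2.2
      = ∑ x : (Fin m × Fin m) × (Fin n × Fin n), if x.1.1 < x.1.2 ∧ x.2.1 < x.2.2 then
        (uu a b x.1.1 x.1.2 * uu c d x.2.1 x.2.2) • F x.1.1 x.1.2 x.2.1 x.2.2 else 0 := by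
    rw [← Finset.sum_filter]
    exact (Finset.sum_subtype (Finset.univ.filter
      fun x : (Fin m × Fin m) × (Fin n × Fin n) => x.1.1 < x.1.2 ∧ x.2.1 < x.2.2)
      (p := fun x => x.1.1 < x.1.2 ∧ x.2.1 < x.2.2) (by simp)
      (fun x => (uu a b x.1.1 x.1.2 * uu c d x.2.1 x.2.2) • F x.1.1 x.1.2 x.2.1 x.2.2)).symm
  rw [e1, Fintype.sum_prod_type, Fintype.sum_prod_type]
  have e2 : ∀ i j, ∑ y : Fin n × Fin n, (if i < j ∧ y.1 < y.2 then
        (uu a b i j * uu c d y.1 y.2) • F i j y.1 y.2 else 0)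
      = if i < j then uu a b i j • F i j c d else 0 := by
    intro i j
    split_ifs with hij
    · rw [Fintype.sum_prod_type, ← uu_sum (F i j) (h2 i j) c d, Finset.smul_sum]
      refine Finset.sum_congr rfl fun k _ => ?_
      rw [Finset.smul_sum]
      refine Finset.sum_congr rfl fun l _ => ?_
      simp only [hij, true_and, smul_ite, smul_zero, mul_smul]
    · simp [hij]
  simp only [e2]
  exact uu_sum (fun i j => F i j c d) (fun a b => h1 a b c d) a b

/-- The alternating symbol. -/
noncomputable def yy {m n : ℕ} (a b : Fin m) (c d : Fin n) : MvPolynomial (MinorIdx m n) ℂ :=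
  ∑ v, eps a b c d v • X v

lemma yy_swap {m n : ℕ} (a b : Fin m) (c d : Fin n) : yy b a c d = - yy a b c d := by
  simp only [yy, ← Finset.sum_neg_distrib]
  refine Finset.sum_congr rfl fun v _ => ?_
  simp [eps, uu_swap a b]
lemma yy_swap' {m n : ℕ} (a b : Fin m) (c d : Fin n) : yy a b d c = - yy a b c d := by
  simp only [yy, ← Finset.sum_neg_distrib]
  refine Finset.sum_congr rfl fun v _ => ?_
  simp [eps, uu_swap c d]

lemma yy_self {m n : ℕ} (v : MinorIdx m n) : yy v.1.1.1 v.1.1.2 v.1.2.1 v.1.2.2 = X v := by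
  rw [yy, Finset.sum_eq_single v]
  · have h1 := v.2.1
    have h2 := v.2.2
    simp [eps, uu, h1.ne, h1.ne', h2.ne, h2.ne']
  · intro v' _ hne
    have : eps v.1.1.1 v.1.1.2 v.1.2.1 v.1.2.2 v' = 0 := by
      by_contra hc
      apply hne
      have h1 := uu_ne v.2.1 v'.2.1 (left_ne_zero_of_mul hc)
      have h2 := uu_ne v.2.2 v'.2.2 (right_ne_zero_of_mul hc)
      exact Subtype.ext (Prod.ext (Prod.ext h1.1.symm h1.2.symm) (Prod.ext h2.1.symm h2.2.symm))
    rw [this, zero_smul]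
  · simp

lemma Psi_yy {m n : ℕ} (a b : Fin m) (c d : Fin n) :
    Psi m n (yy a b c d) = X (a, c) * X (b, d) - X (a, d) * X (b, c) := by
  rw [yy, map_sum]
  rw [← eps_sum (fun a b c d => (X (a, c) * X (b, d) - X (a, d) * X (b, c) :
    MvPolynomial (Fin m × Fin n) ℂ)) (by intros; ring) (by intros; ring) a b c d]
  refine Finset.sum_congr rfl fun v _ => ?_
  rw [map_smul]
  simp [Psi, minorΔ]

lemma yy_hom {m n : ℕ} (a b : Fin m) (c d : Fin n) :
    yy a b c d ∈ homogeneousSubmodule (MinorIdx m n) ℂ 1 := by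
  refine Submodule.sum_mem _ fun v _ => Submodule.smul_mem _ _ ?_
  exact (isHomogeneous_X ℂ v)

/-- Constant-coefficient derivation dual to the alternating symbol. -/
noncomputable def dy {m n : ℕ} (a b : Fin m) (c d : Fin n) :
    Derivation ℂ (MvPolynomial (MinorIdx m n) ℂ) (MvPolynomial (MinorIdx m n) ℂ) :=
  mkDerivation ℂ fun v => C (eps a b c d v)

lemma dy_X {m n : ℕ} (a b : Fin m) (c d : Fin n) (v : MinorIdx m n) :
    dy a b c d (X v) = C (eps a b c d v) := by simp [dy]

lemma dy_swap {m n : ℕ} (a b : Fin m) (c d : Fin n) : (dy b a c d) = - dy a b c d := by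
  apply MvPolynomial.derivation_ext
  intro v
  rw [Derivation.neg_apply, dy_X, dy_X, ← map_neg]
  simp [eps, uu_swap a b]
lemma dy_swap' {m n : ℕ} (a b : Fin m) (c d : Fin n) : (dy a b d c) = - dy a b c d := by
  apply MvPolynomial.derivation_ext
  intro v
  rw [Derivation.neg_apply, dy_X, dy_X, ← map_neg]
  simp [eps, uu_swap c d]

lemma dy_comm {m n : ℕ} (a b : Fin m) (c d : Fin n) (a' b' : Fin m) (c' d' : Fin n)
    (f : MvPolynomial (MinorIdx m n) ℂ) :
    dy a b c d (dy a' b' c' d' f) = dy a' b' c' d' (dy a b c d f) := by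
  have : ⁅dy a b c d, dy a' b' c' d'⁆ = 0 := by
    apply MvPolynomial.derivation_ext
    intro v
    rw [Derivation.commutator_apply, dy_X, dy_X]
    simp
  have h := congrArg (fun D => D f) this
  simp only [Derivation.commutator_apply, Derivation.zero_apply] at h
  exact sub_eq_zero.mp h

lemma dy_yy {m n : ℕ} (a b : Fin m) (c d : Fin n) (a' b' : Fin m) (c' d' : Fin n) :
    dy a b c d (yy a' b' c' d') = C (uu a b a' b' * uu c d c' d') := by
  rw [yy, map_sum]
  have := eps_sum (m := m) (n := n) (fun a' b' c' d' => uu a b a' b' * uu c d c' d')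
    (by intro p q r s; rw [uu_swap']; ring) (by intro p q r s; rw [uu_swap' _ _ r s]; ring)
    a' b' c' d'
  rw [← this, map_sum]
  refine Finset.sum_congr rfl fun v _ => ?_
  rw [Derivation.map_smul, dy_X, smul_eq_mul, C_mul, ← smul_eq_C_mul]
  rfl

/-! ### Part 6: homogeneous components -/

lemma hom_span_two {τ : Type*} (f : MvPolynomial τ ℂ) (hf : f ∈ homogeneousSubmodule τ ℂ 2) :
    f ∈ Submodule.span ℂ {g | ∃ i j : τ, g = X i * X j} := by
  classical
  rw [f.as_sum]
  refine Submodule.sum_mem _ fun d hd => ?_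
  have hdeg : d.toMultiset.card = 2 := by
    have h := (mem_homogeneousSubmodule 2 f).mp hf (mem_support_iff.mp hd)
    rw [Finsupp.card_toMultiset]
    rw [← h, Finsupp.weight_apply]; simp [Finsupp.sum]
  obtain ⟨i, j, hij⟩ := Multiset.card_eq_two.mp hdeg
  have hd' : d = Finsupp.single i 1 + Finsupp.single j 1 := by
    apply Multiset.toFinsupp.symm.injective
    rw [Multiset.toFinsupp_symm_apply, Multiset.toFinsupp_symm_apply]
    rw [hij]; simp
  have : monomial d (coeff d f) = coeff d f • (X i * X j) := by
    rw [hd', X, X, monomial_mul, smul_monomial]; simp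
  rw [this]
  exact Submodule.smul_mem _ _ (Submodule.subset_span ⟨i, j, rfl⟩)

lemma hom_span_three {τ : Type*} (f : MvPolynomial τ ℂ) (hf : f ∈ homogeneousSubmodule τ ℂ 3) :
    f ∈ Submodule.span ℂ {g | ∃ i j k : τ, g = X i * X j * X k} := by
  classical
  rw [f.as_sum]
  refine Submodule.sum_mem _ fun d hd => ?_
  have hdeg : d.toMultiset.card = 3 := by
    have h := (mem_homogeneousSubmodule 3 f).mp hf (mem_support_iff.mp hd)
    rw [Finsupp.card_toMultiset]
    rw [← h, Finsupp.weight_apply]; simp [Finsupp.sum]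
  obtain ⟨i, j, k, hij⟩ := Multiset.card_eq_three.mp hdeg
  have hd' : d = Finsupp.single i 1 + Finsupp.single j 1 + Finsupp.single k 1 := by
    apply Multiset.toFinsupp.symm.injective
    rw [Multiset.toFinsupp_symm_apply, Multiset.toFinsupp_symm_apply]
    rw [hij]; simp
  have : monomial d (coeff d f) = coeff d f • (X i * X j * X k) := by
    rw [hd', X, X, X, monomial_mul, monomial_mul, smul_monomial]; simp
  rw [this]
  exact Submodule.smul_mem _ _ (Submodule.subset_span ⟨i, j, k, rfl⟩)

/-! ### Part 7: cubics as tensors -/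

/-- The cubic attached to a pair of index tuples. -/
noncomputable def y3 {m n : ℕ} (a : Tu m) (c : Tu n) : MvPolynomial (MinorIdx m n) ℂ :=
  yy (a 0) (a 1) (c 0) (c 1) * yy (a 2) (a 3) (c 2) (c 3) * yy (a 4) (a 5) (c 4) (c 5)

/-- The map from tensors to cubics. -/
noncomputable def rho (m n : ℕ) : TT m n →ₗ[ℂ] MvPolynomial (MinorIdx m n) ℂ where
  toFun t := ∑ a, ∑ c, t a c • y3 a c
  map_add' s t := by simp [add_smul, Finset.sum_add_distrib]
  map_smul' r t := by simp [mul_smul, Finset.smul_sum]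

lemma rho_apply {m n : ℕ} (t : TT m n) : rho m n t = ∑ a, ∑ c, t a c • y3 a c := rfl

lemma rho_single {m n : ℕ} (a : Tu m) (c : Tu n) : rho m n (Matrix.single a c 1) = y3 a c := by
  rw [rho_apply, Finset.sum_eq_single a, Finset.sum_eq_single c]
  · simp
  · intro b _ hb; simp [Matrix.single_apply, Ne.symm hb]
  · simp
  · intro b _ hb; simp [Matrix.single_apply, Ne.symm hb]
  · simp

lemma y3_hom {m n : ℕ} (a : Tu m) (c : Tu n) :
    y3 a c ∈ homogeneousSubmodule (MinorIdx m n) ℂ 3 := by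
  have h := IsHomogeneous.mul (IsHomogeneous.mul (yy_hom (a 0) (a 1) (c 0) (c 1))
    (yy_hom (a 2) (a 3) (c 2) (c 3))) (yy_hom (a 4) (a 5) (c 4) (c 5))
  exact h

lemma rho_hom {m n : ℕ} (t : TT m n) : rho m n t ∈ homogeneousSubmodule (MinorIdx m n) ℂ 3 := by
  rw [rho_apply]
  exact Submodule.sum_mem _ fun a _ => Submodule.sum_mem _ fun c _ =>
    Submodule.smul_mem _ _ (y3_hom a c)

lemma rho_surj {m n : ℕ} (f : MvPolynomial (MinorIdx m n) ℂ)
    (hf : f ∈ homogeneousSubmodule (MinorIdx m n) ℂ 3) : ∃ t, rho m n t = f := by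
  have h := hom_span_three f hf
  have h2 : Submodule.span ℂ {g | ∃ i j k : MinorIdx m n, g = X i * X j * X k}
      ≤ LinearMap.range (rho m n) := by
    rw [Submodule.span_le]
    rintro g ⟨i, j, k, rfl⟩
    refine ⟨Matrix.single ![i.1.1.1, i.1.1.2, j.1.1.1, j.1.1.2, k.1.1.1, k.1.1.2]
      ![i.1.2.1, i.1.2.2, j.1.2.1, j.1.2.2, k.1.2.1, k.1.2.2] 1, ?_⟩
    rw [rho_single, ← yy_self i, ← yy_self j, ← yy_self k]
    rfl
  exact h2 h

lemma rho_Lo {m n : ℕ} (σ : G6) (t : TT m n) :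
    rho m n (Lf m n (o σ) t) = ∑ a, ∑ c, t a c • y3 (a ∘ ⇑σ⁻¹) c := by
  simp only [rho_apply, Lf_o]
  refine Fintype.sum_equiv (Equiv.arrowCongr σ.symm (Equiv.refl _)) _ _ ?_
  intro a
  have h1 : (Equiv.arrowCongr σ.symm (Equiv.refl (Fin m))) a = a ∘ σ := rfl
  have h2 : (a ∘ σ) ∘ ⇑σ⁻¹ = a := by funext k; simp
  simp only [h1, h2]

lemma rho_Ro {m n : ℕ} (σ : G6) (t : TT m n) :
    rho m n (Rf m n (o σ) t) = ∑ a, ∑ c, t a c • y3 a (c ∘ ⇑σ⁻¹) := by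
  simp only [rho_apply, Rf_o]
  refine Finset.sum_congr rfl fun a _ => ?_
  refine Fintype.sum_equiv (Equiv.arrowCongr σ.symm (Equiv.refl _)) _ _ ?_
  intro c
  have h1 : (Equiv.arrowCongr σ.symm (Equiv.refl (Fin n))) c = c ∘ σ := rfl
  have h2 : (c ∘ σ) ∘ ⇑σ⁻¹ = c := by funext k; simp
  simp only [h1, h2]

lemma rho_L_neg {m n : ℕ} (σ : G6) (h : ∀ (a : Tu m) (c : Tu n), y3 (a ∘ ⇑σ⁻¹) c = - y3 a c)
    (t : TT m n) : rho m n (Lf m n (o σ) t) = - rho m n t := by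
  rw [rho_Lo]; simp only [h, rho_apply, smul_neg, Finset.sum_neg_distrib]

lemma rho_R_neg {m n : ℕ} (σ : G6) (h : ∀ (a : Tu m) (c : Tu n), y3 a (c ∘ ⇑σ⁻¹) = - y3 a c)
    (t : TT m n) : rho m n (Rf m n (o σ) t) = - rho m n t := by
  rw [rho_Ro]; simp only [h, rho_apply, smul_neg, Finset.sum_neg_distrib]

lemma rho_LR {m n : ℕ} (σ : G6)
    (h : ∀ (a : Tu m) (c : Tu n), y3 (a ∘ ⇑σ⁻¹) (c ∘ ⇑σ⁻¹) = y3 a c)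
    (t : TT m n) : rho m n (Rf m n (o σ) (Lf m n (o σ) t)) = rho m n t := by
  rw [rho_Ro, rho_apply]
  simp only [Lf_o]
  refine Fintype.sum_equiv (Equiv.arrowCongr σ.symm (Equiv.refl _)) _ _ ?_
  intro a
  have h1 : (Equiv.arrowCongr σ.symm (Equiv.refl (Fin m))) a = a ∘ σ := rfl
  refine Finset.sum_congr rfl fun c _ => ?_
  rw [h1, ← h (a ∘ σ)]
  have h2 : (a ∘ σ) ∘ ⇑σ⁻¹ = a := by funext k; simp
  rw [h2]

lemma y3_L01 {m n : ℕ} (a : Tu m) (c : Tu n) : y3 (a ∘ ⇑(w 0 1)⁻¹) c = - y3 a c := by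
  rw [show (w 0 1)⁻¹ = w 0 1 by decide]
  simp only [y3, Function.comp, show w 0 1 0 = 1 by decide, show w 0 1 1 = 0 by decide,
    show w 0 1 2 = 2 by decide, show w 0 1 3 = 3 by decide, show w 0 1 4 = 4 by decide,
    show w 0 1 5 = 5 by decide, yy_swap (a 0) (a 1)]
  ring
lemma y3_L23 {m n : ℕ} (a : Tu m) (c : Tu n) : y3 (a ∘ ⇑(w 2 3)⁻¹) c = - y3 a c := by
  rw [show (w 2 3)⁻¹ = w 2 3 by decide]
  simp only [y3, Function.comp, show w 2 3 0 = 0 by decide, show w 2 3 1 = 1 by decide,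
    show w 2 3 2 = 3 by decide, show w 2 3 3 = 2 by decide, show w 2 3 4 = 4 by decide,
    show w 2 3 5 = 5 by decide, yy_swap (a 2) (a 3)]
  ring
lemma y3_L45 {m n : ℕ} (a : Tu m) (c : Tu n) : y3 (a ∘ ⇑(w 4 5)⁻¹) c = - y3 a c := by
  rw [show (w 4 5)⁻¹ = w 4 5 by decide]
  simp only [y3, Function.comp, show w 4 5 0 = 0 by decide, show w 4 5 1 = 1 by decide,
    show w 4 5 2 = 2 by decide, show w 4 5 3 = 3 by decide, show w 4 5 4 = 5 by decide,
    show w 4 5 5 = 4 by decide, yy_swap (a 4) (a 5)]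
  ring
lemma y3_R01 {m n : ℕ} (a : Tu m) (c : Tu n) : y3 a (c ∘ ⇑(w 0 1)⁻¹) = - y3 a c := by
  rw [show (w 0 1)⁻¹ = w 0 1 by decide]
  simp only [y3, Function.comp, show w 0 1 0 = 1 by decide, show w 0 1 1 = 0 by decide,
    show w 0 1 2 = 2 by decide, show w 0 1 3 = 3 by decide, show w 0 1 4 = 4 by decide,
    show w 0 1 5 = 5 by decide, yy_swap' _ _ (c 0) (c 1)]
  ring
lemma y3_R23 {m n : ℕ} (a : Tu m) (c : Tu n) : y3 a (c ∘ ⇑(w 2 3)⁻¹) = - y3 a c := by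
  rw [show (w 2 3)⁻¹ = w 2 3 by decide]
  simp only [y3, Function.comp, show w 2 3 0 = 0 by decide, show w 2 3 1 = 1 by decide,
    show w 2 3 2 = 3 by decide, show w 2 3 3 = 2 by decide, show w 2 3 4 = 4 by decide,
    show w 2 3 5 = 5 by decide, yy_swap' _ _ (c 2) (c 3)]
  ring
lemma y3_R45 {m n : ℕ} (a : Tu m) (c : Tu n) : y3 a (c ∘ ⇑(w 4 5)⁻¹) = - y3 a c := by
  rw [show (w 4 5)⁻¹ = w 4 5 by decide]
  simp only [y3, Function.comp, show w 4 5 0 = 0 by decide, show w 4 5 1 = 1 by decide,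
    show w 4 5 2 = 2 by decide, show w 4 5 3 = 3 by decide, show w 4 5 4 = 5 by decide,
    show w 4 5 5 = 4 by decide, yy_swap' _ _ (c 4) (c 5)]
  ring
lemma y3_s1 {m n : ℕ} (a : Tu m) (c : Tu n) : y3 (a ∘ ⇑s1⁻¹) (c ∘ ⇑s1⁻¹) = y3 a c := by
  rw [show s1⁻¹ = s1 by decide]
  simp only [y3, Function.comp, show s1 0 = 2 by decide, show s1 1 = 3 by decide,
    show s1 2 = 0 by decide, show s1 3 = 1 by decide, show s1 4 = 4 by decide,
    show s1 5 = 5 by decide]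
  ring
lemma y3_s2 {m n : ℕ} (a : Tu m) (c : Tu n) : y3 (a ∘ ⇑s2⁻¹) (c ∘ ⇑s2⁻¹) = y3 a c := by
  rw [show s2⁻¹ = s2 by decide]
  simp only [y3, Function.comp, show s2 0 = 0 by decide, show s2 1 = 1 by decide,
    show s2 2 = 4 by decide, show s2 3 = 5 by decide, show s2 4 = 2 by decide,
    show s2 5 = 3 by decide]
  ring

lemma rho_W {m n : ℕ} (t : TT m n) : rho m n (Lf m n W t - Rf m n W t) ∈ R1kerPsi2 m n := by
  have hR : ∀ (a b : Fin m) (c d : Fin n) (q), q ∈ kerPsiDeg m n 2 →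
      q * yy a b c d ∈ R1kerPsi2 m n := by
    intro a b c d q hq
    rw [yy, Finset.mul_sum]
    refine Submodule.sum_mem _ fun v _ => ?_
    rw [mul_smul_comm, mul_comm]
    exact Submodule.smul_mem _ _ (Submodule.subset_span ⟨v, q, hq, rfl⟩)
  have hyy : ∀ (a b a' b' : Fin m) (c d c' d' : Fin n), yy a b c d * yy a' b' c' d' ∈
      homogeneousSubmodule (MinorIdx m n) ℂ 2 := by
    intro a b a' b' c d c' d'
    exact IsHomogeneous.mul (yy_hom a b c d) (yy_hom a' b' c' d')
  have hq : ∀ (a0 a1 a2 a3 : Fin m) (c0 c1 c2 c3 : Fin n),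
      (yy a2 a1 c0 c1 * yy a0 a3 c2 c3 + yy a3 a1 c0 c1 * yy a2 a0 c2 c3
        + yy a0 a2 c0 c1 * yy a1 a3 c2 c3 + yy a0 a3 c0 c1 * yy a2 a1 c2 c3)
      - (yy a0 a1 c2 c1 * yy a2 a3 c0 c3 + yy a0 a1 c3 c1 * yy a2 a3 c2 c0
        + yy a0 a1 c0 c2 * yy a2 a3 c1 c3 + yy a0 a1 c0 c3 * yy a2 a3 c2 c1)
      ∈ kerPsiDeg m n 2 := by
    intro a0 a1 a2 a3 c0 c1 c2 c3
    refine ⟨?_, ?_⟩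
    · simp only [Submodule.coe_restrictScalars, SetLike.mem_coe, RingHom.mem_ker, map_sub, map_add,
        map_mul, Psi_yy]
      ring
    · refine Submodule.sub_mem _ (Submodule.add_mem _ (Submodule.add_mem _ (Submodule.add_mem _ ?_ ?_)
        ?_) ?_) (Submodule.add_mem _ (Submodule.add_mem _ (Submodule.add_mem _ ?_ ?_)
        ?_) ?_) <;> exact hyy _ _ _ _ _ _ _ _
  simp only [W, map_add, LinearMap.add_apply, map_sub, rho_Lo, rho_Ro, Equiv.swap_inv]
  simp only [← Finset.sum_add_distrib, ← Finset.sum_sub_distrib, ← smul_add, ← smul_sub]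
  refine Submodule.sum_mem _ fun a _ => Submodule.sum_mem _ fun c _ => Submodule.smul_mem _ _ ?_
  convert hR (a 4) (a 5) (c 4) (c 5) _ (hq (a 0) (a 1) (a 2) (a 3) (c 0) (c 1) (c 2) (c 3)) using 1
  simp only [y3, Function.comp,
    show w 0 2 0 = 2 by decide, show w 0 2 1 = 1 by decide, show w 0 2 2 = 0 by decide,
    show w 0 2 3 = 3 by decide, show w 0 2 4 = 4 by decide, show w 0 2 5 = 5 by decide,
    show w 0 3 0 = 3 by decide, show w 0 3 1 = 1 by decide, show w 0 3 2 = 2 by decide,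
    show w 0 3 3 = 0 by decide, show w 0 3 4 = 4 by decide, show w 0 3 5 = 5 by decide,
    show w 1 2 0 = 0 by decide, show w 1 2 1 = 2 by decide, show w 1 2 2 = 1 by decide,
    show w 1 2 3 = 3 by decide, show w 1 2 4 = 4 by decide, show w 1 2 5 = 5 by decide,
    show w 1 3 0 = 0 by decide, show w 1 3 1 = 3 by decide, show w 1 3 2 = 2 by decide,
    show w 1 3 3 = 1 by decide, show w 1 3 4 = 4 by decide, show w 1 3 5 = 5 by decide]
  ring

/-! ### Part 8: evaluation into the coordinate ring -/

/-- The degree six monomial attached to a pair of tuples. -/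
noncomputable def mon {m n : ℕ} (a : Tu m) (c : Tu n) : MvPolynomial (Fin m × Fin n) ℂ :=
  ∏ k, X (a k, c k)

/-- Evaluate a tensor as a polynomial. -/
noncomputable def xi (m n : ℕ) : TT m n →ₗ[ℂ] MvPolynomial (Fin m × Fin n) ℂ where
  toFun t := ∑ a, ∑ c, t a c • mon a c
  map_add' s t := by simp [add_smul, Finset.sum_add_distrib]
  map_smul' r t := by simp [mul_smul, Finset.smul_sum]

lemma xi_apply {m n : ℕ} (t : TT m n) : xi m n t = ∑ a, ∑ c, t a c • mon a c := rfl

lemma mon_comp {m n : ℕ} (σ : G6) (a : Tu m) (c : Tu n) : mon (a ∘ σ) (c ∘ σ) = mon a c := by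
  simp only [mon, Function.comp]
  exact Equiv.prod_comp σ (fun k => (X (a k, c k) : MvPolynomial (Fin m × Fin n) ℂ))

lemma xi_Ro {m n : ℕ} (σ : G6) (t : TT m n) :
    xi m n (Rf m n (o σ) t) = ∑ a, ∑ c, t a c • mon a (c ∘ ⇑σ⁻¹) := by
  simp only [xi_apply, Rf_o]
  refine Finset.sum_congr rfl fun a _ => ?_
  refine Fintype.sum_equiv (Equiv.arrowCongr σ.symm (Equiv.refl _)) _ _ ?_
  intro c
  have h1 : (Equiv.arrowCongr σ.symm (Equiv.refl (Fin n))) c = c ∘ σ := rfl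
  have h2 : (c ∘ σ) ∘ ⇑σ⁻¹ = c := by funext k; simp
  simp only [h1, h2]

lemma xi_Lo {m n : ℕ} (σ : G6) (t : TT m n) :
    xi m n (Lf m n (o σ) t) = xi m n (Rf m n (o σ⁻¹) t) := by
  rw [xi_Ro]
  simp only [xi_apply, Lf_o]
  refine Fintype.sum_equiv (Equiv.arrowCongr σ.symm (Equiv.refl _)) _ _ ?_
  intro a
  have h1 : (Equiv.arrowCongr σ.symm (Equiv.refl (Fin m))) a = a ∘ σ := rfl
  simp only [h1, inv_inv, mon_comp]

lemma xi_L {m n : ℕ} (x : A6) (t : TT m n) : xi m n (Lf m n x t) = xi m n (Rf m n (Sa x) t) := by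
  induction x using A6_induction with
  | ho σ => rw [xi_Lo, Sa_o]
  | hadd x y hx hy => simp only [Sa_add, map_add, LinearMap.add_apply, hx, hy]
  | hsmul c x hx => simp only [Sa_smul, map_smul, LinearMap.smul_apply, hx]

lemma xi_pp {m n : ℕ} (t : TT m n) : xi m n (pp m n t) = 0 := by
  rw [pp_apply, map_add, xi_L, xi_L, RR_mul, RR_mul, Sa_zA, Sa_zB, zA_zB, zB_zA]
  simp

lemma Psi_rho {m n : ℕ} (t : TT m n) :
    Psi m n (rho m n t) = (8 : ℂ) • xi m n (Rf m n e t) := by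
  rw [e_expand]
  simp only [map_add, map_sub, map_smul, LinearMap.add_apply, LinearMap.sub_apply,
    LinearMap.smul_apply]
  rw [smul_smul, show (8 * (1 / 8) : ℂ) = 1 by norm_num, one_smul, ← o_one]
  simp only [xi_Ro]
  rw [rho_apply, map_sum]
  simp only [← Finset.sum_add_distrib, ← Finset.sum_sub_distrib, ← smul_add, ← smul_sub]
  refine Finset.sum_congr rfl fun a _ => ?_
  rw [map_sum]
  refine Finset.sum_congr rfl fun c _ => ?_
  rw [map_smul]
  congr 1
  rw [show (w 0 1 * w 2 3)⁻¹ = w 0 1 * w 2 3 by decide,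
    show (w 0 1 * w 4 5)⁻¹ = w 0 1 * w 4 5 by decide,
    show (w 2 3 * w 4 5)⁻¹ = w 2 3 * w 4 5 by decide,
    show (w 0 1 * w 2 3 * w 4 5)⁻¹ = w 0 1 * w 2 3 * w 4 5 by decide]
  simp only [y3, map_mul, Psi_yy, mon, Fin.prod_univ_six, Function.comp, Equiv.Perm.coe_mul,
    Equiv.swap_inv, inv_one, Equiv.Perm.coe_one, id,
    show w 0 1 0 = 1 by decide, show w 0 1 1 = 0 by decide,
    show w 0 1 2 = 2 by decide, show w 0 1 3 = 3 by decide, show w 0 1 4 = 4 by decide,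
    show w 0 1 5 = 5 by decide,
    show w 2 3 0 = 0 by decide, show w 2 3 1 = 1 by decide,
    show w 2 3 2 = 3 by decide, show w 2 3 3 = 2 by decide, show w 2 3 4 = 4 by decide,
    show w 2 3 5 = 5 by decide,
    show w 4 5 0 = 0 by decide, show w 4 5 1 = 1 by decide,
    show w 4 5 2 = 2 by decide, show w 4 5 3 = 3 by decide, show w 4 5 4 = 5 by decide,
    show w 4 5 5 = 4 by decide]
  ring

lemma Psi_rho_pp {m n : ℕ} (t : TT m n) : Psi m n (rho m n (pp m n t)) = 0 := by
  have h : Rf m n e (pp m n t) = pp m n t := by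
    rw [pp_apply, map_add, ← LR_comm', ← LR_comm', RR_mul, RR_mul, e_zA, e_zB]
  rw [Psi_rho, h, xi_pp, smul_zero]

/-! ### Part 9: coefficient extraction -/

lemma exists_perm_of_count {B : Type*} [DecidableEq B] (b b' : Fin 6 → B)
    (h : ∑ k, Finsupp.single (b k) 1 = ∑ k, (Finsupp.single (b' k) 1 : B →₀ ℕ)) :
    ∃ σ : G6, b ∘ σ = b' := by
  have hc : ∀ x, Fintype.card {k // b' k = x} = Fintype.card {k // b k = x} := by
    intro x
    have := DFunLike.congr_fun h x
    simp only [Finsupp.coe_finsetSum, Finset.sum_apply, Finsupp.single_apply] at this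
    rw [Fintype.card_subtype, Fintype.card_subtype, Finset.card_filter, Finset.card_filter, this]
  refine ⟨Equiv.ofFiberEquiv (fun x => Fintype.equivOfCardEq (hc x)), ?_⟩
  funext k
  exact Equiv.ofFiberEquiv_map _ k

lemma sym_sum_zero {B : Type*} [Fintype B] [DecidableEq B] (f : (Fin 6 → B) → ℂ)
    (h : ∑ b, f b • (∏ k, X (b k) : MvPolynomial B ℂ) = 0) (b0 : Fin 6 → B) :
    ∑ σ : G6, f (b0 ∘ σ) = 0 := by
  have hm : ∀ b : Fin 6 → B, (∏ k, X (b k) : MvPolynomial B ℂ)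
      = monomial (∑ k, Finsupp.single (b k) 1) 1 := by
    intro b; rw [monomial_sum_one]; rfl
  have hco := congrArg (coeff (∑ k, Finsupp.single (b0 k) 1)) h
  simp only [hm, coeff_sum, coeff_smul, coeff_monomial, coeff_zero, smul_eq_mul, mul_ite, mul_one,
    mul_zero] at hco
  have key : ∀ b : Fin 6 → B, (((Finset.univ.filter fun σ : G6 => b0 ∘ σ = b).card : ℕ) : ℂ) * f b
      = ((Finset.univ.filter fun σ : G6 => b0 ∘ σ = b0).card : ℂ) *
        (if ∑ k, Finsupp.single (b k) 1 = ∑ k, (Finsupp.single (b0 k) 1 : B →₀ ℕ)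
          then f b else 0) := by
    intro b
    split_ifs with hb
    · obtain ⟨τ, hτ⟩ := exists_perm_of_count b0 b hb.symm
      congr 2
      refine Finset.card_bij (fun σ _ => σ * τ⁻¹) ?_ ?_ ?_
      · intro σ hσ
        simp only [Finset.mem_filter, Finset.mem_univ, true_and] at hσ ⊢
        rw [Equiv.Perm.coe_mul, ← Function.comp_assoc, hσ, ← hτ]
        funext k; simp
      · intro σ _ σ' _ hh
        exact mul_right_cancel hh
      · intro σ hσ
        simp only [Finset.mem_filter, Finset.mem_univ, true_and] at hσ
        refine ⟨σ * τ, ?_, by simp⟩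
        simp only [Finset.mem_filter, Finset.mem_univ, true_and]
        rw [Equiv.Perm.coe_mul, ← Function.comp_assoc, hσ, hτ]
    · have : (Finset.univ.filter fun σ : G6 => b0 ∘ σ = b) = ∅ := by
        rw [Finset.filter_eq_empty_iff]
        rintro σ _ rfl
        apply hb
        exact Equiv.sum_comp σ (fun k => (Finsupp.single (b0 k) 1 : B →₀ ℕ))
      rw [this]; simp
  have h1 : ∑ σ : G6, f (b0 ∘ σ)
      = ∑ b, (((Finset.univ.filter fun σ : G6 => b0 ∘ σ = b).card : ℕ) : ℂ) * f b := by
    rw [← Finset.sum_fiberwise (s := Finset.univ) (g := fun σ : G6 => b0 ∘ σ)]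
    refine Finset.sum_congr rfl fun b _ => ?_
    rw [← nsmul_eq_mul, ← Finset.sum_const]
    refine Finset.sum_congr rfl fun σ hσ => ?_
    rw [(Finset.mem_filter.mp hσ).2]
  rw [h1, Finset.sum_congr rfl (fun b _ => key b), ← Finset.mul_sum, hco, mul_zero]

lemma xi_zero {m n : ℕ} (t : TT m n) (h : xi m n t = 0) :
    ∑ σ : G6, Lf m n (o σ) (Rf m n (o σ) t) = 0 := by
  have h2 : ∑ b : Fin 6 → Fin m × Fin n, t (fun k => (b k).1) (fun k => (b k).2) •
      (∏ k, X (b k) : MvPolynomial (Fin m × Fin n) ℂ) = 0 := by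
    rw [← h, xi_apply, ← Fintype.sum_prod_type']
    exact Fintype.sum_equiv (Equiv.arrowProdEquivProdArrow (Fin 6) (fun _ => Fin m) (fun _ => Fin n))
      _ _ (fun b => rfl)
  ext a c
  have := sym_sum_zero _ h2 (fun k => (a k, c k))
  rw [Matrix.sum_apply]
  simp only [Lf_o, Rf_o, Matrix.zero_apply]
  exact this

/-! ### Part 10: no cubic relation is orthogonal to everything -/

/-- Tensors representing decomposable relations. -/
noncomputable def YY (m n : ℕ) : Submodule ℂ (TT m n) := (R1kerPsi2 m n).comap (rho m n)

theorem final_zero {m n : ℕ} (t : TT m n) (hZ : Psi m n (rho m n t) = 0)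
    (hp : pp m n t = 0) (hY : ∀ y ∈ YY m n, ip y t = 0) : t = 0 := by
  have hk : ∀ y, rho m n y = 0 → ip y t = 0 := by
    intro y hy
    apply hY
    change rho m n y ∈ R1kerPsi2 m n
    rw [hy]; exact Submodule.zero_mem _
  have hL : ∀ σ : G6, σ⁻¹ = σ → (∀ (a : Tu m) (c : Tu n), y3 (a ∘ ⇑σ⁻¹) c = - y3 a c) →
      Lf m n (o σ) t = - t := by
    intro σ hi hσ
    rw [← sub_eq_zero, sub_neg_eq_add]
    apply ip_nondeg
    intro s
    have := hk (Lf m n (o σ) s + s) (by rw [map_add, rho_L_neg σ hσ, neg_add_cancel])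
    rwa [ip_add_left, ip_Lo, hi, ← ip_add_right] at this
  have hR : ∀ σ : G6, σ⁻¹ = σ → (∀ (a : Tu m) (c : Tu n), y3 a (c ∘ ⇑σ⁻¹) = - y3 a c) →
      Rf m n (o σ) t = - t := by
    intro σ hi hσ
    rw [← sub_eq_zero, sub_neg_eq_add]
    apply ip_nondeg
    intro s
    have := hk (Rf m n (o σ) s + s) (by rw [map_add, rho_R_neg σ hσ, neg_add_cancel])
    rwa [ip_add_left, ip_Ro, hi, ← ip_add_right] at this
  have hS : ∀ σ : G6, σ⁻¹ = σ →
      (∀ (a : Tu m) (c : Tu n), y3 (a ∘ ⇑σ⁻¹) (c ∘ ⇑σ⁻¹) = y3 a c) →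
      Rf m n (o σ) (Lf m n (o σ) t) = t := by
    intro σ hi hσ
    rw [← sub_eq_zero]
    apply ip_nondeg
    intro s
    have := hk (Rf m n (o σ) (Lf m n (o σ) s) - s) (by rw [map_sub, rho_LR σ hσ, sub_self])
    rwa [ip_sub_left, ip_Ro, ip_Lo, hi, ← ip_sub_right, LR_comm'] at this
  have hL01 := hL (w 0 1) (by decide) y3_L01
  have hL23 := hL (w 2 3) (by decide) y3_L23
  have hL45 := hL (w 4 5) (by decide) y3_L45
  have hR01 := hR (w 0 1) (by decide) y3_R01
  have hR23 := hR (w 2 3) (by decide) y3_R23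
  have hR45 := hR (w 4 5) (by decide) y3_R45
  have hs1 := hS s1 (by decide) y3_s1
  have hs2 := hS s2 (by decide) y3_s2
  have hW : Lf m n W t = Rf m n W t := by
    rw [← sub_eq_zero]
    apply ip_nondeg
    intro s
    have := hY _ (show Lf m n W s - Rf m n W s ∈ YY m n from rho_W s)
    rw [← this]
    simp only [W, map_add, LinearMap.add_apply, ip_sub_left, ip_add_left, ip_sub_right,
      ip_add_right, ip_Lo, ip_Ro, Equiv.swap_inv]
  have hAB : Lf m n zA (Rf m n zB t) = 0 := by rw [← Lf_zA_pp, hp, map_zero]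
  have hBA : Lf m n zB (Rf m n zA t) = 0 := by rw [← Lf_zB_pp, hp, map_zero]
  have bal := bal_all (LR_comm m n) hL01 hL23 hL45 hR01 hR23 hR45 hs1 hs2 hW hAB hBA
  have hLe : Lf m n e t = t := by
    rw [e_expand]
    simp only [map_add, map_sub, map_smul, LinearMap.add_apply, LinearMap.sub_apply, map_one,
      LinearMap.smul_apply, o_mul, ← LL_mul, hL01, hL23, hL45, map_neg, neg_neg,
      Module.End.one_apply]
    module
  have hRe : Rf m n e t = t := by
    rw [e_expand]
    simp only [map_add, map_sub, map_smul, LinearMap.add_apply, LinearMap.sub_apply, map_one,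
      LinearMap.smul_apply, o_mul, ← RR_mul, hR01, hR23, hR45, map_neg, neg_neg,
      Module.End.one_apply]
    module
  have hxi : xi m n t = 0 := by
    rw [Psi_rho, hRe] at hZ
    exact (smul_eq_zero.mp hZ).resolve_left (by norm_num)
  have h0 := xi_zero t hxi
  have h1 : ∑ σ : G6, Lf m n (e * o σ * e) (Lf m n (e * o σ⁻¹ * e) t) = 0 := by
    have := congrArg (fun s => Lf m n e (Rf m n e s)) h0
    simp only [map_sum, map_zero] at this
    rw [← this]
    refine Finset.sum_congr rfl fun σ _ => ?_
    have hb : Lf m n (e * o σ⁻¹ * e) t = Rf m n (e * o σ * e) t := by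
      have := bal σ⁻¹
      rwa [Bal, inv_inv] at this
    rw [hb]
    nth_rw 2 [← hLe]
    nth_rw 2 [← hRe]
    simp only [← LR_comm', LL_mul, RR_mul, mul_assoc]
  have h2 := congrArg (fun s => (ip t s).re) h1
  have hsum : ∀ (F : G6 → TT m n), ip t (∑ σ, F σ) = ∑ σ, ip t (F σ) := by
    intro F
    exact map_sum (AddMonoidHom.mk' (fun s => ip t s) (ip_add_right t)) F _
  simp only [ip_zero_right, hsum, Complex.re_sum, Complex.zero_re] at h2
  have h3 : ∀ σ : G6, ip t (Lf m n (e * o σ * e) (Lf m n (e * o σ⁻¹ * e) t))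
      = ip (Lf m n (e * o σ⁻¹ * e) t) (Lf m n (e * o σ⁻¹ * e) t) := by
    intro σ
    rw [ip_Leoe, inv_inv]
  simp only [h3] at h2
  rw [Finset.sum_eq_zero_iff_of_nonneg (fun σ _ => ip_self_nonneg _)] at h2
  have h4 := h2 1 (Finset.mem_univ _)
  rw [inv_one, o_one, mul_one, e_mul_e, hLe] at h4
  exact ip_self_eq_zero t h4.le

/-! ### Part 11: the projection kills decomposable relations -/

/-- Polarized coefficients of a quadric. -/
noncomputable def q4 {m n : ℕ} (q : MvPolynomial (MinorIdx m n) ℂ) (a0 a1 a2 a3 : Fin m)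
    (c0 c1 c2 c3 : Fin n) : ℂ := constantCoeff (dy a0 a1 c0 c1 (dy a2 a3 c2 c3 q))

lemma q4_flip {m n : ℕ} (q : MvPolynomial (MinorIdx m n) ℂ) (a0 a1 a2 a3 : Fin m)
    (c0 c1 c2 c3 : Fin n) : q4 q a1 a0 a3 a2 c0 c1 c2 c3 = q4 q a0 a1 a2 a3 c0 c1 c2 c3 := by
  rw [q4, dy_swap a0 a1, dy_swap a2 a3]
  simp [q4]

lemma q4_comm {m n : ℕ} (q : MvPolynomial (MinorIdx m n) ℂ) (a0 a1 a2 a3 : Fin m)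
    (c0 c1 c2 c3 : Fin n) : q4 q a2 a3 a0 a1 c2 c3 c0 c1 = q4 q a0 a1 a2 a3 c0 c1 c2 c3 := by
  rw [q4, dy_comm]; rfl

lemma pd_minor {m n : ℕ} (a b : Fin m) (c d : Fin n) (v : MinorIdx m n) :
    pderiv (a, c) (pderiv (b, d) (minorΔ v)) = C (eps a b c d v) := by
  have hX : ∀ (a : Fin m) (c : Fin n) (i : Fin m) (j : Fin n),
      pderiv (a, c) (X (i, j) : MvPolynomial (Fin m × Fin n) ℂ)
      = C ((if a = i then 1 else 0) * (if c = j then 1 else 0)) := by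
    intro a c i j
    rw [pderiv_X, Pi.single_apply]
    by_cases h1 : a = i <;> by_cases h2 : c = j <;> simp [h1, h2, eq_comm]
  rw [minorΔ]
  simp only [map_sub, map_add, Derivation.leibniz, smul_eq_mul, hX, pderiv_C, mul_zero, zero_add,
    add_zero]
  simp only [eps, uu, C_mul, C_sub]
  ring


lemma q4_XX {m n : ℕ} (v v' : MinorIdx m n) (a0 a1 a2 a3 : Fin m) (c0 c1 c2 c3 : Fin n) :
    q4 (X v * X v') a0 a1 a2 a3 c0 c1 c2 c3
      = eps a0 a1 c0 c1 v * eps a2 a3 c2 c3 v' + eps a0 a1 c0 c1 v' * eps a2 a3 c2 c3 v := by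
  simp only [q4, Derivation.leibniz, map_add, smul_eq_mul, dy_X, map_mul, constantCoeff_X,
    constantCoeff_C]
  simp [Derivation.leibniz, dy_X, dy]
  try ring

lemma q4_Psi {m n : ℕ} (q : MvPolynomial (MinorIdx m n) ℂ)
    (hq : q ∈ homogeneousSubmodule (MinorIdx m n) ℂ 2)
    (a0 a1 a2 a3 : Fin m) (c0 c1 c2 c3 : Fin n) :
    constantCoeff (pderiv (a0, c0) (pderiv (a1, c1) (pderiv (a2, c2) (pderiv (a3, c3)
      (Psi m n q))))) = q4 q a0 a1 a2 a3 c0 c1 c2 c3 + q4 q a0 a2 a1 a3 c0 c2 c1 c3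
        + q4 q a0 a3 a1 a2 c0 c3 c1 c2 := by
  have h := hom_span_two q hq
  clear hq
  induction h using Submodule.span_induction with
  | mem x hx =>
    obtain ⟨v, v', rfl⟩ := hx
    have hP : ∀ v, Psi m n (X v) = minorΔ v := fun v => by simp [Psi]
    rw [map_mul, hP, hP]
    have h4 : pderiv (a0, c0) (pderiv (a1, c1) (pderiv (a2, c2) (pderiv (a3, c3)
      (minorΔ v * minorΔ v')))) = C (eps a0 a1 c0 c1 v * eps a2 a3 c2 c3 v' +
        eps a0 a1 c0 c1 v' * eps a2 a3 c2 c3 v + eps a0 a2 c0 c2 v * eps a1 a3 c1 c3 v'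
        + eps a0 a2 c0 c2 v' * eps a1 a3 c1 c3 v + eps a0 a3 c0 c3 v * eps a1 a2 c1 c2 v'
        + eps a0 a3 c0 c3 v' * eps a1 a2 c1 c2 v) := by
      simp only [Derivation.leibniz, map_add, smul_eq_mul, pd_minor, pderiv_C, map_mul, map_zero,
        mul_zero, zero_mul, add_zero, zero_add]
      ring
    rw [h4, constantCoeff_C, q4_XX, q4_XX, q4_XX]
    ring
  | zero => simp [q4]
  | add x y _ _ hx hy =>
    simp only [map_add, q4] at hx hy ⊢
    linear_combination hx + hy
  | smul r x _ hx =>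
    simp only [map_smul, Derivation.map_smul, constantCoeff_smul, smul_eq_mul, q4] at hx ⊢
    linear_combination r * hx

lemma q4_swap {m n : ℕ} (q : MvPolynomial (MinorIdx m n) ℂ) (hq : q ∈ kerPsiDeg m n 2)
    (a0 a1 a2 a3 : Fin m) (c0 c1 c2 c3 : Fin n) :
    q4 q a2 a3 a0 a1 c0 c1 c2 c3 = q4 q a0 a1 a2 a3 c0 c1 c2 c3 := by
  have hP : Psi m n q = 0 := hq.1
  have hE : ∀ a0 a1 a2 a3 : Fin m, q4 q a0 a1 a2 a3 c0 c1 c2 c3 + q4 q a0 a2 a1 a3 c0 c2 c1 c3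
        + q4 q a0 a3 a1 a2 c0 c3 c1 c2 = 0 := by
    intro a0 a1 a2 a3
    rw [← q4_Psi q hq.2, hP]; simp
  have E0 := hE a0 a1 a2 a3
  have E1 := hE a2 a3 a0 a1
  have E2 := hE a1 a0 a3 a2
  have E3 := hE a3 a2 a1 a0
  rw [q4_flip q a0 a2 a1 a3, q4_flip q a1 a2 a0 a3] at E1
  rw [q4_flip q a0 a1 a2 a3] at E2
  rw [q4_flip q a2 a3 a0 a1, q4_flip q a1 a3 a0 a2, q4_flip q a0 a3 a1 a2] at E3
  linear_combination (1 / 2) * (E1 + E3 - E2 - E0)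

/-- Polarized coefficients of a cubic. -/
noncomputable def pi0 (m n : ℕ) : MvPolynomial (MinorIdx m n) ℂ →ₗ[ℂ] TT m n where
  toFun f := Matrix.of fun a c => constantCoeff (dy (a 0) (a 1) (c 0) (c 1)
    (dy (a 2) (a 3) (c 2) (c 3) (dy (a 4) (a 5) (c 4) (c 5) f)))
  map_add' f g := by ext a c; simp
  map_smul' r f := by ext a c; simp

lemma pi0_apply {m n : ℕ} (f : MvPolynomial (MinorIdx m n) ℂ) (a : Tu m) (c : Tu n) :
    pi0 m n f a c = constantCoeff (dy (a 0) (a 1) (c 0) (c 1)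
    (dy (a 2) (a 3) (c 2) (c 3) (dy (a 4) (a 5) (c 4) (c 5) f))) := rfl

lemma Lf_EE_fixed {m n : ℕ} (σ : G6) (hσ : EE * o σ = -EE) (t : TT m n)
    (h : Lf m n (o σ) t = t) : Lf m n EE t = 0 := by
  have h1 : Lf m n EE t = - Lf m n EE t := by
    conv_lhs => rw [← h, LL_mul, hσ, map_neg, LinearMap.neg_apply]
  have h2 : (2 : ℂ) • Lf m n EE t = 0 := by
    rw [two_smul]; nth_rw 1 [h1]; exact neg_add_cancel _
  exact (smul_eq_zero.mp h2).resolve_left (by norm_num)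

lemma pi0_dec {m n : ℕ} (v : MinorIdx m n) (q : MvPolynomial (MinorIdx m n) ℂ)
    (hq : q ∈ kerPsiDeg m n 2) : Lf m n EE (pi0 m n (X v * q)) = 0 := by
  have h : pi0 m n (X v * q) =
      (Matrix.of fun (a : Tu m) (c : Tu n) => eps (a 0) (a 1) (c 0) (c 1) v
        * q4 q (a 2) (a 3) (a 4) (a 5) (c 2) (c 3) (c 4) (c 5))
      + (Matrix.of fun (a : Tu m) (c : Tu n) => eps (a 2) (a 3) (c 2) (c 3) v
        * q4 q (a 0) (a 1) (a 4) (a 5) (c 0) (c 1) (c 4) (c 5))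
      + (Matrix.of fun (a : Tu m) (c : Tu n) => eps (a 4) (a 5) (c 4) (c 5) v
        * q4 q (a 0) (a 1) (a 2) (a 3) (c 0) (c 1) (c 2) (c 3)) := by
    ext a c
    have hC : ∀ (a b : Fin m) (c d : Fin n) (r : ℂ), dy a b c d (C r) = 0 := fun a b c d r => by
      exact Derivation.map_algebraMap _ r
    simp only [pi0_apply, Derivation.leibniz, map_add, smul_eq_mul, dy_X, map_mul,
      constantCoeff_X, constantCoeff_C, hC, mul_zero, zero_mul, add_zero, zero_add,
      Matrix.add_apply, Matrix.of_apply, q4]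
    ring
  rw [h, map_add, map_add, Lf_EE_fixed s2 EE_s2, Lf_EE_fixed s3 EE_s3, Lf_EE_fixed s1 EE_s1]
  · simp
  · ext a c
    rw [Lf_o]
    simp only [Matrix.of_apply, Function.comp, show s1 0 = 2 by decide, show s1 1 = 3 by decide,
      show s1 2 = 0 by decide, show s1 3 = 1 by decide, show s1 4 = 4 by decide,
      show s1 5 = 5 by decide]
    rw [q4_swap q hq]
  · ext a c
    rw [Lf_o]
    simp only [Matrix.of_apply, Function.comp, show s3 0 = 4 by decide, show s3 1 = 5 by decide,
      show s3 2 = 2 by decide, show s3 3 = 3 by decide, show s3 4 = 0 by decide,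
      show s3 5 = 1 by decide]
    rw [q4_swap q hq]
  · ext a c
    rw [Lf_o]
    simp only [Matrix.of_apply, Function.comp, show s2 0 = 0 by decide, show s2 1 = 1 by decide,
      show s2 2 = 4 by decide, show s2 3 = 5 by decide, show s2 4 = 2 by decide,
      show s2 5 = 3 by decide]
    rw [q4_swap q hq]

lemma pi0_R1 {m n : ℕ} (f : MvPolynomial (MinorIdx m n) ℂ) (hf : f ∈ R1kerPsi2 m n) :
    Lf m n EE (pi0 m n f) = 0 := by
  have h : R1kerPsi2 m n ≤ LinearMap.ker (Lf m n EE ∘ₗ pi0 m n) := by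
    rw [R1kerPsi2, Submodule.span_le]
    rintro g ⟨v, q, hq, rfl⟩
    exact pi0_dec v q hq
  exact h hf

lemma Mx_e {d : ℕ} (a b : Tu d) : Mx d e a b = (1 / 8) * (uu (a 0) (a 1) (b 0) (b 1)
    * uu (a 2) (a 3) (b 2) (b 3) * uu (a 4) (a 5) (b 4) (b 5)) := by
  obtain ⟨δ, hδ⟩ : ∃ δ : Fin d → Fin d → ℂ, ∀ i j, δ i j = if i = j then 1 else 0 :=
    ⟨_, fun _ _ => rfl⟩
  have huu : ∀ a b i j : Fin d, uu a b i j = δ a i * δ b j - δ b i * δ a j := by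
    intro a b i j; simp only [uu, hδ]
  have hd : ∀ a b : Tu d, (if a = b then (1 : ℂ) else 0) = δ (a 0) (b 0) * δ (a 1) (b 1)
      * δ (a 2) (b 2) * δ (a 3) (b 3) * δ (a 4) (b 4) * δ (a 5) (b 5) := by
    intro a b
    simp only [hδ]
    by_cases h : a = b
    · subst h; simp
    · rw [if_neg h]
      obtain ⟨k, hk⟩ := Function.ne_iff.mp h
      fin_cases k <;> simp at hk <;> simp [hk]
  rw [e_expand, map_smul, Matrix.smul_apply, smul_eq_mul]
  congr 1
  simp only [map_add, map_sub, Matrix.add_apply, Matrix.sub_apply, ← o_one, Mx_o]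
  simp only [hd]
  simp only [Function.comp_apply, Equiv.Perm.coe_mul, Equiv.Perm.coe_one, id,
    show w 0 1 0 = 1 by decide, show w 0 1 1 = 0 by decide,
    show w 0 1 2 = 2 by decide, show w 0 1 3 = 3 by decide, show w 0 1 4 = 4 by decide,
    show w 0 1 5 = 5 by decide,
    show w 2 3 0 = 0 by decide, show w 2 3 1 = 1 by decide,
    show w 2 3 2 = 3 by decide, show w 2 3 3 = 2 by decide, show w 2 3 4 = 4 by decide,
    show w 2 3 5 = 5 by decide,
    show w 4 5 0 = 0 by decide, show w 4 5 1 = 1 by decide,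
    show w 4 5 2 = 2 by decide, show w 4 5 3 = 3 by decide, show w 4 5 4 = 5 by decide,
    show w 4 5 5 = 4 by decide, huu]
  ring

lemma Mx_mul_o {d : ℕ} (x : A6) (σ : G6) (a b : Tu d) :
    Mx d (x * o σ) a b = Mx d x a (b ∘ ⇑σ⁻¹) := by
  rw [map_mul, Matrix.mul_apply, Finset.sum_eq_single (b ∘ ⇑σ⁻¹)]
  · rw [Mx_o, if_pos, mul_one]; funext k; simp
  · intro c _ hc
    rw [Mx_o, if_neg, mul_zero]
    rintro rfl
    apply hc; funext k; simp
  · simp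

lemma LR_entry {m n : ℕ} (x y : A6) (t : TT m n) (a : Tu m) (c : Tu n) :
    Lf m n x (Rf m n y t) a c = ∑ a', ∑ c', t a' c' * (Mx m x a a' * Mx n y c c') := by
  rw [Lf_apply, Rf_apply, Matrix.mul_apply]
  simp only [Matrix.mul_apply, Finset.mul_sum, Matrix.transpose_apply]
  refine Finset.sum_congr rfl fun _ _ => Finset.sum_congr rfl fun _ _ => by ring

/-- One term of the polarization of `rho`. -/
noncomputable def pol {m n : ℕ} (σ : G6) (t : TT m n) : TT m n :=
  Lf m n (e * o σ) (Rf m n (e * o σ) t)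

lemma pi0_rho {m n : ℕ} (t : TT m n) : pi0 m n (rho m n t) =
    (64 : ℂ) • (pol 1 t + pol s1 t + pol s2 t + pol s3 t + pol (s1 * s2) t + pol (s2 * s1) t) := by
  ext a c
  simp only [pol, Matrix.smul_apply, Matrix.add_apply, LR_entry, ← Finset.sum_add_distrib,
    smul_eq_mul, Finset.mul_sum]
  rw [rho_apply]
  simp only [map_sum, map_smul, Matrix.sum_apply, Matrix.smul_apply, smul_eq_mul]
  refine Finset.sum_congr rfl fun a' _ => Finset.sum_congr rfl fun c' _ => ?_
  have hC : ∀ (a b : Fin m) (c d : Fin n) (r : ℂ), dy a b c d (C r) = 0 := fun a b c d r => by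
    exact Derivation.map_algebraMap _ r
  rw [show s1 = s1⁻¹ by decide, show s2 = s2⁻¹ by decide, show s3 = s3⁻¹ by decide,
    ← mul_inv_rev, ← mul_inv_rev, show (1 : G6) = 1⁻¹ by decide]
  simp only [Mx_mul_o, inv_inv, Mx_e, Function.comp, Equiv.Perm.coe_mul, Equiv.Perm.coe_one, id,
    show s1 0 = 2 by decide, show s1 1 = 3 by decide,
    show s1 2 = 0 by decide, show s1 3 = 1 by decide, show s1 4 = 4 by decide,
    show s1 5 = 5 by decide,
    show s2 0 = 0 by decide, show s2 1 = 1 by decide,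
    show s2 2 = 4 by decide, show s2 3 = 5 by decide, show s2 4 = 2 by decide,
    show s2 5 = 3 by decide,
    show s3 0 = 4 by decide, show s3 1 = 5 by decide,
    show s3 2 = 2 by decide, show s3 3 = 3 by decide, show s3 4 = 0 by decide,
    show s3 5 = 1 by decide]
  simp only [pi0_apply, y3, Derivation.leibniz, map_add, smul_eq_mul, dy_yy, map_mul,
      constantCoeff_C, hC, mul_zero, zero_mul, add_zero, zero_add, map_zero]
  ring

lemma EE_pol {m n : ℕ} (σ : G6) (r : ℂ) (hr : r * r = 1) (h : EE * o σ = r • EE) (t : TT m n) :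
    Lf m n EE (Rf m n EE (pol σ t)) = Lf m n EE (Rf m n EE t) := by
  rw [pol, LR_comm', LL_mul, ← LR_comm', RR_mul, ← mul_assoc, EE_e, h]
  simp only [map_smul, LinearMap.smul_apply, smul_smul, hr, one_smul]

lemma EE_pi0_rho {m n : ℕ} (t : TT m n) : Lf m n EE (Rf m n EE (pi0 m n (rho m n t)))
    = (384 : ℂ) • Lf m n EE (Rf m n EE t) := by
  rw [pi0_rho]
  simp only [map_smul, map_add]
  rw [EE_pol 1 1 (by norm_num) (by simp [o_one]), EE_pol s1 (-1) (by norm_num) (by simp [EE_s1]),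
    EE_pol s2 (-1) (by norm_num) (by simp [EE_s2]), EE_pol s3 (-1) (by norm_num) (by simp [EE_s3]),
    EE_pol (s1 * s2) 1 (by norm_num) (by simp [o_mul, ← mul_assoc, EE_s1, EE_s2]),
    EE_pol (s2 * s1) 1 (by norm_num) (by simp [o_mul, ← mul_assoc, EE_s1, EE_s2])]
  module

theorem pp_YY {m n : ℕ} (y : TT m n) (hy : y ∈ YY m n) : pp m n y = 0 := by
  have h1 : Lf m n EE (pi0 m n (rho m n y)) = 0 := pi0_R1 _ hy
  have h2 := EE_pi0_rho y
  rw [LR_comm', h1, map_zero] at h2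
  have h3 := (smul_eq_zero.mp h2.symm).resolve_left (by norm_num)
  rw [← pp_EE, h3, map_zero]

theorem Psi_YY {m n : ℕ} (y : TT m n) (hy : y ∈ YY m n) : Psi m n (rho m n y) = 0 := by
  have h : R1kerPsi2 m n ≤ LinearMap.ker (Psi m n).toLinearMap := by
    rw [R1kerPsi2, Submodule.span_le]
    rintro g ⟨v, q, hq, rfl⟩
    have : Psi m n q = 0 := hq.1
    simp [this]
  exact h hy

/-! ### Part 12: dimension as a trace -/

/-- Tensors as a Euclidean space. -/
noncomputable def toE (m n : ℕ) : TT m n ≃ₗ[ℂ] EuclideanSpace ℂ (Tu m × Tu n) :=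
  (LinearEquiv.curry ℂ ℂ (Tu m) (Tu n)).symm.trans (WithLp.linearEquiv 2 ℂ (Tu m × Tu n → ℂ)).symm

lemma toE_inner {m n : ℕ} (s t : TT m n) : inner ℂ (toE m n s) (toE m n t) = ip s t := by
  rw [PiLp.inner_apply, Fintype.sum_prod_type]
  refine Finset.sum_congr rfl fun a _ => Finset.sum_congr rfl fun c _ => ?_
  rw [RCLike.inner_apply, mul_comm]
  rfl

lemma mem_YY {m n : ℕ} (t : TT m n) (hZ : Psi m n (rho m n t) = 0) (hp : pp m n t = 0) :
    t ∈ YY m n := by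
  obtain ⟨y, hy, z, hz, hyz⟩ :=
    Submodule.exists_add_mem_mem_orthogonal (K := (YY m n).map (toE m n).toLinearMap) (toE m n t)
  obtain ⟨s, hs, rfl⟩ := hy
  have hz' : z = toE m n (t - s) := by
    rw [map_sub, hyz]; simp
  have h0 : t - s = 0 := by
    apply final_zero
    · rw [map_sub, map_sub, hZ, Psi_YY s hs, sub_zero]
    · rw [map_sub, hp, pp_YY s hs, sub_zero]
    · intro y hy
      rw [← toE_inner, ← hz']
      exact (Submodule.mem_orthogonal _ _).mp hz _ ⟨y, hy, rfl⟩
  rw [sub_eq_zero.mp h0]; exact hs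

lemma kerPsi_mem {m n : ℕ} (t : TT m n) (h : Psi m n (rho m n t) = 0) :
    rho m n t ∈ kerPsiDeg m n 3 := ⟨h, rho_hom t⟩

lemma range_pp {m n : ℕ} (t : TT m n) (ht : t ∈ LinearMap.range (pp m n)) : pp m n t = t := by
  obtain ⟨s, rfl⟩ := ht
  exact pp_pp s

/-- The comparison map. -/
noncomputable def cmp (m n : ℕ) : LinearMap.range (pp m n) →ₗ[ℂ]
    (↥(kerPsiDeg m n 3) ⧸ Submodule.comap (kerPsiDeg m n 3).subtype (R1kerPsi2 m n)) :=
  (Submodule.mkQ _) ∘ₗ LinearMap.codRestrict (kerPsiDeg m n 3)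
    (rho m n ∘ₗ (LinearMap.range (pp m n)).subtype) (by
      rintro ⟨t, s, rfl⟩
      exact kerPsi_mem _ (Psi_rho_pp s))

lemma cmp_bij (m n : ℕ) : Function.Bijective (cmp m n) := by
  constructor
  · rw [← LinearMap.ker_eq_bot, LinearMap.ker_eq_bot']
    rintro ⟨t, ht⟩ h
    rw [cmp, LinearMap.comp_apply, Submodule.mkQ_apply, Submodule.Quotient.mk_eq_zero] at h
    have h1 : t ∈ YY m n := h
    have h2 := pp_YY t h1
    rw [range_pp t ht] at h2
    exact Subtype.ext h2
  · intro x
    obtain ⟨⟨f, hf⟩, rfl⟩ := Submodule.mkQ_surjective _ x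
    obtain ⟨t, rfl⟩ := rho_surj f hf.2
    refine ⟨⟨pp m n t, ⟨t, rfl⟩⟩, ?_⟩
    rw [cmp, LinearMap.comp_apply, Submodule.mkQ_apply, Submodule.mkQ_apply,
      Submodule.Quotient.eq]
    have hP : Psi m n (rho m n t) = 0 := hf.1
    have h1 : pp m n t - t ∈ YY m n := by
      apply mem_YY
      · rw [map_sub, map_sub, Psi_rho_pp, hP, sub_zero]
      · rw [map_sub, pp_pp, sub_self]
    have h2 : rho m n (pp m n t - t) ∈ R1kerPsi2 m n := h1
    rw [map_sub] at h2
    exact h2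

theorem finrank_eq_trace (m n : ℕ) : (Module.finrank ℂ
      (↥(kerPsiDeg m n 3) ⧸
        Submodule.comap (kerPsiDeg m n 3).subtype (R1kerPsi2 m n)) : ℂ)
      = LinearMap.trace ℂ (TT m n) (pp m n) := by
  rw [← (LinearEquiv.ofBijective (cmp m n) (cmp_bij m n)).finrank_eq]
  have h : LinearMap.IsProj (LinearMap.range (pp m n)) (pp m n) :=
    ⟨fun t => ⟨t, rfl⟩, fun t ht => range_pp t ht⟩
  rw [h.trace]

lemma trace_LR (m n : ℕ) (x y : A6) : LinearMap.trace ℂ (TT m n) (Lf m n x * Rf m n y)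
    = (Mx m x).trace * (Mx n y).trace := by
  rw [LinearMap.trace_eq_matrix_trace ℂ (Matrix.stdBasis ℂ (Tu m) (Tu n)), Matrix.trace,
    Fintype.sum_prod_type, Matrix.trace, Matrix.trace, Finset.sum_mul_sum]
  refine Finset.sum_congr rfl fun a _ => Finset.sum_congr rfl fun c _ => ?_
  rw [Matrix.diag_apply, LinearMap.toMatrix_apply, Matrix.stdBasis_eq_single]
  have : ∀ t : TT m n, (Matrix.stdBasis ℂ (Tu m) (Tu n)).repr t (a, c) = t a c := by
    intro t; rfl
  rw [this, Module.End.mul_apply, LR_entry, Finset.sum_eq_single a, Finset.sum_eq_single c]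
  · simp
  · intro b _ hb; simp [Matrix.single_apply, Ne.symm hb]
  · simp
  · intro b _ hb; simp [Matrix.single_apply, Ne.symm hb]
  · simp

lemma trace_pp (m n : ℕ) : LinearMap.trace ℂ (TT m n) (pp m n)
    = (Mx m zA).trace * (Mx n zB).trace + (Mx m zB).trace * (Mx n zA).trace := by
  rw [pp, map_add, trace_LR, trace_LR]

/-! ### Part 13: computing the traces -/

instance instFintypeCycles (σ : G6) : Fintype (Quotient (Equiv.Perm.SameCycle.setoid σ)) :=
  @Quotient.fintype _ _ (Equiv.Perm.SameCycle.setoid σ) (inferInstanceAs (DecidableRel σ.SameCycle))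

/-- The number of cycles of a permutation. -/
def cyc (σ : G6) : ℕ := Fintype.card (Quotient (Equiv.Perm.SameCycle.setoid σ))

lemma card_fixed (d : ℕ) (σ : G6) :
    (Finset.univ.filter fun a : Tu d => a ∘ σ = a).card = d ^ cyc σ := by
  have h : ∀ a : Tu d, a ∘ σ = a → ∀ i j, σ.SameCycle i j → a i = a j := by
    intro a ha i j hij
    obtain ⟨k, rfl⟩ := hij
    have h1 : ∀ i, a (σ i) = a i := fun i => congrFun ha i
    have h2 : ∀ i, a (σ⁻¹ i) = a i := fun i => by
      rw [← h1 (σ⁻¹ i)]; simp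
    induction k generalizing i with
    | zero => simp
    | succ k ih => rw [zpow_add_one, Equiv.Perm.mul_apply, ← ih, h1]
    | pred k ih => rw [zpow_sub_one, Equiv.Perm.mul_apply, ← ih, h2]
  classical
  rw [← Fintype.card_subtype]
  let E : {a : Tu d // a ∘ σ = a} ≃ (Quotient (Equiv.Perm.SameCycle.setoid σ) → Fin d) :=
    { toFun := fun a q => Quotient.lift a.1 (fun i j hij => h a.1 a.2 i j hij) q
      invFun := fun b => ⟨fun i => b (Quotient.mk _ i), by
        funext i
        refine congrArg b (Quotient.sound ?_)
        exact (Equiv.Perm.sameCycle_apply_left).mpr (Equiv.Perm.SameCycle.refl σ i)⟩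
      left_inv := fun a => rfl
      right_inv := fun b => by
        funext q
        induction q using Quotient.inductionOn
        rfl }
  rw [Fintype.card_congr E, Fintype.card_fun, Fintype.card_fin, cyc]

lemma tr_o (d : ℕ) (σ : G6) : (Mx d (o σ)).trace = (d : ℂ) ^ cyc σ := by
  rw [Matrix.trace]
  simp only [Matrix.diag_apply, Mx_o]
  rw [Finset.sum_boole, card_fixed]
  push_cast; rfl

/-- Terms of `N`. -/
def Nl : List (ℤ × G6) :=
  [(1, 1), (-1, s1), (-1, s2), (-1, s3), (1, s1 * s2), (1, s2 * s1)]
/-- Terms of `e`. -/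
def el : List (ℤ × G6) :=
  [(1, 1), (-1, w 0 1), (-1, w 2 3), (-1, w 4 5), (1, w 0 1 * w 2 3), (1, w 0 1 * w 4 5),
    (1, w 2 3 * w 4 5), (-1, w 0 1 * w 2 3 * w 4 5)]

/-- Terms of a product, with sign and cycle count. -/
def Pl (g : G6) : List (ℤ × ℕ) :=
  Nl.flatMap fun p => el.map fun q => (p.1 * q.1, cyc (p.2 * q.2 * g))

lemma N_list : N = (1 / 6 : ℂ) • (Nl.map fun p => (p.1 : ℂ) • o p.2).sum := by
  simp only [N, Nl, List.map_cons, List.map_nil, List.sum_cons, List.sum_nil, o_one, Int.cast_one,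
    Int.cast_neg, one_smul, neg_smul]
  congr 1
  abel

lemma e_list : e = (1 / 8 : ℂ) • (el.map fun p => (p.1 : ℂ) • o p.2).sum := by
  rw [e_expand]
  simp only [el, List.map_cons, List.map_nil, List.sum_cons, List.sum_nil, o_one, Int.cast_one,
    Int.cast_neg, one_smul, neg_smul]
  congr 1
  abel

lemma tr_sum_mid (d : ℕ) (x y : A6) (l : List (ℤ × G6)) :
    (Mx d (x * (l.map fun p => (p.1 : ℂ) • o p.2).sum * y)).trace
      = (l.map fun p => (p.1 : ℂ) * (Mx d (x * o p.2 * y)).trace).sum := by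
  induction l with
  | nil => simp
  | cons p l ih =>
    simp only [List.map_cons, List.sum_cons, mul_add, add_mul, map_add, Matrix.trace_add, ih,
      mul_smul_comm, smul_mul_assoc, map_smul, Matrix.trace_smul, smul_eq_mul]

lemma Pl_sum (d : ℕ) (g : G6) (l l' : List (ℤ × G6)) : ((l.flatMap fun p => l'.map fun q =>
      (p.1 * q.1, cyc (p.2 * q.2 * g))).map fun p => (p.1 : ℂ) * (d : ℂ) ^ p.2).sum
      = (l.map fun p => (p.1 : ℂ) * (l'.map fun q =>
        (q.1 : ℂ) * (Mx d (o p.2 * o q.2 * o g)).trace).sum).sum := by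
  induction l with
  | nil => simp
  | cons p l ih =>
    rw [List.flatMap_cons, List.map_append, List.sum_append, ih, List.map_cons, List.sum_cons,
      ← List.sum_map_mul_left, List.map_map]
    congr 2
    refine List.map_congr_left fun q _ => ?_
    simp only [Function.comp, ← o_mul, tr_o]
    push_cast
    ring

lemma tr_list (d : ℕ) (g : G6) : (Mx d (N * e * o g)).trace
    = (1 / 48) * ((Pl g).map fun p => (p.1 : ℂ) * (d : ℂ) ^ p.2).sum := by
  rw [Pl, Pl_sum, N_list, e_list]
  generalize Nl = l
  generalize el = l'
  have h := tr_sum_mid d 1 ((l'.map fun p => (p.1 : ℂ) • o p.2).sum * o g) l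
  simp only [one_mul, ← mul_assoc, tr_sum_mid] at h
  simp only [mul_smul_comm, smul_mul_assoc, map_smul, Matrix.trace_smul, smul_eq_mul]
  rw [← h, ← tr_sum_mid, ← mul_assoc]
  congr 1
  norm_num

lemma Pl_one : Pl 1 =
    [(1, 6), (-1, 5), (-1, 5), (-1, 5), (1, 4), (1, 4), (1, 4), (-1, 3), (-1, 4), (1, 3), (1,
    3), (1, 3), (-1, 4), (-1, 2), (-1, 2), (1, 3), (-1, 4), (1, 3), (1, 3), (1, 3), (-1, 2),
    (-1, 2), (-1, 4), (1, 3), (-1, 4), (1, 3), (1, 3), (1, 3), (-1, 2), (-1, 4), (-1, 2), (1,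
    3), (1, 2), (-1, 1), (-1, 1), (-1, 1), (1, 2), (1, 2), (1, 2), (-1, 1), (1, 2), (-1, 1),
    (-1, 1), (-1, 1), (1, 2), (1, 2), (1, 2), (-1, 1)] := by
  decide +kernel

lemma Pl_gg : Pl gg =
    [(1, 4), (-1, 3), (-1, 3), (-1, 3), (1, 2), (1, 2), (1, 2), (-1, 1), (-1, 2), (1, 3), (1,
    3), (1, 1), (-1, 4), (-1, 2), (-1, 2), (1, 3), (-1, 2), (1, 1), (1, 3), (1, 3), (-1, 2),
    (-1, 2), (-1, 4), (1, 3), (-1, 2), (1, 1), (1, 1), (1, 1), (-1, 2), (-1, 2), (-1, 2), (1,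
    3), (1, 2), (-1, 3), (-1, 3), (-1, 1), (1, 4), (1, 2), (1, 2), (-1, 3), (1, 2), (-1, 1),
    (-1, 3), (-1, 3), (1, 2), (1, 2), (1, 4), (-1, 3)] := by
  decide +kernel

lemma tr_EE (d : ℕ) : (Mx d EE).trace
    = ((d : ℂ) ^ 6 - 3 * d ^ 5 - 3 * d ^ 4 + 11 * d ^ 3 + 2 * d ^ 2 - 8 * d) / 48 := by
  have h := tr_list d 1
  rw [o_one, mul_one, Pl_one] at h
  rw [EE, h]
  simp only [List.map_cons, List.map_nil, List.sum_cons, List.sum_nil]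
  push_cast
  ring

lemma tr_tau (d : ℕ) : (Mx d tau).trace
    = ((d : ℂ) ^ 4 - 2 * d ^ 3 - d ^ 2 + 2 * d) / 48 := by
  have h := tr_list d gg
  rw [Pl_gg] at h
  have h1 : (Mx d tau).trace = (Mx d (N * e * o gg)).trace := by
    rw [tau, t0, ← mul_assoc, map_mul, Matrix.trace_mul_comm, ← map_mul, ← mul_assoc, ← mul_assoc,
      ← N_e, mul_assoc N, e_mul_e]
  rw [h1, h]
  simp only [List.map_cons, List.map_nil, List.sum_cons, List.sum_nil]
  push_cast
  ring

lemma tr_zA (d : ℕ) : (Mx d zA).trace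
    = ((d * (d + 1) * (d + 2) * (d - 1) * (d - 2) * (d - 3) / 72 : ℕ) : ℂ) := by
  have h1 : (Mx d zA).trace
      = (d : ℂ) * (d + 1) * (d + 2) * (d - 1) * (d - 2) * (d - 3) / 72 := by
    rw [zA]
    simp only [map_smul, map_sub, Matrix.trace_smul, Matrix.trace_sub, tr_EE, tr_tau, smul_eq_mul]
    ring
  rw [h1]
  rcases lt_or_ge d 3 with hd | hd
  · interval_cases d <;> norm_num
  · obtain ⟨k, rfl⟩ := Nat.exists_eq_add_of_le' hd
    have hdvd : 72 ∣ (k + 3) * (k + 3 + 1) * (k + 3 + 2) * (k + 3 - 1) * (k + 3 - 2)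
        * (k + 3 - 3) := by
      rw [← ZMod.natCast_eq_zero_iff]
      have h2 : ∀ x : ZMod 72, (x + 3) * (x + 3 + 1) * (x + 3 + 2) * (x + 2) * (x + 1) * x = 0 := by
        decide +kernel
      have h3 := h2 (k : ZMod 72)
      rw [show k + 3 - 1 = k + 2 by omega, show k + 3 - 2 = k + 1 by omega,
        show k + 3 - 3 = k by omega]
      push_cast
      exact h3
    rw [Nat.cast_div hdvd (by norm_num), show k + 3 - 1 = k + 2 by omega,
      show k + 3 - 2 = k + 1 by omega, show k + 3 - 3 = k by omega]
    push_cast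
    ring

lemma tr_zB (d : ℕ) : (Mx d zB).trace
    = ((d ^ 2 * (d - 1) ^ 2 * (d + 1) * (d - 2) / 144 : ℕ) : ℂ) := by
  have h1 : (Mx d zB).trace
      = (d : ℂ) ^ 2 * (d - 1) ^ 2 * (d + 1) * (d - 2) / 144 := by
    rw [zB]
    simp only [map_smul, map_add, Matrix.trace_smul, Matrix.trace_add, tr_EE, tr_tau, smul_eq_mul]
    ring
  rw [h1]
  rcases lt_or_ge d 2 with hd | hd
  · interval_cases d <;> norm_num
  · obtain ⟨k, rfl⟩ := Nat.exists_eq_add_of_le' hd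
    have hdvd : 144 ∣ (k + 2) ^ 2 * (k + 2 - 1) ^ 2 * (k + 2 + 1) * (k + 2 - 2) := by
      rw [← ZMod.natCast_eq_zero_iff]
      have h2 : ∀ x : ZMod 144, (x + 2) ^ 2 * (x + 1) ^ 2 * (x + 2 + 1) * x = 0 := by
        decide +kernel
      have h3 := h2 (k : ZMod 144)
      rw [show k + 2 - 1 = k + 1 by omega, show k + 2 - 2 = k by omega]
      push_cast
      exact h3
    rw [Nat.cast_div hdvd (by norm_num), show k + 2 - 1 = k + 1 by omega,
      show k + 2 - 2 = k by omega]
    push_cast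
    ring

end Cubic

/-- The space of minimal cubic relations among the 2×2 minors,
`(ker Ψ)₃ / (R₁·(ker Ψ)₂)`, has the stated dimension. -/
theorem dim_minimal_cubic_relations_minors (m n : ℕ) (hm : 1 ≤ m) (hn : 1 ≤ n) :
    Module.finrank ℂ
      (↥(kerPsiDeg m n 3) ⧸
        Submodule.comap (kerPsiDeg m n 3).subtype (R1kerPsi2 m n)) =
      m * (m + 1) * (m + 2) * (m - 1) * (m - 2) * (m - 3) / 72 *
          (n ^ 2 * (n - 1) ^ 2 * (n + 1) * (n - 2) / 144) +
        m ^ 2 * (m - 1) ^ 2 * (m + 1) * (m - 2) / 144 *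
          (n * (n + 1) * (n + 2) * (n - 1) * (n - 2) * (n - 3) / 72) := by
  have h : (Module.finrank ℂ
      (↥(kerPsiDeg m n 3) ⧸
        Submodule.comap (kerPsiDeg m n 3).subtype (R1kerPsi2 m n)) : ℂ) = _ :=
    (Cubic.finrank_eq_trace m n).trans (Cubic.trace_pp m n)
  rw [Cubic.tr_zA, Cubic.tr_zB, Cubic.tr_zA, Cubic.tr_zB] at h
  exact_mod_cast h
end

section
/- The kernel of Ψ̄ (the ideal of relations among the generalized 2×2 permanents of a generic m×n matrix) is generated, as an ideal of R̄, by its homogeneous elements of degrees 2 and 3; that is, ker Ψ̄ equals the ideal of R̄ generated by (ker Ψ̄)_2 ∪ (ker Ψ̄)_3. -/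
open MvPolynomial

/-- Index set for the generalized 2×2 permanents of a generic `m × n` matrix:
quadruples `((i,i'),(j,j'))` with `i ≤ i'` and `j ≤ j'`. -/
def PermIdx (m n : ℕ) : Type :=
  {w : (Fin m × Fin m) × (Fin n × Fin n) // w.1.1 ≤ w.1.2 ∧ w.2.1 ≤ w.2.2}

/-- The generalized 2×2 permanent
`p_{(i,i'),(j,j')} = x_{i,j} x_{i',j'} + x_{i,j'} x_{i',j}`. -/
noncomputable def perm {m n : ℕ} (w : PermIdx m n) : MvPolynomial (Fin m × Fin n) ℂ :=
  X (w.1.1.1, w.1.2.1) * X (w.1.1.2, w.1.2.2) + X (w.1.1.1, w.1.2.2) * X (w.1.1.2, w.1.2.1)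

/-- The ℂ-algebra map `Ψ̄ : R̄ → S` sending `ȳ_w` to the corresponding permanent. -/
noncomputable def PsiBar (m n : ℕ) :
    MvPolynomial (PermIdx m n) ℂ →ₐ[ℂ] MvPolynomial (Fin m × Fin n) ℂ :=
  aeval perm

/-- The degree `d` graded component of `ker Ψ̄`, as a ℂ-subspace of `R̄`. -/
noncomputable def kerPsiBarDeg (m n d : ℕ) : Submodule ℂ (MvPolynomial (PermIdx m n) ℂ) :=
  Submodule.restrictScalars ℂ (RingHom.ker (PsiBar m n)) ⊓
    homogeneousSubmodule (PermIdx m n) ℂ d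

namespace PermRel

set_option linter.unusedSectionVars false

/-- permutations of the `2d` boxes -/
abbrev GG (ι : Type) := Equiv.Perm (ι × Bool)
/-- group algebra -/
abbrev AA (ι : Type) := MonoidAlgebra ℂ (GG ι)

/-- group element in the group algebra -/
noncomputable abbrev uu {ι : Type} (g : GG ι) : AA ι := MonoidAlgebra.of ℂ (GG ι) g

/-- flips -/
def fl {ι : Type} (c : ι → Bool) : GG ι where
  toFun p := (p.1, xor p.2 (c p.1))
  invFun p := (p.1, xor p.2 (c p.1))
  left_inv p := by simp
  right_inv p := by simp

/-- block permutations -/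
def dg {ι : Type} (s : Equiv.Perm ι) : GG ι where
  toFun p := (s p.1, p.2)
  invFun p := (s.symm p.1, p.2)
  left_inv p := by simp
  right_inv p := by simp

/-- permutations of the layer `false` -/
def lay {ι : Type} (s : Equiv.Perm ι) : GG ι where
  toFun p := (if p.2 then p.1 else s p.1, p.2)
  invFun p := (if p.2 then p.1 else s.symm p.1, p.2)
  left_inv p := by rcases p with ⟨p, _ | _⟩ <;> simp
  right_inv p := by rcases p with ⟨p, _ | _⟩ <;> simp

section basics
variable {ι : Type}

@[simp] lemma fl_apply (c : ι → Bool) (p : ι × Bool) : fl c p = (p.1, xor p.2 (c p.1)) := rfl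
@[simp] lemma dg_apply (c : Equiv.Perm ι) (p : ι × Bool) : dg c p = (c p.1, p.2) := rfl
@[simp] lemma lay_apply (c : Equiv.Perm ι) (p : ι × Bool) :
    lay c p = (if p.2 then p.1 else c p.1, p.2) := rfl

lemma fl_mul (c c' : ι → Bool) : fl c * fl c' = fl (fun k => xor (c' k) (c k)) := by
  ext p <;> simp

lemma fl_inv (c : ι → Bool) : (fl c)⁻¹ = fl c := by
  rw [inv_eq_iff_mul_eq_one, fl_mul]
  ext p <;> simp

lemma dg_mul (s t : Equiv.Perm ι) : dg (s * t) = dg s * dg t := by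
  ext p <;> simp

lemma lay_mul (s t : Equiv.Perm ι) : lay (s * t) = lay s * lay t := by
  ext ⟨p, _ | _⟩ <;> simp

lemma lay_one : lay (1 : Equiv.Perm ι) = 1 := by
  ext ⟨p, _ | _⟩ <;> simp

lemma dg_one : dg (1 : Equiv.Perm ι) = 1 := by
  ext ⟨p, _ | _⟩ <;> simp

lemma dg_lay (s t : Equiv.Perm ι) : dg s * lay t = lay (s * t * s⁻¹) * dg s := by
  ext ⟨p, _ | _⟩ <;> simp

lemma dg_fl (s : Equiv.Perm ι) (c : ι → Bool) : dg s * fl c = fl (fun k => c (s.symm k)) * dg s := by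
  ext ⟨p, _ | _⟩ <;> simp

lemma lay_fl_comm (s : Equiv.Perm ι) (c : ι → Bool) (h : ∀ k, c k = true → s k = k) :
    lay s * fl c = fl c * lay s := by
  have h2 : ∀ k, c (s k) = c k := by
    intro k
    by_cases hk : c k = true
    · rw [h k hk]
    · by_cases hk' : c (s k) = true
      · have := s.injective (h _ hk')
        rw [this]
      · simp at hk hk'; rw [hk, hk']
  ext ⟨p, _ | _⟩
  · simp only [Equiv.Perm.coe_mul, Function.comp_apply, fl_apply, lay_apply]
    cases hc : c p
    · simp
    · simp [h p hc]
  · simp only [Equiv.Perm.coe_mul, Function.comp_apply, fl_apply, lay_apply]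
    cases hc : c p
    · simp [h2, hc]
    · simp [h2, hc]
  · simp only [Equiv.Perm.coe_mul, Function.comp_apply, fl_apply, lay_apply]
    cases hc : c p
    · simp
    · simp [h p hc]
  · simp only [Equiv.Perm.coe_mul, Function.comp_apply, fl_apply, lay_apply]
    cases hc : c p
    · simp [hc]
    · simp [hc]

/-- flip everything -/
abbrev flu : GG ι := fl (fun _ => true)

lemma flu_lay (s : Equiv.Perm ι) : flu * lay s * flu = lay s⁻¹ * dg s := by
  ext ⟨p, _ | _⟩ <;> simp

lemma flu_lay' (s : Equiv.Perm ι) : flu * lay s * flu = dg s * lay s⁻¹ := by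
  ext ⟨p, _ | _⟩ <;> simp

lemma uu_mul (a b : GG ι) : uu (a * b) = uu a * uu b := map_mul _ _ _
lemma uu_one : uu (1 : GG ι) = 1 := map_one _

end basics

section ee
variable {ι : Type} [Fintype ι] [DecidableEq ι]

/-- idempotent of the flip group -/
noncomputable def ee (ι : Type) [Fintype ι] [DecidableEq ι] : AA ι :=
  ((Fintype.card (ι → Bool) : ℂ)⁻¹) • ∑ c : ι → Bool, uu (fl c)

lemma xor_sum {M : Type*} [AddCommMonoid M] (c : ι → Bool) (f : (ι → Bool) → M) :
    ∑ a : ι → Bool, f (fun k => xor (a k) (c k)) = ∑ a, f a := by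
  apply Fintype.sum_bijective (fun a : ι → Bool => fun k => xor (a k) (c k))
  · apply Function.Involutive.bijective
    intro a; ext k; simp
  · intro a; rfl

lemma fl_ee (c : ι → Bool) : uu (fl c) * ee ι = ee ι := by
  unfold ee
  rw [mul_smul_comm, Finset.mul_sum]
  congr 1
  simp only [← uu_mul, fl_mul]
  exact xor_sum c (fun a => uu (fl a))

lemma ee_fl (c : ι → Bool) : ee ι * uu (fl c) = ee ι := by
  unfold ee
  rw [smul_mul_assoc, Finset.sum_mul]
  congr 1
  simp only [← uu_mul, fl_mul]
  rw [← xor_sum c (fun a => uu (fl a))]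
  simp only [Bool.xor_comm]

lemma card_ne : (Fintype.card (ι → Bool) : ℂ) ≠ 0 := by
  exact_mod_cast Fintype.card_ne_zero

/-- sandwiching: a linear map constant along the flips. -/
lemma ee_avg {M : Type*} [AddCommGroup M] [Module ℂ M] (F : AA ι →ₗ[ℂ] M) (z : M)
    (h : ∀ c, F (uu (fl c)) = z) : F (ee ι) = z := by
  unfold ee
  rw [map_smul, map_sum, Finset.sum_congr rfl (fun c _ => h c)]
  simp only [Finset.sum_const, Finset.card_univ]
  rw [← Nat.cast_smul_eq_nsmul ℂ, smul_smul, inv_mul_cancel₀, one_smul]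
  exact card_ne

lemma ee_avg2 {M : Type*} [AddCommGroup M] [Module ℂ M] (F : AA ι →ₗ[ℂ] M) (z : M) (c' : ι → Bool)
    (h : ∀ c, F (uu (fl c)) + F (uu (fl (fun k => xor (c k) (c' k)))) = z) :
    (2 : ℂ) • F (ee ι) = z := by
  have := ee_avg (F + F ∘ₗ LinearMap.mulRight ℂ (uu (fl c'))) z (by
    intro c
    simp only [LinearMap.add_apply, LinearMap.comp_apply, LinearMap.mulRight_apply, ← uu_mul, fl_mul]
    rw [← h c]
    simp only [Bool.xor_comm])
  simp only [LinearMap.add_apply, LinearMap.comp_apply, LinearMap.mulRight_apply, ee_fl] at this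
  rw [two_smul, this]

lemma ee_ee : ee ι * ee ι = ee ι := by
  have := ee_avg (LinearMap.mulLeft ℂ (ee ι)) (ee ι) (fun c => ee_fl c)
  simpa using this

lemma dg_ee (s : Equiv.Perm ι) : uu (dg s) * ee ι = ee ι * uu (dg s) := by
  unfold ee
  rw [mul_smul_comm, smul_mul_assoc, Finset.mul_sum, Finset.sum_mul]
  congr 1
  simp only [← uu_mul, dg_fl]
  apply Fintype.sum_bijective (fun a : ι → Bool => fun k => a (s.symm k))
  · exact (Equiv.arrowCongr s (Equiv.refl Bool)).bijective
  · intro a; rfl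

end ee

section gen
variable {ι : Type} [Fintype ι] [DecidableEq ι]

/-- sandwich linear map -/
noncomputable def sw (a b : AA ι) : AA ι →ₗ[ℂ] AA ι :=
  LinearMap.mulLeft ℂ (ee ι * a) ∘ₗ LinearMap.mulRight ℂ (b * ee ι)

lemma sw_apply (a b x : AA ι) : sw a b x = ee ι * (a * x * b) * ee ι := by
  simp [sw, mul_assoc]

lemma fl_absorb (c c' : ι → Bool) (x : AA ι) :
    ee ι * (uu (fl c) * x * uu (fl c')) * ee ι = ee ι * x * ee ι := by
  calc _ = (ee ι * uu (fl c)) * x * (uu (fl c') * ee ι) := by simp only [mul_assoc]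
    _ = _ := by rw [fl_ee, ee_fl]

lemma P0 (S : ι → Bool) (τ ρ : Equiv.Perm ι) (h : ∀ k, S k = false → τ k = k ∨ ρ k = k)
    (c : ι → Bool) :
    sw (uu (lay τ)) (uu (lay ρ)) (uu (fl c)) =
    sw (uu (lay τ)) (uu (lay ρ)) (uu (fl (fun k => S k && c k))) := by
  rw [sw_apply, sw_apply]
  rw [← fl_absorb (fun k => if S k = false ∧ τ k = k then c k else false)
    (fun k => if S k = false ∧ τ k ≠ k then c k else false)
    (uu (lay τ) * uu (fl (fun k => S k && c k)) * uu (lay ρ))]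
  congr 2
  simp only [← uu_mul]
  congr 1
  rw [show ∀ a b c d e : GG ι, a * (b * c * d) * e = (a * b) * c * (d * e) by
    intros; simp only [mul_assoc]]
  rw [← lay_fl_comm, lay_fl_comm ρ]
  · rw [show ∀ a b c d e : GG ι, a * b * c * (d * e) = a * (b * c * d) * e by
      intros; simp only [mul_assoc]]
    rw [fl_mul, fl_mul]
    congr 3
    ext k
    cases hk : S k
    · by_cases hk' : τ k = k <;> simp [hk']
    · simp
  · intro k hk
    by_cases h1 : S k = false ∧ τ k ≠ k
    · exact (h k h1.1).resolve_left h1.2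
    · rw [if_neg h1] at hk; simp at hk
  · intro k hk
    by_cases h1 : S k = false ∧ τ k = k
    · exact h1.2
    · rw [if_neg h1] at hk; simp at hk

lemma P1 (i : ι) (τ ρ : Equiv.Perm ι) (h : ∀ k, k ≠ i → τ k = k ∨ ρ k = k)
    (c : ι → Bool) :
    sw (uu (lay τ)) (uu (lay ρ)) (uu (fl c)) =
    sw (uu (lay τ)) (uu (lay ρ)) (uu (fl (fun k => decide (k = i) && c k))) :=
  P0 _ τ ρ (by simpa using h) c

lemma P1F (i : ι) (τ ρ : Equiv.Perm ι) (h : ∀ k, k ≠ i → τ k = k ∨ ρ k = k)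
    (c : ι → Bool) (hc : c i = false) :
    sw (uu (lay τ)) (uu (lay ρ)) (uu (fl c)) = ee ι * uu (lay (τ * ρ)) * ee ι := by
  rw [P1 i τ ρ h, sw_apply]
  congr 2
  rw [lay_mul, ← uu_mul, ← uu_mul]
  congr 2
  convert mul_one _
  ext p
  · simp
  · by_cases hp : p.1 = i <;> simp [hp, hc]

lemma P1T (i : ι) (τ ρ : Equiv.Perm ι) (h : ∀ k, k ≠ i → τ k = k ∨ ρ k = k)
    (c : ι → Bool) (hc : c i = true) :
    sw (uu (lay τ)) (uu (lay ρ)) (uu (fl c)) = ee ι * (uu (lay τ) * uu flu * uu (lay ρ)) * ee ι := by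
  rw [P1 i τ ρ h, ← sw_apply, P1 i τ ρ h (fun _ => true)]
  congr 3
  ext k
  by_cases hk : k = i <;> simp [hk, hc]

lemma P2 (i : ι) (τ ρ : Equiv.Perm ι) (h : ∀ k, k ≠ i → τ k = k ∨ ρ k = k) :
    (2 : ℂ) • (ee ι * (uu (lay τ) * ee ι * uu (lay ρ)) * ee ι) =
      ee ι * uu (lay (τ * ρ)) * ee ι + ee ι * (uu (lay τ) * uu flu * uu (lay ρ)) * ee ι := by
  rw [← sw_apply]
  apply ee_avg2 _ _ (fun k => decide (k = i))
  intro c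
  cases hc : c i
  · rw [P1F i τ ρ h c hc, P1T i τ ρ h _ (by simp [hc])]
  · rw [P1T i τ ρ h c hc, P1F i τ ρ h _ (by simp [hc]), add_comm]

lemma P3 (τ ρ : Equiv.Perm ι) (h : ∀ k, τ k = k ∨ ρ k = k) :
    ee ι * (uu (lay τ) * ee ι * uu (lay ρ)) * ee ι = ee ι * uu (lay (τ * ρ)) * ee ι := by
  rw [← sw_apply]
  apply ee_avg
  intro c
  rw [P0 (fun _ => false) τ ρ (fun k _ => h k), sw_apply]
  have : fl (fun k : ι => false && c k) = 1 := by ext p <;> simp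
  rw [this, uu_one, mul_one, lay_mul, uu_mul]

end gen

section gen2
variable {ι : Type} [Fintype ι] [DecidableEq ι]

/-- closure properties of the set of group algebra elements that can be moved across -/
structure Good (K : Submodule ℂ (AA ι)) : Prop where
  ee_iff : ∀ x, x ∈ K ↔ ee ι * x * ee ι ∈ K
  mul : ∀ x y, x ∈ K → y ∈ K → x * ee ι * y ∈ K
  dg : ∀ s, uu (dg s) ∈ K
  two : ∀ i j, i ≠ j → uu (lay (Equiv.swap i j)) ∈ K
  three : ∀ i j l, i ≠ j → j ≠ l → i ≠ l → uu (lay (Equiv.swap l j * Equiv.swap i l)) ∈ K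

variable {K : Submodule ℂ (AA ι)}

lemma Good.fl_left (hK : Good K) (c : ι → Bool) (x : AA ι) : uu (fl c) * x ∈ K ↔ x ∈ K := by
  rw [hK.ee_iff, hK.ee_iff x, ← mul_assoc, ee_fl]

lemma Good.fl_right (hK : Good K) (c : ι → Bool) (x : AA ι) : x * uu (fl c) ∈ K ↔ x ∈ K := by
  rw [hK.ee_iff, hK.ee_iff x, mul_assoc, mul_assoc, fl_ee, ← mul_assoc]

lemma Good.dg_left (hK : Good K) (s : Equiv.Perm ι) {x : AA ι} (hx : x ∈ K) :
    uu (PermRel.dg s) * x ∈ K := by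
  rw [hK.ee_iff]
  have := (hK.ee_iff _).1 (hK.mul _ _ (hK.dg s) hx)
  rwa [dg_ee, ← mul_assoc, ← mul_assoc, ee_ee, mul_assoc (ee ι) (uu _)] at this

lemma Good.dg_right (hK : Good K) (s : Equiv.Perm ι) {x : AA ι} (hx : x ∈ K) :
    x * uu (PermRel.dg s) ∈ K := by
  rw [hK.ee_iff]
  have := (hK.ee_iff _).1 (hK.mul _ _ hx (hK.dg s))
  rwa [mul_assoc x, ← dg_ee, ← mul_assoc x, mul_assoc, mul_assoc _ (ee ι) (ee ι), ee_ee,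
    ← mul_assoc] at this

lemma Good.dg_left_iff (hK : Good K) (s : Equiv.Perm ι) (x : AA ι) :
    uu (PermRel.dg s) * x ∈ K ↔ x ∈ K := by
  refine ⟨fun h => ?_, hK.dg_left s⟩
  have := hK.dg_left s⁻¹ h
  rwa [← mul_assoc, ← uu_mul, ← dg_mul, inv_mul_cancel, dg_one, uu_one, one_mul] at this

lemma Good.join (hK : Good K) (i : ι) (τ ρ : Equiv.Perm ι) (h : ∀ k, k ≠ i → τ k = k ∨ ρ k = k)
    (hτ : uu (lay τ) ∈ K) (hρ : uu (lay ρ) ∈ K) :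
    uu (lay (τ * ρ)) + uu (lay τ) * uu flu * uu (lay ρ) ∈ K := by
  rw [hK.ee_iff, mul_add, add_mul, ← P2 i τ ρ h]
  exact K.smul_mem _ ((hK.ee_iff _).1 (hK.mul _ _ hτ hρ))

lemma Good.joinR (hK : Good K) (i : ι) (τ ρ : Equiv.Perm ι) (h : ∀ k, k ≠ i → τ k = k ∨ ρ k = k)
    (hτ : uu (lay τ) ∈ K) (hρ : uu (lay ρ) ∈ K) :
    uu (lay (τ * ρ)) + uu (lay (τ * ρ⁻¹)) * uu (PermRel.dg ρ) ∈ K := by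
  have h1 := hK.join i τ ρ h hτ hρ
  have e : uu (lay (τ * ρ⁻¹)) * uu (PermRel.dg ρ) = uu (lay τ) * uu flu * uu (lay ρ) * uu flu := by
    rw [lay_mul, uu_mul, mul_assoc, ← uu_mul _ (PermRel.dg ρ), ← flu_lay]
    simp only [uu_mul, mul_assoc]
  have e' : ee ι * (uu (lay (τ * ρ)) + uu (lay (τ * ρ⁻¹)) * uu (PermRel.dg ρ)) * ee ι =
      ee ι * (uu (lay (τ * ρ)) + uu (lay τ) * uu flu * uu (lay ρ)) * ee ι := by
    rw [mul_assoc, add_mul, e, mul_assoc _ (uu flu) (ee ι), fl_ee, ← add_mul, ← mul_assoc]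
  rw [hK.ee_iff] at h1 ⊢
  rw [e']
  exact h1

lemma Good.joinL (hK : Good K) (i : ι) (ρ τ : Equiv.Perm ι) (h : ∀ k, k ≠ i → ρ k = k ∨ τ k = k)
    (hρ : uu (lay ρ) ∈ K) (hτ : uu (lay τ) ∈ K) :
    uu (lay (ρ * τ)) + uu (PermRel.dg ρ) * uu (lay (ρ⁻¹ * τ)) ∈ K := by
  have h1 := hK.join i ρ τ h hρ hτ
  have e : uu (PermRel.dg ρ) * uu (lay (ρ⁻¹ * τ)) = uu flu * (uu (lay ρ) * uu flu * uu (lay τ)) := by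
    rw [lay_mul, uu_mul, ← mul_assoc, ← uu_mul (PermRel.dg ρ), ← flu_lay']
    simp only [uu_mul, mul_assoc]
  have e' : ee ι * (uu (lay (ρ * τ)) + uu (PermRel.dg ρ) * uu (lay (ρ⁻¹ * τ))) * ee ι =
      ee ι * (uu (lay (ρ * τ)) + uu (lay ρ) * uu flu * uu (lay τ)) * ee ι := by
    rw [mul_add, e, ← mul_assoc _ (uu flu), ee_fl, ← mul_add]
  rw [hK.ee_iff] at h1 ⊢
  rw [e']
  exact h1

lemma swap_id1 {i j l : ι} (hij : i ≠ j) (hjl : j ≠ l) (hil : i ≠ l) :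
    Equiv.swap i l * (Equiv.swap l j * (Equiv.swap i l * Equiv.swap l j)) =
      Equiv.swap i j * Equiv.swap j l := by
  ext x
  simp only [Equiv.Perm.coe_mul, Function.comp_apply, Equiv.swap_apply_def]
  grind

lemma swap_id2 {i j l : ι} (hij : i ≠ j) (hjl : j ≠ l) (hil : i ≠ l) :
    Equiv.swap i l * Equiv.swap l j = Equiv.swap i j * Equiv.swap i l := by
  ext x
  simp only [Equiv.Perm.coe_mul, Function.comp_apply, Equiv.swap_apply_def]
  grind

lemma support_lt_right {σ : Equiv.Perm ι} {i j : ι} (hij : σ i = j) (hne : i ≠ j) :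
    (σ * Equiv.swap i j).support.card < σ.support.card := by
  apply Finset.card_lt_card
  rw [Finset.ssubset_iff_of_subset]
  · refine ⟨j, ?_, ?_⟩
    · rw [Equiv.Perm.mem_support]; rw [← hij]; intro h
      exact hne (by rw [← hij]; exact (σ.injective h).symm)
    · rw [Equiv.Perm.mem_support]; simp [hij]
  · intro k
    simp only [Equiv.Perm.mem_support, Equiv.Perm.coe_mul, Function.comp_apply, Equiv.swap_apply_def]
    split_ifs with h1 h2
    · subst h1; intro _ h; exact hne (h.symm.trans hij)
    · subst h2; intro h; exact absurd hij h
    · exact id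

lemma support_lt_left {σ : Equiv.Perm ι} {i j : ι} (hij : σ i = j) (hne : i ≠ j) :
    (Equiv.swap i j * σ).support.card < σ.support.card := by
  have h : Equiv.swap i j * σ = Equiv.swap i j * (σ * Equiv.swap i j) * (Equiv.swap i j)⁻¹ := by
    simp [mul_assoc]
  rw [h, Equiv.Perm.card_support_conj]
  exact support_lt_right hij hne

lemma Good.relR (hK : Good K) (N : ℕ) (IH : ∀ τ : Equiv.Perm ι, τ.support.card < N → uu (lay τ) ∈ K)
    (σ : Equiv.Perm ι) (hσ : σ.support.card ≤ N) (i j : ι) (hij : σ i = j) (hne : i ≠ j) :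
    uu (lay σ) + uu (lay σ) * uu (PermRel.dg (Equiv.swap i j)) ∈ K := by
  have := hK.joinR i (σ * Equiv.swap i j) (Equiv.swap i j) (by
    intro k hk
    by_cases hkj : k = j
    · left; subst hkj; simp [hij]
    · right; exact Equiv.swap_apply_of_ne_of_ne hk hkj)
    (IH _ ((support_lt_right hij hne).trans_le hσ)) (hK.two i j hne)
  simpa only [mul_assoc, Equiv.swap_inv, Equiv.swap_mul_self, mul_one] using this

lemma Good.relL (hK : Good K) (N : ℕ) (IH : ∀ τ : Equiv.Perm ι, τ.support.card < N → uu (lay τ) ∈ K)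
    (σ : Equiv.Perm ι) (hσ : σ.support.card ≤ N) (i j : ι) (hij : σ i = j) (hne : i ≠ j) :
    uu (lay σ) + uu (PermRel.dg (Equiv.swap i j)) * uu (lay σ) ∈ K := by
  have := hK.joinL j (Equiv.swap i j) (Equiv.swap i j * σ) (by
    intro k hk
    by_cases hki : k = i
    · right; subst hki; simp [hij]
    · left; exact Equiv.swap_apply_of_ne_of_ne hki hk)
    (hK.two i j hne) (IH _ ((support_lt_left hij hne).trans_le hσ))
  simpa only [← mul_assoc, Equiv.swap_inv, Equiv.swap_mul_self, one_mul] using this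

lemma Good.lay_mem (hK : Good K) (N : ℕ) :
    ∀ σ : Equiv.Perm ι, σ.support.card = N → uu (lay σ) ∈ K := by
  induction N using Nat.strong_induction_on with
  | _ N IH0 =>
  intro σ hσ
  have IH : ∀ τ : Equiv.Perm ι, τ.support.card < N → uu (lay τ) ∈ K := fun τ h => IH0 _ h τ rfl
  by_cases h3 : ∃ i, σ i ≠ i ∧ σ (σ i) ≠ i
  · obtain ⟨i, hi1, hi2⟩ := h3
    obtain ⟨j, hj⟩ : ∃ j, j = σ i := ⟨_, rfl⟩
    obtain ⟨l, hl⟩ : ∃ l, l = σ j := ⟨_, rfl⟩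
    rw [← hj] at hi1 hi2
    rw [← hl] at hi2
    have hij : i ≠ j := hi1.symm
    have hil : i ≠ l := hi2.symm
    have hjl : j ≠ l := by
      intro h; apply hij; apply σ.injective; rw [← hj, ← hl, h]
    set ρ : Equiv.Perm ι := Equiv.swap l j * Equiv.swap i l with hρ
    set τ : Equiv.Perm ι := σ * Equiv.swap i l * Equiv.swap l j with hτ
    have e1 : τ * ρ = σ := by
      simp [hτ, hρ, mul_assoc]
    set σ' : Equiv.Perm ι := Equiv.swap j l * σ * Equiv.swap j l with hσ'
    have e2 : τ * ρ⁻¹ = σ' := by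
      rw [hσ', Equiv.swap_mul_eq_mul_swap, hτ, hρ]
      have a1 : σ⁻¹ j = i := by rw [hj]; simp
      have a2 : σ⁻¹ l = j := by rw [hl]; simp
      rw [a1, a2]
      simp only [mul_assoc, mul_inv_rev, Equiv.swap_inv]
      rw [swap_id1 hij hjl hil]
    have hτc : τ.support.card < N := by
      have s1 : (σ * Equiv.swap i j).support.card < N := hσ ▸ support_lt_right hj.symm hij
      have e3 : τ = (σ * Equiv.swap i j) * Equiv.swap i l := by
        rw [hτ, mul_assoc, mul_assoc, swap_id2 hij hjl hil]
      rw [e3]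
      refine (support_lt_right ?_ hil).trans s1
      simp [← hl]
    have hτm := IH τ hτc
    have hρm := hK.three i j l hij hjl hil
    have r1 := hK.joinR i τ ρ (by
      intro k hk
      by_cases hkj : k = j
      · left; subst hkj; simp [hτ, ← hj]
      · by_cases hkl : k = l
        · left; subst hkl
          simp [hτ]
          rw [Equiv.swap_apply_of_ne_of_ne hij.symm hjl]; exact hl.symm
        · right; simp [hρ, Equiv.swap_apply_def, hk, hkj, hkl]) hτm hρm
    rw [e1, e2] at r1
    have hσ'c : σ'.support.card ≤ N := by
      have : σ' = Equiv.swap j l * σ * (Equiv.swap j l)⁻¹ := by simp [hσ']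
      rw [this, Equiv.Perm.card_support_conj, hσ]
    have s1 : σ' i = l := by
      simp only [hσ', Equiv.Perm.coe_mul, Function.comp_apply]
      rw [Equiv.swap_apply_of_ne_of_ne hij hil, ← hj]; simp
    have s2 : σ' l = j := by
      simp only [hσ', Equiv.Perm.coe_mul, Function.comp_apply]
      rw [Equiv.swap_apply_right, ← hl]; simp
    have r2 := hK.relR N IH σ' hσ'c i l s1 hil
    have r3 := hK.dg_right (Equiv.swap i l) (hK.relR N IH σ' hσ'c l j s2 hjl.symm)
    have r4 := hK.dg_right (Equiv.swap j l) (hK.relL N IH σ hσ.le j l hl.symm hjl)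
    have r5 := hK.relR N IH σ hσ.le j l hl.symm hjl
    have e4 : uu (PermRel.dg ρ) = uu (PermRel.dg (Equiv.swap l j)) * uu (PermRel.dg (Equiv.swap i l)) := by
      rw [hρ, dg_mul, uu_mul]
    have e5 : uu (lay σ') =
        uu (PermRel.dg (Equiv.swap j l)) * uu (lay σ) * uu (PermRel.dg (Equiv.swap j l)) := by
      rw [← uu_mul, dg_lay, ← uu_mul, mul_assoc, ← dg_mul]
      simp [hσ', dg_one]
    rw [add_mul, ← e5] at r4
    rw [add_mul] at r3
    rw [e4, ← mul_assoc] at r1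
    have key : (2 : ℂ) • uu (lay σ) ∈ K := by
      have := K.add_mem (K.sub_mem (K.add_mem r1 r2) r3) (K.sub_mem r5 r4)
      convert this using 1
      rw [two_smul]; abel
    have := K.smul_mem (2 : ℂ)⁻¹ key
    rwa [smul_smul, inv_mul_cancel₀ two_ne_zero, one_smul] at this
  · push Not at h3
    by_cases h1 : ∃ i, σ i ≠ i
    · obtain ⟨i, hi⟩ := h1
      obtain ⟨j, hj⟩ : ∃ j, j = σ i := ⟨_, rfl⟩
      have hji := h3 i hi
      rw [← hj] at hi hji
      have hτ := IH (σ * Equiv.swap i j) (hσ ▸ support_lt_right hj.symm hi.symm)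
      rw [hK.ee_iff]
      have := (hK.ee_iff _).1 (hK.mul _ _ hτ (hK.two i j hi.symm))
      rw [P3] at this
      · simpa [mul_assoc] using this
      · intro k
        by_cases hki : k = i
        · left; subst hki; simp [hji]
        · by_cases hkj : k = j
          · left; subst hkj; simp [← hj]
          · right; exact Equiv.swap_apply_of_ne_of_ne hki hkj
    · push Not at h1
      have : σ = 1 := by ext x; simp [h1 x]
      rw [this, lay_one, ← dg_one]
      exact hK.dg 1

/-- a two-regular bipartite multigraph has a perfect matching -/
lemma exists_matching (g : GG ι) : ∃ (f : Equiv.Perm ι) (c : ι → Bool), ∀ k, (g (k, c k)).1 = f k := by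
  have h := (Finset.all_card_le_biUnion_card_iff_exists_injective
    (fun k : ι => ({(g (k, false)).1, (g (k, true)).1} : Finset ι))).1 (by
      intro s
      have h1 : (s ×ˢ (Finset.univ : Finset Bool)).card ≤
          ((s.biUnion (fun k : ι => ({(g (k, false)).1, (g (k, true)).1} : Finset ι))) ×ˢ
            (Finset.univ : Finset Bool)).card := by
        apply Finset.card_le_card_of_injOn g
        · rintro ⟨k, b⟩ hk
          simp only [Finset.coe_product, Set.mem_prod, Finset.mem_coe, Finset.mem_univ, and_true,
            Finset.mem_biUnion] at hk ⊢
          refine ⟨k, hk, ?_⟩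
          cases b <;> simp
        · exact g.injective.injOn
      simpa [Finset.card_product] using h1)
  obtain ⟨f, hf, hm⟩ := h
  have hb : Function.Bijective f := Finite.injective_iff_bijective.1 hf
  refine ⟨Equiv.ofBijective f hb, fun k => decide (f k ≠ (g (k, false)).1), fun k => ?_⟩
  have := hm k
  simp only [Finset.mem_insert, Finset.mem_singleton] at this
  by_cases hk : f k = (g (k, false)).1
  · simp [hk]
  · simp [hk]
    exact (this.resolve_left hk).symm

theorem Good.all (hK : Good K) (g : GG ι) : uu g ∈ K := by
  obtain ⟨f, c, hf⟩ := exists_matching g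
  rw [← hK.fl_right (fun k => !(c k)), ← hK.dg_left_iff f⁻¹, ← uu_mul, ← uu_mul]
  set g1 : GG ι := PermRel.dg f⁻¹ * (g * fl (fun k => !(c k))) with hg1
  have h1 : ∀ k, (g1 (k, true)).1 = k := by
    intro k; simp [hg1, hf]
  rw [← hK.fl_left (fun k => !(g1 (k, true)).2), ← uu_mul]
  set g2 : GG ι := fl (fun k => !(g1 (k, true)).2) * g1 with hg2
  have h2 : ∀ k, g2 (k, true) = (k, true) := by
    intro k
    ext
    · simp [hg2, h1]
    · simp [hg2, h1]
  have h3 : ∀ k, (g2 (k, false)).2 = false := by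
    intro k
    by_contra hk
    simp only [Bool.not_eq_false] at hk
    have : g2 (k, false) = g2 ((g2 (k, false)).1, true) := by
      rw [h2]; ext <;> simp [hk]
    have := g2.injective this
    simp at this
  have h4 : Function.Injective (fun k => (g2 (k, false)).1) := by
    intro a b hab
    have : g2 (a, false) = g2 (b, false) := by
      ext
      · exact hab
      · rw [h3, h3]
    simpa using g2.injective this
  have : g2 = lay (Equiv.ofBijective _ (Finite.injective_iff_bijective.1 h4)) := by
    ext ⟨k, _ | _⟩ <;> simp [h2, h3]
  rw [this]
  exact hK.lay_mem _ _ rfl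

end gen2

section maschke

lemma exists_unit_aux {G A : Type} [Group G] [Fintype G] [Ring A] [Algebra ℂ A] (u : G →* A)
    (e ε : A) (a : G → A) (ha : ∑ g, a g * (e * u g) = ε) :
    ∃ b : A, (∑ k : G, u k * (b * e) * u k⁻¹) = (Fintype.card G : ℂ)⁻¹ • ∑ k : G, u k * ε * u k⁻¹ := by
  refine ⟨(Fintype.card G : ℂ)⁻¹ • ∑ g : G, u g * a g, ?_⟩
  have h : ∀ k, u k * (((Fintype.card G : ℂ)⁻¹ • ∑ g : G, u g * a g) * e) * u k⁻¹ =
      (Fintype.card G : ℂ)⁻¹ • ∑ g, u k * (u g * a g * e) * u k⁻¹ := by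
    intro k
    rw [smul_mul_assoc, mul_smul_comm, smul_mul_assoc, Finset.sum_mul, Finset.mul_sum,
      Finset.sum_mul]
  have h' : ∀ k, u k * ε * u k⁻¹ = ∑ g, u k * (a g * (e * u g)) * u k⁻¹ := by
    intro k
    rw [← ha, Finset.mul_sum, Finset.sum_mul]
  rw [Finset.sum_congr rfl (fun k _ => h k), Finset.sum_congr rfl (fun k _ => h' k),
    ← Finset.smul_sum, Finset.sum_comm]
  congr 1
  rw [Finset.sum_comm (s := (Finset.univ : Finset G)) (t := (Finset.univ : Finset G))
    (f := fun k g => u k * (a g * (e * u g)) * u k⁻¹)]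
  refine Finset.sum_congr rfl fun g _ => ?_
  apply Fintype.sum_bijective (fun k : G => k * g) (Group.mulRight_bijective g)
  intro k
  rw [mul_inv_rev, map_mul, map_mul]
  simp only [mul_assoc]
  rw [← mul_assoc (u g) (u g⁻¹), ← map_mul, mul_inv_cancel, map_one, one_mul]

lemma avg_central {G A : Type} [Group G] [Fintype G] [Ring A] [Algebra ℂ A] (u : G →* A)
    (ε : A) (g : G) : u g * (∑ k : G, u k * ε * u k⁻¹) = (∑ k : G, u k * ε * u k⁻¹) * u g := by
  rw [Finset.mul_sum, Finset.sum_mul]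
  apply Fintype.sum_bijective (fun k : G => g * k) (Group.mulLeft_bijective g)
  intro k
  rw [mul_inv_rev, map_mul, map_mul]
  simp only [mul_assoc]
  rw [← map_mul u g⁻¹, inv_mul_cancel, map_one, mul_one]

lemma exists_unit_gen {G : Type} [Group G] [Fintype G] (e : MonoidAlgebra ℂ G) :
    ∃ b : MonoidAlgebra ℂ G, (∑ k : G, MonoidAlgebra.of ℂ G k * (b * e) * MonoidAlgebra.of ℂ G k⁻¹) * e
      = e := by
  generalize hu : MonoidAlgebra.of ℂ G = u
  let I : Submodule (MonoidAlgebra ℂ G) (MonoidAlgebra ℂ G) :=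
    Submodule.span (MonoidAlgebra ℂ G) (Set.range (fun g : G => e * u g))
  obtain ⟨L, hL⟩ := ComplementedLattice.exists_isCompl I
  have h1 : (1 : MonoidAlgebra ℂ G) ∈ I ⊔ L := by rw [hL.sup_eq_top]; trivial
  obtain ⟨ε, hε, l, hl, hεl⟩ := Submodule.mem_sup.1 h1
  have h2 : ∀ g : G, e * u g * ε = e * u g := by
    intro g
    have hg : e * u g ∈ I := Submodule.subset_span ⟨g, rfl⟩
    have e1 : e * u g * l = e * u g - e * u g * ε := by
      rw [eq_sub_iff_add_eq, add_comm, ← mul_add, hεl, mul_one]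
    have m1 : e * u g * l ∈ L := L.smul_mem (e * u g) hl
    have m2 : e * u g * l ∈ I := by
      rw [e1]; exact I.sub_mem hg (I.smul_mem (e * u g) hε)
    have : e * u g * l ∈ I ⊓ L := ⟨m2, m1⟩
    rw [hL.inf_eq_bot, Submodule.mem_bot, e1, sub_eq_zero] at this
    exact this.symm
  obtain ⟨a, ha⟩ := (Submodule.mem_span_range_iff_exists_fun (MonoidAlgebra ℂ G)).1 hε
  simp only [smul_eq_mul] at ha
  have hc : (Fintype.card G : ℂ) ≠ 0 := by exact_mod_cast Fintype.card_ne_zero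
  obtain ⟨b, hb⟩ := exists_unit_aux u e ε a ha
  refine ⟨b, ?_⟩
  rw [hb]
  have comm : ∀ x : MonoidAlgebra ℂ G, x * (∑ k : G, u k * ε * u k⁻¹) =
      (∑ k : G, u k * ε * u k⁻¹) * x := by
    intro x
    induction x using MonoidAlgebra.induction_on with
    | of g => rw [hu]; exact avg_central u ε g
    | add x y hx hy => rw [add_mul, mul_add, hx, hy]
    | smul r x hx => rw [smul_mul_assoc, mul_smul_comm, hx]
  rw [smul_mul_assoc, ← comm, Finset.mul_sum]
  have : ∀ k : G, e * (u k * ε * u k⁻¹) = e := by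
    intro k
    rw [← mul_assoc, ← mul_assoc, h2, mul_assoc, ← map_mul, mul_inv_cancel, map_one, mul_one]
  rw [Finset.sum_congr rfl (fun k _ => this k), Finset.sum_const, Finset.card_univ,
    ← Nat.cast_smul_eq_nsmul ℂ, smul_smul, inv_mul_cancel₀ hc, one_smul]

lemma exists_unit {ι : Type} [Fintype ι] [DecidableEq ι] :
    ∃ b : AA ι, (∑ k : GG ι, uu k * (b * ee ι) * uu k⁻¹) * ee ι = ee ι :=
  exists_unit_gen (ee ι)

end maschke

section bimod
variable {ι : Type} [Fintype ι] [DecidableEq ι] {s t : Type}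

/-- functions of two tableaux -/
abbrev WW (ι s t M : Type) := (ι × Bool → s) → (ι × Bool → t) → M

variable {M M' : Type} [AddCommGroup M] [Module ℂ M] [AddCommGroup M'] [Module ℂ M']

/-- first action -/
def lam (ι s t M : Type) [AddCommGroup M] [Module ℂ M] : GG ι →* Module.End ℂ (WW ι s t M) where
  toFun g :=
    { toFun := fun F α β => F (α ∘ g) β
      map_add' := fun _ _ => rfl
      map_smul' := fun _ _ => rfl }
  map_one' := rfl
  map_mul' _ _ := rfl

/-- second action -/
def rho (ι s t M : Type) [AddCommGroup M] [Module ℂ M] : GG ι →* Module.End ℂ (WW ι s t M) where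
  toFun g :=
    { toFun := fun F α β => F α (β ∘ g)
      map_add' := fun _ _ => rfl
      map_smul' := fun _ _ => rfl }
  map_one' := rfl
  map_mul' _ _ := rfl

lemma lam_apply (g : GG ι) (F : WW ι s t M) (α : ι × Bool → s) (β : ι × Bool → t) :
    lam ι s t M g F α β = F (α ∘ g) β := rfl
lemma rho_apply (g : GG ι) (F : WW ι s t M) (α : ι × Bool → s) (β : ι × Bool → t) :
    rho ι s t M g F α β = F α (β ∘ g) := rfl

/-- first action of the group algebra -/
noncomputable def Lam : AA ι →ₐ[ℂ] Module.End ℂ (WW ι s t M) :=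
  MonoidAlgebra.lift ℂ _ _ (lam ι s t M)

/-- second action of the group algebra, made contravariant, as a hom to the opposite -/
noncomputable def Nop : AA ι →ₐ[ℂ] (Module.End ℂ (WW ι s t M))ᵐᵒᵖ :=
  MonoidAlgebra.lift ℂ _ _
    { toFun := fun g => MulOpposite.op (rho ι s t M g⁻¹)
      map_one' := by simp
      map_mul' := fun a b => by rw [mul_inv_rev, map_mul]; rfl }

/-- second action of the group algebra, made contravariant -/
noncomputable def NN (x : AA ι) : Module.End ℂ (WW ι s t M) := (Nop x).unop

lemma Lam_uu (g : GG ι) : (Lam (uu g) : Module.End ℂ (WW ι s t M)) = lam ι s t M g :=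
  MonoidAlgebra.lift_of _ _

lemma NN_uu (g : GG ι) : (NN (uu g) : Module.End ℂ (WW ι s t M)) = rho ι s t M g⁻¹ := by
  unfold NN Nop
  rw [MonoidAlgebra.lift_of]; rfl

lemma NN_mul (x y : AA ι) : (NN (x * y) : Module.End ℂ (WW ι s t M)) = NN y * NN x := by
  unfold NN; rw [map_mul]; rfl

lemma NN_add (x y : AA ι) : (NN (x + y) : Module.End ℂ (WW ι s t M)) = NN x + NN y := by
  unfold NN; rw [map_add]; rfl

lemma NN_smul (c : ℂ) (x : AA ι) : (NN (c • x) : Module.End ℂ (WW ι s t M)) = c • NN x := by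
  unfold NN; rw [map_smul]; rfl

/-- `NN` as a linear map -/
noncomputable def NNl : AA ι →ₗ[ℂ] Module.End ℂ (WW ι s t M) where
  toFun := NN
  map_add' := NN_add
  map_smul' := NN_smul

lemma Lam_NN_comm (x y : AA ι) (F : WW ι s t M) : Lam x (NN y F) = NN y (Lam x F) := by
  induction x using MonoidAlgebra.induction_on with
  | of g =>
    induction y using MonoidAlgebra.induction_on with
    | of h =>
      have h1 := Lam_uu (M := M) (s := s) (t := t) g
      have h2 := NN_uu (M := M) (s := s) (t := t) h
      unfold uu at h1 h2
      rw [h1, h2]; rfl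
    | add a b ha hb => rw [NN_add]; simp only [LinearMap.add_apply, map_add, ha, hb]
    | smul r a ha => rw [NN_smul]; simp only [LinearMap.smul_apply, map_smul, ha]
  | add a b ha hb => simp only [LinearMap.add_apply, map_add, ha, hb]
  | smul r a ha => simp only [LinearMap.smul_apply, map_smul, ha]

/-- post-composition -/
def post (φ : M →ₗ[ℂ] M') : WW ι s t M →ₗ[ℂ] WW ι s t M' where
  toFun F α β := φ (F α β)
  map_add' _ _ := by ext; simp
  map_smul' _ _ := by ext; simp

lemma post_apply (φ : M →ₗ[ℂ] M') (F : WW ι s t M) (α : ι × Bool → s) (β : ι × Bool → t) :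
    post φ F α β = φ (F α β) := rfl

lemma post_Lam (φ : M →ₗ[ℂ] M') (x : AA ι) (F : WW ι s t M) :
    post φ (Lam x F) = Lam x (post φ F) := by
  induction x using MonoidAlgebra.induction_on with
  | of g =>
    have h1 := Lam_uu (M := M) (s := s) (t := t) g
    have h2 := Lam_uu (M := M') (s := s) (t := t) g
    unfold uu at h1 h2
    rw [h1, h2]; rfl
  | add a b ha hb => simp only [LinearMap.add_apply, map_add, ha, hb]
  | smul r a ha => simp only [LinearMap.smul_apply, map_smul, ha]

lemma post_NN (φ : M →ₗ[ℂ] M') (x : AA ι) (F : WW ι s t M) :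
    post φ (NN x F) = NN x (post φ F) := by
  induction x using MonoidAlgebra.induction_on with
  | of g =>
    have h1 := NN_uu (M := M) (s := s) (t := t) g
    have h2 := NN_uu (M := M') (s := s) (t := t) g
    unfold uu at h1 h2
    rw [h1, h2]; rfl
  | add a b ha hb => simp only [NN_add, LinearMap.add_apply, map_add, ha, hb]
  | smul r a ha => simp only [NN_smul, LinearMap.smul_apply, map_smul, ha]

lemma Lam_ee_eq (g : GG ι) (F : WW ι s t M) (α : ι × Bool → s) (β : ι × Bool → t) :
    Lam (ee ι * uu g) F α β =
      (Fintype.card (ι → Bool) : ℂ)⁻¹ • ∑ c : ι → Bool, F (α ∘ (fl c * g : GG ι)) β := by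
  unfold ee
  rw [smul_mul_assoc, Finset.sum_mul, map_smul, map_sum]
  simp only [← uu_mul, Lam_uu, LinearMap.smul_apply, Pi.smul_apply, LinearMap.sum_apply,
    Finset.sum_apply, lam_apply]

lemma NN_ee_eq (g : GG ι) (F : WW ι s t M) (α : ι × Bool → s) (β : ι × Bool → t) :
    NN (uu g * ee ι) F α β =
      (Fintype.card (ι → Bool) : ℂ)⁻¹ • ∑ c : ι → Bool, F α (β ∘ (fl c * g⁻¹ : GG ι)) := by
  change NNl _ F α β = _
  unfold ee
  rw [mul_smul_comm, Finset.mul_sum, map_smul, map_sum]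
  simp only [← uu_mul, LinearMap.smul_apply, Pi.smul_apply, LinearMap.sum_apply,
    Finset.sum_apply]
  congr 1
  refine Finset.sum_congr rfl fun c _ => ?_
  change NN _ F α β = _
  rw [NN_uu, rho_apply, mul_inv_rev, fl_inv]

lemma Lam_ee_fix (F : WW ι s t M) (h : ∀ c, lam ι s t M (fl c) F = F) : Lam (ee ι) F = F := by
  have := ee_avg ((LinearMap.applyₗ F) ∘ₗ (Lam (M := M) (s := s) (t := t) (ι := ι)).toLinearMap) F (by
    intro c
    change Lam (uu (fl c)) F = F
    rw [Lam_uu, h])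
  exact this

lemma NN_ee_fix (F : WW ι s t M) (h : ∀ c, rho ι s t M (fl c) F = F) : NN (ee ι) F = F := by
  have := ee_avg ((LinearMap.applyₗ F) ∘ₗ (NNl (M := M) (s := s) (t := t) (ι := ι))) F (by
    intro c
    change NN (uu (fl c)) F = F
    rw [NN_uu, fl_inv, h])
  exact this

/-- group algebra elements that can be moved across `F` -/
noncomputable def KK (F : WW ι s t M) : Submodule ℂ (AA ι) where
  carrier := {x | Lam (ee ι * x) F = NN (x * ee ι) F}
  zero_mem' := by
    change Lam (ee ι * 0) F = NNl (0 * ee ι) F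
    simp
  add_mem' := by
    intro a b ha hb
    simp only [Set.mem_ofPred_eq] at *
    rw [mul_add, map_add, add_mul, NN_add, LinearMap.add_apply, LinearMap.add_apply, ha, hb]
  smul_mem' := by
    intro c a ha
    simp only [Set.mem_ofPred_eq] at *
    rw [mul_smul_comm, map_smul, smul_mul_assoc, NN_smul, LinearMap.smul_apply,
      LinearMap.smul_apply, ha]

lemma mem_KK (F : WW ι s t M) (x : AA ι) : x ∈ KK F ↔ Lam (ee ι * x) F = NN (x * ee ι) F := Iff.rfl

lemma good_KK (F : WW ι s t M) (h1 : ∀ c, lam ι s t M (fl c) F = F)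
    (h2 : ∀ c, rho ι s t M (fl c) F = F)
    (h3 : ∀ σ, lam ι s t M (dg σ) (rho ι s t M (dg σ) F) = F)
    (two : ∀ i j, i ≠ j → uu (lay (Equiv.swap i j)) ∈ KK F)
    (three : ∀ i j l, i ≠ j → j ≠ l → i ≠ l → uu (lay (Equiv.swap l j * Equiv.swap i l)) ∈ KK F) :
    Good (KK F) where
  ee_iff x := by
    rw [mem_KK, mem_KK]
    have e1 : Lam (ee ι * (ee ι * x * ee ι)) F = Lam (ee ι * x) F := by
      rw [← mul_assoc, ← mul_assoc, ee_ee, map_mul, Module.End.mul_apply, Lam_ee_fix F h1]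
    have e2 : NN (ee ι * x * ee ι * ee ι) F = NN (x * ee ι) F := by
      rw [mul_assoc, ee_ee, mul_assoc, NN_mul, Module.End.mul_apply, NN_ee_fix F h2]
    rw [e1, e2]
  mul x y hx hy := by
    rw [mem_KK] at *
    have e1 : ee ι * (x * ee ι * y) = (ee ι * x) * (ee ι * y) := by simp only [mul_assoc]
    have e2 : x * ee ι * y * ee ι = (x * ee ι) * (y * ee ι) := by simp only [mul_assoc]
    rw [e1, e2, map_mul, NN_mul, Module.End.mul_apply, Module.End.mul_apply, hy, Lam_NN_comm, hx]
  dg σ := by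
    rw [mem_KK, ← dg_ee, map_mul, Module.End.mul_apply, Lam_ee_fix F h1, dg_ee, NN_mul,
      Module.End.mul_apply, NN_ee_fix F h2, Lam_uu, NN_uu]
    have := h3 σ⁻¹
    have hi : (dg σ)⁻¹ = dg σ⁻¹ := by
      rw [inv_eq_iff_mul_eq_one, ← dg_mul, mul_inv_cancel, dg_one]
    rw [hi]
    conv_lhs => rw [← this]
    rw [← Module.End.mul_apply, ← map_mul, ← dg_mul, mul_inv_cancel, dg_one, map_one]
    rfl
  two := two
  three := three

/-- The key transfer statement. -/
theorem exists_invariant (F : WW ι s t M) (h1 : ∀ c, lam ι s t M (fl c) F = F)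
    (hK : ∀ g, uu g ∈ KK F) :
    ∃ F' : WW ι s t M, (∀ (g : GG ι) α β, F' (α ∘ g) (β ∘ g) = F' α β) ∧ NN (ee ι) F' = F := by
  obtain ⟨b, hb⟩ := exists_unit (ι := ι)
  refine ⟨∑ g : GG ι, Lam (uu g * (b * ee ι)) (NN (uu g⁻¹) F), ?_, ?_⟩
  · intro k α β
    simp only [Finset.sum_apply]
    apply Fintype.sum_bijective (fun g : GG ι => k * g) (Group.mulLeft_bijective k)
    intro g
    rw [mul_inv_rev, uu_mul, uu_mul, NN_mul, mul_assoc, map_mul Lam (uu k), Lam_uu, NN_uu k⁻¹]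
    rw [Module.End.mul_apply, lam_apply, inv_inv]
    have e := Lam_NN_comm (uu g * (b * ee ι)) (uu k⁻¹) (NN (uu g⁻¹) F)
    rw [NN_uu k⁻¹, inv_inv] at e
    rw [Module.End.mul_apply, e]
    rfl
  · rw [map_sum]
    have : ∀ g : GG ι, NN (ee ι) (Lam (uu g * (b * ee ι)) (NN (uu g⁻¹) F)) =
        Lam (uu g * (b * ee ι) * uu g⁻¹) F := by
      intro g
      rw [← Lam_NN_comm, ← Module.End.mul_apply (NN (ee ι)), ← NN_mul, ← (mem_KK F _).1 (hK g⁻¹),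
        ← Module.End.mul_apply, ← map_mul]
      congr 2
      simp only [mul_assoc]
      rw [← mul_assoc (ee ι) (ee ι), ee_ee]
    rw [Finset.sum_congr rfl (fun g _ => this g)]
    have e : (∑ g : GG ι, Lam (uu g * (b * ee ι) * uu g⁻¹) F) =
        Lam (∑ k : GG ι, uu k * (b * ee ι) * uu k⁻¹) F := by
      rw [map_sum, LinearMap.sum_apply]
    rw [e]
    conv_lhs => rw [← Lam_ee_fix F h1]
    rw [← Module.End.mul_apply, ← map_mul, hb, Lam_ee_fix F h1]

end bimod

section concrete
variable {m n : ℕ} {ι : Type} [Fintype ι] [DecidableEq ι]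

/-- index of an unordered quadruple -/
def yidx (a b : Fin m) (c d : Fin n) : PermIdx m n :=
  ⟨((min a b, max a b), (min c d, max c d)), min_le_max, min_le_max⟩

lemma yidx_comm1 (a b : Fin m) (c d : Fin n) : yidx a b c d = yidx b a c d := by
  apply Subtype.ext
  change ((min a b, max a b), (min c d, max c d)) = ((min b a, max b a), (min c d, max c d))
  rw [min_comm a b, max_comm a b]

lemma yidx_comm2 (a b : Fin m) (c d : Fin n) : yidx a b c d = yidx a b d c := by
  apply Subtype.ext
  change ((min a b, max a b), (min c d, max c d)) = ((min a b, max a b), (min d c, max d c))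
  rw [min_comm c d, max_comm c d]

lemma yidx_self (w : PermIdx m n) : yidx w.1.1.1 w.1.1.2 w.1.2.1 w.1.2.2 = w := by
  obtain ⟨⟨⟨a, b⟩, ⟨c, d⟩⟩, h1, h2⟩ := w
  apply Subtype.ext
  simp only at h1 h2
  simp [yidx, h1, h2]

lemma perm_yidx (a b : Fin m) (c d : Fin n) :
    perm (yidx a b c d) = X (a, c) * X (b, d) + X (a, d) * X (b, c) := by
  unfold perm yidx
  rcases le_total a b with h1 | h1 <;> rcases le_total c d with h2 | h2 <;> simp [h1, h2] <;> ring

lemma perm_ne_zero (w : PermIdx m n) : perm w ≠ 0 := by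
  intro h
  have := congrArg (MvPolynomial.eval (fun _ => (1 : ℂ))) h
  simp [perm] at this

/-- the variable attached to block `k` of the two tableaux -/
noncomputable def yk (k : ι) (α : ι × Bool → Fin m) (β : ι × Bool → Fin n) :
    MvPolynomial (PermIdx m n) ℂ :=
  X (yidx (α (k, false)) (α (k, true)) (β (k, false)) (β (k, true)))

/-- partial product of variables -/
noncomputable def YT (T : Finset ι) : WW ι (Fin m) (Fin n) (MvPolynomial (PermIdx m n) ℂ) :=
  fun α β => ∏ k ∈ T, yk k α β

/-- product of matrix entries -/
noncomputable def XX : WW ι (Fin m) (Fin n) (MvPolynomial (Fin m × Fin n) ℂ) :=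
  fun α β => ∏ p : ι × Bool, X (α p, β p)

/-- exponent vector of `XX` -/
noncomputable def expo (α : ι × Bool → Fin m) (β : ι × Bool → Fin n) : Fin m × Fin n →₀ ℕ :=
  ∑ p : ι × Bool, Finsupp.single (α p, β p) 1

lemma XX_eq (α : ι × Bool → Fin m) (β : ι × Bool → Fin n) : XX α β = monomial (expo α β) 1 := by
  unfold XX expo
  rw [monomial_sum_one]
  rfl

lemma expo_eq (α α' : ι × Bool → Fin m) (β β' : ι × Bool → Fin n) (h : expo α β = expo α' β') :
    ∃ g : GG ι, α = α' ∘ g ∧ β = β' ∘ g := by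
  have h1 : ∀ v : Fin m × Fin n, Fintype.card {p : ι × Bool // (α p, β p) = v} =
      Fintype.card {p : ι × Bool // (α' p, β' p) = v} := by
    intro v
    have := DFunLike.congr_fun h v
    unfold expo at this
    rw [Finsupp.finsetSum_apply, Finsupp.finsetSum_apply] at this
    simp only [Finsupp.single_apply, Finset.sum_boole, Nat.cast_id] at this
    rw [Fintype.card_subtype, Fintype.card_subtype]
    exact this
  let E : GG ι := Equiv.ofFiberEquiv (f := fun p => (α p, β p)) (g := fun p => (α' p, β' p))
    (fun v => Fintype.equivOfCardEq (h1 v))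
  have hE : ∀ p, (α' (E p), β' (E p)) = (α p, β p) :=
    fun p => Equiv.ofFiberEquiv_map (f := fun p => (α p, β p)) (g := fun p => (α' p, β' p)) _ p
  exact ⟨E, funext fun p => (congrArg Prod.fst (hE p)).symm,
    funext fun p => (congrArg Prod.snd (hE p)).symm⟩

lemma XX_inv (g : GG ι) (α : ι × Bool → Fin m) (β : ι × Bool → Fin n) :
    XX (α ∘ g) (β ∘ g) = XX α β := by
  unfold XX
  exact Equiv.prod_comp g (fun p => X (α p, β p))

lemma Lam_XX (x : AA ι) : Lam x (XX (m := m) (n := n)) = NN x XX := by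
  induction x using MonoidAlgebra.induction_on with
  | of g =>
    change Lam (uu g) _ = NN (uu g) _
    rw [Lam_uu, NN_uu]
    ext1 α; ext1 β
    rw [lam_apply, rho_apply]
    have := XX_inv g α (β ∘ (g⁻¹ : GG ι))
    rw [← this]
    congr 1
    ext p
    simp
  | add a b ha hb => rw [map_add, NN_add, LinearMap.add_apply, LinearMap.add_apply, ha, hb]
  | smul r a ha => rw [map_smul, NN_smul, LinearMap.smul_apply, LinearMap.smul_apply, ha]

lemma Psi_Y (α : ι × Bool → Fin m) (β : ι × Bool → Fin n) :
    PsiBar m n (YT Finset.univ α β) = ∑ c : ι → Bool, XX α (β ∘ (fl c : GG ι)) := by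
  unfold YT XX PsiBar
  rw [map_prod]
  have h : ∀ k : ι, aeval perm (yk k α β) = ∑ b : Bool,
      (X (α (k, false), β (k, xor false b)) * X (α (k, true), β (k, xor true b)) :
        MvPolynomial (Fin m × Fin n) ℂ) := by
    intro k
    unfold yk
    rw [aeval_X, perm_yidx, Fintype.sum_bool]
    simp [add_comm]
  rw [Finset.prod_congr rfl (fun k _ => h k), Finset.prod_univ_sum, Fintype.piFinset_univ]
  refine Finset.sum_congr rfl fun c _ => ?_
  rw [Fintype.prod_prod_type]
  refine Finset.prod_congr rfl fun k _ => ?_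
  rw [Fintype.prod_bool, mul_comm]
  rfl

lemma post_Psi_Y : post (PsiBar m n).toLinearMap (YT (ι := ι) Finset.univ) =
    (Fintype.card (ι → Bool) : ℂ) • NN (ee ι) XX := by
  ext1 α; ext1 β
  rw [post_apply, Pi.smul_apply, Pi.smul_apply]
  have := NN_ee_eq 1 (XX (m := m) (n := n)) α β
  rw [uu_one, one_mul] at this
  rw [this, smul_smul, mul_inv_cancel₀ card_ne, one_smul]
  simp only [inv_one, mul_one]
  exact Psi_Y α β

lemma post_Psi_rel (x : AA ι) : post (PsiBar m n).toLinearMap (Lam (ee ι * x) (YT Finset.univ)) =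
    post (PsiBar m n).toLinearMap (NN (x * ee ι) (YT Finset.univ)) := by
  rw [post_Lam, post_NN, post_Psi_Y, map_smul, map_smul, ← Lam_XX, ← Module.End.mul_apply, ← map_mul,
    Lam_XX, Lam_XX, ← Module.End.mul_apply, ← NN_mul, mul_assoc]

lemma yk_lam (k : ι) (g : GG ι) (hg : ∀ b, g (k, b) = (k, b)) (c : ι → Bool)
    (α : ι × Bool → Fin m) (β : ι × Bool → Fin n) :
    yk k (α ∘ (fl c * g : GG ι)) β = yk k α β := by
  unfold yk
  simp only [Function.comp_apply, Equiv.Perm.coe_mul, hg, fl_apply]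
  cases c k
  · rfl
  · simp only [Bool.xor_true, Bool.not_false, Bool.not_true]; rw [yidx_comm1]

lemma yk_rho (k : ι) (g : GG ι) (hg : ∀ b, g (k, b) = (k, b)) (c : ι → Bool)
    (α : ι × Bool → Fin m) (β : ι × Bool → Fin n) :
    yk k α (β ∘ (fl c * g : GG ι)) = yk k α β := by
  unfold yk
  simp only [Function.comp_apply, Equiv.Perm.coe_mul, hg, fl_apply]
  cases c k
  · rfl
  · simp only [Bool.xor_true, Bool.not_false, Bool.not_true]; rw [yidx_comm2]

/-- the ideal generated by the low degree relations -/
noncomputable abbrev JJ (m n : ℕ) : Ideal (MvPolynomial (PermIdx m n) ℂ) :=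
  Ideal.span {f | f ∈ RingHom.ker (PsiBar m n) ∧ (f.IsHomogeneous 2 ∨ f.IsHomogeneous 3)}

lemma YT_homog (T : Finset ι) (α : ι × Bool → Fin m) (β : ι × Bool → Fin n) :
    (YT T α β).IsHomogeneous T.card := by
  unfold YT
  have := IsHomogeneous.prod T (fun k => yk k α β) (fun _ => 1) (fun k _ => isHomogeneous_X _ _)
  simpa using this

lemma low_mem (T : Finset ι) (hT : T.card = 2 ∨ T.card = 3) (g : GG ι)
    (hg : ∀ k, k ∉ T → ∀ b, g (k, b) = (k, b)) (α : ι × Bool → Fin m) (β : ι × Bool → Fin n) :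
    Lam (ee ι * uu g) (YT Finset.univ) α β - NN (uu g * ee ι) (YT Finset.univ) α β ∈ JJ m n := by
  have hg' : ∀ k, k ∉ T → ∀ b, g⁻¹ (k, b) = (k, b) := by
    intro k hk b
    rw [Equiv.Perm.inv_eq_iff_eq, hg k hk]
  set D : MvPolynomial (PermIdx m n) ℂ :=
    Lam (ee ι * uu g) (YT T) α β - NN (uu g * ee ι) (YT T) α β with hD
  have hsplit : ∀ α β, YT (m := m) (n := n) (Finset.univ : Finset ι) α β = YT Tᶜ α β * YT T α β := by
    intro α β
    unfold YT
    rw [mul_comm, Finset.prod_mul_prod_compl]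
  have e1 : Lam (ee ι * uu g) (YT Finset.univ) α β - NN (uu g * ee ι) (YT Finset.univ) α β =
      YT Tᶜ α β * D := by
    rw [hD, Lam_ee_eq, NN_ee_eq, Lam_ee_eq, NN_ee_eq, mul_sub, mul_smul_comm, mul_smul_comm,
      Finset.mul_sum, Finset.mul_sum]
    congr 2
    · refine Finset.sum_congr rfl fun c _ => ?_
      rw [hsplit]
      congr 1
      refine Finset.prod_congr rfl fun k hk => ?_
      exact yk_lam k g (hg k (by simpa using hk)) c α β
    · refine Finset.sum_congr rfl fun c _ => ?_
      rw [hsplit]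
      congr 1
      refine Finset.prod_congr rfl fun k hk => ?_
      exact yk_rho k g⁻¹ (hg' k (by simpa using hk)) c α β
  rw [e1]
  apply Ideal.mul_mem_left
  apply Ideal.subset_span
  have hDh : D.IsHomogeneous T.card := by
    rw [← mem_homogeneousSubmodule, hD, Lam_ee_eq, NN_ee_eq]
    apply Submodule.sub_mem
    · exact Submodule.smul_mem _ _ (Submodule.sum_mem _ fun c _ => YT_homog T _ _)
    · exact Submodule.smul_mem _ _ (Submodule.sum_mem _ fun c _ => YT_homog T _ _)
  refine ⟨?_, ?_⟩
  · rw [RingHom.mem_ker]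
    have h0 : PsiBar m n (YT Tᶜ α β * D) = 0 := by
      rw [← e1, map_sub, sub_eq_zero]
      exact congrFun (congrFun (post_Psi_rel (m := m) (n := n) (uu g)) α) β
    rw [map_mul] at h0
    refine (mul_eq_zero.1 h0).resolve_left ?_
    unfold YT
    rw [map_prod]
    refine Finset.prod_ne_zero_iff.2 fun k _ => ?_
    unfold yk PsiBar
    rw [aeval_X]
    exact perm_ne_zero _
  · rcases hT with h | h
    · left; rwa [h] at hDh
    · right; rwa [h] at hDh

/-- quotient map -/
noncomputable abbrev qq (m n : ℕ) :
    MvPolynomial (PermIdx m n) ℂ →ₗ[ℂ] (MvPolynomial (PermIdx m n) ℂ ⧸ JJ m n) :=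
  (Ideal.Quotient.mkₐ ℂ (JJ m n)).toLinearMap

lemma low_KK (T : Finset ι) (hT : T.card = 2 ∨ T.card = 3) (g : GG ι)
    (hg : ∀ k, k ∉ T → ∀ b, g (k, b) = (k, b)) :
    uu g ∈ KK (post (qq m n) (YT (ι := ι) Finset.univ)) := by
  rw [mem_KK, ← post_Lam, ← post_NN]
  ext1 α; ext1 β
  rw [post_apply, post_apply]
  exact Ideal.Quotient.eq.2 (low_mem T hT g hg α β)

lemma Y_good : Good (KK (post (qq m n) (YT (ι := ι) Finset.univ))) := by
  apply good_KK
  · intro c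
    ext1 α; ext1 β
    rw [lam_apply, post_apply, post_apply]
    congr 1
    refine Finset.prod_congr rfl fun k _ => ?_
    simpa using yk_lam k 1 (fun _ => rfl) c α β
  · intro c
    ext1 α; ext1 β
    rw [rho_apply, post_apply, post_apply]
    congr 1
    refine Finset.prod_congr rfl fun k _ => ?_
    simpa using yk_rho k 1 (fun _ => rfl) c α β
  · intro σ
    ext1 α; ext1 β
    rw [lam_apply, rho_apply, post_apply, post_apply]
    congr 1
    exact Equiv.prod_comp σ (fun k => yk k α β)
  · intro i j hij
    apply low_KK {i, j} (Or.inl (Finset.card_pair hij))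
    intro k hk b
    simp only [Finset.mem_insert, Finset.mem_singleton, not_or] at hk
    rw [lay_apply, Equiv.swap_apply_of_ne_of_ne hk.1 hk.2]
    simp
  · intro i j l hij hjl hil
    apply low_KK {i, j, l} (Or.inr (Finset.card_eq_three.2 ⟨i, j, l, hij, hil, hjl, rfl⟩))
    intro k hk b
    simp only [Finset.mem_insert, Finset.mem_singleton, not_or] at hk
    rw [lay_apply, Equiv.Perm.mul_apply, Equiv.swap_apply_of_ne_of_ne hk.1 hk.2.2,
      Equiv.swap_apply_of_ne_of_ne hk.2.2 hk.2.1]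
    simp

open Classical in
lemma factor {M : Type} [AddCommGroup M] [Module ℂ M] (F : WW ι (Fin m) (Fin n) M)
    (hF : ∀ (g : GG ι) α β, F (α ∘ g) (β ∘ g) = F α β) :
    ∃ φ : MvPolynomial (Fin m × Fin n) ℂ →ₗ[ℂ] M, F = post φ XX := by
  refine ⟨(basisMonomials (Fin m × Fin n) ℂ).constr ℂ (fun u =>
    if h : ∃ p : (ι × Bool → Fin m) × (ι × Bool → Fin n), expo p.1 p.2 = u then
      F h.choose.1 h.choose.2 else 0), ?_⟩
  ext1 α; ext1 β
  have hb : (monomial (expo α β) (1 : ℂ)) = basisMonomials _ ℂ (expo α β) := by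
    simp [coe_basisMonomials]
  rw [post_apply, XX_eq, hb, Module.Basis.constr_basis]
  have h : ∃ p : (ι × Bool → Fin m) × (ι × Bool → Fin n), expo p.1 p.2 = expo α β := ⟨(α, β), rfl⟩
  rw [dif_pos h]
  obtain ⟨g, h1, h2⟩ := expo_eq _ _ _ _ h.choose_spec
  rw [h1, h2, hF]

lemma homog_mem (d : ℕ) (f : MvPolynomial (PermIdx m n) ℂ) (hf : f.IsHomogeneous d)
    (hk : PsiBar m n f = 0) : f ∈ JJ m n := by
  classical
  have hw : ∀ u ∈ f.support, ∃ p : (Fin d × Bool → Fin m) × (Fin d × Bool → Fin n),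
      YT Finset.univ p.1 p.2 = monomial u (1 : ℂ) := by
    intro u hu
    have hdeg : u.degree = d := by
      have := hf (mem_support_iff.1 hu)
      rwa [Finsupp.degree_eq_weight_one]
    have hc : (Finsupp.toMultiset u).card = d := by
      rw [← hdeg, Finsupp.card_toMultiset]; rfl
    obtain ⟨L, hL⟩ := Quot.exists_rep (Finsupp.toMultiset u)
    change (L : Multiset (PermIdx m n)) = _ at hL
    have hLd : L.length = d := by rw [← hc, ← hL]; rfl
    subst hLd
    refine ⟨(fun p => if p.2 then (L.get p.1).1.1.2 else (L.get p.1).1.1.1,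
      fun p => if p.2 then (L.get p.1).1.2.2 else (L.get p.1).1.2.1), ?_⟩
    unfold YT
    have : ∀ k : Fin L.length, yk k (fun p : Fin L.length × Bool => if p.2 then (L.get p.1).1.1.2 else (L.get p.1).1.1.1)
      (fun p => if p.2 then (L.get p.1).1.2.2 else (L.get p.1).1.2.1) = X (L.get k) := by
      intro k
      unfold yk
      simp [yidx_self]
    rw [Finset.prod_congr rfl (fun k _ => this k)]
    have e : u = ∑ k : Fin L.length, Finsupp.single (L.get k) 1 := by
      apply Multiset.toFinsupp.symm.injective
      change Finsupp.toMultiset u = Finsupp.toMultiset _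
      rw [map_sum, ← hL]
      simp only [Finsupp.toMultiset_single, one_smul]
      conv_lhs => rw [← List.ofFn_get L]
      rw [← Fin.univ_val_map]
      rw [← Multiset.sum_map_singleton (Multiset.map _ _), Multiset.map_map]
      rfl
    conv_rhs => rw [e]
    rw [monomial_sum_one]
    rfl
  by_cases hf0 : f = 0
  · rw [hf0]; exact Ideal.zero_mem _
  obtain ⟨u0, hu0⟩ := support_nonempty.2 hf0
  have : Nonempty ((Fin d × Bool → Fin m) × (Fin d × Bool → Fin n)) := ⟨(hw u0 hu0).choose⟩
  choose! p hp using hw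
  let ℓ (M : Type) [AddCommGroup M] [Module ℂ M] : WW (Fin d) (Fin m) (Fin n) M → M :=
    fun F => ∑ u ∈ f.support, f.coeff u • F (p u).1 (p u).2
  have hpost : ∀ {M M' : Type} [AddCommGroup M] [Module ℂ M] [AddCommGroup M'] [Module ℂ M']
      (φ : M →ₗ[ℂ] M') (F : WW (Fin d) (Fin m) (Fin n) M), ℓ M' (post φ F) = φ (ℓ M F) := by
    intro M M' _ _ _ _ φ F
    simp only [ℓ, map_sum, map_smul, post_apply]
  have hY : ℓ _ (YT Finset.univ) = f := by
    conv_rhs => rw [f.as_sum]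
    refine Finset.sum_congr rfl fun u hu => ?_
    rw [hp u hu, smul_monomial, smul_eq_mul, mul_one]
  have h0 : ℓ _ (NN (ee (Fin d)) (XX (m := m) (n := n))) = 0 := by
    have h1 := hpost (PsiBar m n).toLinearMap (YT Finset.univ)
    rw [hY, post_Psi_Y] at h1
    have h2 : ℓ _ ((Fintype.card (Fin d → Bool) : ℂ) • NN (ee (Fin d)) (XX (m := m) (n := n))) =
        (Fintype.card (Fin d → Bool) : ℂ) • ℓ _ (NN (ee (Fin d)) (XX (m := m) (n := n))) := by
      simp only [ℓ, Finset.smul_sum, Pi.smul_apply]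
      refine Finset.sum_congr rfl fun u _ => ?_
      rw [smul_comm]
    rw [h2] at h1
    have h3 : (PsiBar m n).toLinearMap f = 0 := hk
    rw [h3] at h1
    exact (smul_eq_zero.1 h1).resolve_left card_ne
  have hgood := Y_good (m := m) (n := n) (ι := Fin d)
  obtain ⟨F', hF', hNF⟩ := exists_invariant (post (qq m n) (YT (ι := Fin d) Finset.univ)) (by
    intro c
    ext1 α; ext1 β
    rw [lam_apply, post_apply, post_apply]
    congr 1
    refine Finset.prod_congr rfl fun k _ => ?_
    simpa using yk_lam k 1 (fun _ => rfl) c α β) hgood.all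
  obtain ⟨φ, hφ⟩ := factor F' hF'
  rw [hφ, ← post_NN] at hNF
  have h5 := hpost (qq m n) (YT (ι := Fin d) Finset.univ)
  rw [← hNF, hpost φ, h0, map_zero, hY] at h5
  exact Ideal.Quotient.eq_zero_iff_mem.1 h5.symm

lemma perm_homog (w : PermIdx m n) : (perm w).IsHomogeneous 2 := by
  unfold perm
  exact ((isHomogeneous_X _ _).mul (isHomogeneous_X _ _)).add
    ((isHomogeneous_X _ _).mul (isHomogeneous_X _ _))

lemma comp_ker (f : MvPolynomial (PermIdx m n) ℂ) (hf : PsiBar m n f = 0) (d : ℕ) :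
    PsiBar m n (homogeneousComponent d f) = 0 := by
  classical
  have hh : ∀ i, (PsiBar m n (homogeneousComponent i f)).IsHomogeneous (2 * i) := fun i =>
    (homogeneousComponent_isHomogeneous i f).aeval _ perm_homog
  have h1 := congrArg (fun q => homogeneousComponent (2 * d) (PsiBar m n q)) (sum_homogeneousComponent f)
  simp only [hf, map_zero, map_sum] at h1
  have h2 : ∀ i, homogeneousComponent (2 * d) (PsiBar m n (homogeneousComponent i f)) =
      if i = d then PsiBar m n (homogeneousComponent d f) else 0 := by
    intro i
    rw [homogeneousComponent_of_mem (hh i)]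
    by_cases h : i = d
    · simp [h]
    · rw [if_neg h, if_neg (by omega)]
  simp only [h2, Finset.sum_ite_eq', Finset.mem_range] at h1
  by_cases hd : d < f.totalDegree + 1
  · rwa [if_pos hd] at h1
  · rw [homogeneousComponent_eq_zero _ _ (by omega), map_zero]

theorem main (m n : ℕ) : RingHom.ker (PsiBar m n) = JJ m n := by
  apply le_antisymm
  · intro f hf
    rw [← sum_homogeneousComponent f]
    refine Ideal.sum_mem _ fun d _ => ?_
    exact homog_mem d _ (homogeneousComponent_isHomogeneous d f) (comp_ker f hf d)
  · rw [Ideal.span_le]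
    intro f hf
    exact hf.1

end concrete

end PermRel

/-- The ideal of relations among the generalized 2×2 permanents of a generic
`m × n` matrix is generated by its homogeneous elements of degrees 2 and 3. -/
theorem relations_permanents_generated_in_degrees_two_and_three (m n : ℕ)
    (hm : 1 ≤ m) (hn : 1 ≤ n) :
    RingHom.ker (PsiBar m n) =
      Ideal.span {f | f ∈ RingHom.ker (PsiBar m n) ∧
        (f.IsHomogeneous 2 ∨ f.IsHomogeneous 3)} := by
  exact PermRel.main m n
end
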